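/- Let (K,h,δ) be a marked strongly invertible knot. If S is an invariant Seifert surface for (K,h,δ) and Š = π(S) is its image under the quotient projection π: S³ → S³/h, then the first Betti numbers satisfy β₁(S) = 2·β₁(Š). -/

import Mathlib

open Set Function Metric Topology Manifold
open scoped Manifold

noncomputable section

/-! ### Basic spaces: the 3-sphere and the circle -/

/-- Euclidean 4-space. -/
abbrev E4 : Type := EuclideanSpace ℝ (Fin 4)
/-- Euclidean 2-space. -/
abbrev E2 : Type := EuclideanSpace ℝ (Fin 2)
/-- Euclidean 3-space. -/
abbrev E3 : Type := EuclideanSpace ℝ (Fin 3)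

/-- The 3-sphere `S³`, realized as the unit sphere in `ℝ⁴`. -/
abbrev S3 : Type := Metric.sphere (0 : E4) 1
/-- The circle `S¹`, realized as the unit sphere in `ℝ²`. -/
abbrev Circle1 : Type := Metric.sphere (0 : E2) 1

/-- A subset of `S³` which is a topological circle (simple loop). -/
def IsCircleSet (A : Set S3) : Prop := Nonempty (A ≃ₜ Circle1)

/-- A subset of `S³` which is a topological arc. -/
def IsArcSet (A : Set S3) : Prop := Nonempty (A ≃ₜ (Set.Icc (0:ℝ) 1))

/-! ### Isotopies and orientation -/

/-- An (ambient) isotopy of `S³` starting at the identity. -/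
def IsIsotopy (F : ℝ → S3 → S3) : Prop :=
  Continuous (fun p : ℝ × S3 => F p.1 p.2) ∧ (∀ t, IsHomeomorph (F t)) ∧ F 0 = id

/-- A self-map of `S³` is orientation preserving iff it is (a homeomorphism)
isotopic to the identity; for `S³` this is equivalent to the usual notion. -/
def OrientationPreserving (φ : S3 → S3) : Prop := ∃ F, IsIsotopy F ∧ F 1 = φ

/-- An isotopy of the circle. -/
def CircleIsotopy (F : ℝ → Circle1 → Circle1) : Prop :=
  Continuous (fun p : ℝ × Circle1 => F p.1 p.2) ∧ (∀ t, IsHomeomorph (F t)) ∧ F 0 = id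

/-- A self-map of the circle is orientation preserving iff it is isotopic to the identity. -/
def CircleOrientationPreserving (g : Circle1 → Circle1) : Prop :=
  ∃ F, CircleIsotopy F ∧ F 1 = g

/-- A diffeomorphism of `S³` (a smooth map with a smooth inverse). -/
def IsDiffeo (φ : S3 → S3) : Prop :=
  ∃ ψ : S3 → S3, ContMDiff (𝓡 3) (𝓡 3) (⊤ : ℕ∞) φ ∧ ContMDiff (𝓡 3) (𝓡 3) (⊤ : ℕ∞) ψ ∧
    ψ ∘ φ = id ∧ φ ∘ ψ = id

/-! ### Knots -/

/-- A (smooth) knot in `S³`: the image of a smooth embedding of the circle. -/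
def IsKnot (K : Set S3) : Prop :=
  ∃ γ : Circle1 → S3, ContMDiff (𝓡 1) (𝓡 3) (⊤ : ℕ∞) γ ∧ IsEmbedding γ ∧ Set.range γ = K

/-! ### Surfaces with boundary in `S³` -/

/-- The closed half plane, model for boundary points of a surface. -/
def halfPlane : Set (ℝ × ℝ) := {p | 0 ≤ p.1}

/-- `x` is a 2-manifold interior point of `S ⊆ S³`. -/
def IsInteriorPointOf (S : Set S3) (x : S3) : Prop :=
  ∃ U : Set S3, IsOpen U ∧ x ∈ U ∧ Nonempty ((U ∩ S : Set S3) ≃ₜ (ℝ × ℝ))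

/-- `x` is a 2-manifold boundary point of `S ⊆ S³`: some relative neighbourhood of `x`
in `S` is homeomorphic to the closed half plane, with `x` going to the boundary line. -/
def IsBoundaryPointOf (S : Set S3) (x : S3) : Prop :=
  ∃ (U : Set S3) (_ : IsOpen U) (hx : x ∈ U ∩ S) (φ : (U ∩ S : Set S3) ≃ₜ halfPlane),
    ((φ ⟨x, hx⟩ : halfPlane) : ℝ × ℝ).1 = 0

/-- `S` is a compact connected 2-manifold in `S³` with (manifold) boundary the set `B`. -/
def IsSurfaceWithBoundary (S B : Set S3) : Prop :=
  IsCompact S ∧ IsConnected S ∧ B ⊆ S ∧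
  (∀ x ∈ S \ B, IsInteriorPointOf S x) ∧
  (∀ x ∈ B, IsBoundaryPointOf S x)

/-- The relation generating the Möbius band as a quotient of `ℝ × [-1,1]`. -/
def mobiusRel : (ℝ × (Set.Icc (-1:ℝ) 1)) → (ℝ × (Set.Icc (-1:ℝ) 1)) → Prop :=
  fun a b => b.1 = a.1 + 1 ∧ (b.2 : ℝ) = -(a.2 : ℝ)

/-- The Möbius band. -/
def MobiusBand : Type := Quot mobiusRel

instance : TopologicalSpace MobiusBand := by unfold MobiusBand; infer_instance

/-- A surface in `S³` is orientable iff it contains no Möbius band. -/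
def Orientable (S : Set S3) : Prop :=
  ¬ ∃ M : Set S3, M ⊆ S ∧ Nonempty (M ≃ₜ MobiusBand)

/-- `S` has first Betti number `b`: its fundamental group is free of rank `b`
(a correct characterization for compact connected surfaces with nonempty boundary). -/
def HasBetti1 (S : Set S3) (b : ℕ) : Prop :=
  ∃ x : S, Nonempty (FundamentalGroup S x ≃* FreeGroup (Fin b))

/-- The first Betti number of `S`. -/
def betti1 (S : Set S3) : ℕ := sInf {b | HasBetti1 S b}

/-- A compact connected orientable surface with one boundary circle has genus `g`
iff its first Betti number is `2g`. -/
def HasGenus (S : Set S3) (g : ℕ) : Prop := HasBetti1 S (2 * g)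

/-- The genus of a surface. -/
def genusOf (S : Set S3) : ℕ := sInf {g | HasGenus S g}

/-! ### Seifert surfaces and genus -/

/-- A Seifert surface for a knot `K`: a compact connected orientable surface
embedded in `S³` with boundary `K`. -/
def IsSeifertSurface (K S : Set S3) : Prop :=
  IsSurfaceWithBoundary S K ∧ Orientable S

/-- The genus `g(K)` of a knot: the minimal genus of its Seifert surfaces. -/
def knotGenus (K : Set S3) : ℕ := sInf {g | ∃ S, IsSeifertSurface K S ∧ HasGenus S g}

/-- A minimal genus Seifert surface. -/
def IsMinimalSeifertSurface (K S : Set S3) : Prop :=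
  IsSeifertSurface K S ∧ HasGenus S (knotGenus K)

/-! ### Strongly invertible knots -/

/-- A strong inversion of the knot `K`: a smooth involution of `S³` leaving `K`
invariant whose fixed point set is a simple loop meeting `K` in two points. -/
structure StrongInversion (K : Set S3) where
  toFun : S3 → S3
  smooth : ContMDiff (𝓡 3) (𝓡 3) (⊤ : ℕ∞) toFun
  involutive : Function.Involutive toFun
  invariant : toFun '' K = K
  fixCircle : IsCircleSet (Function.fixedPoints toFun)
  fixMeetsK : (Function.fixedPoints toFun ∩ K).ncard = 2

/-- A strongly invertible knot `(K, h)`. -/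
structure SIKnot where
  K : Set S3
  isKnot : IsKnot K
  h : S3 → S3
  smooth : ContMDiff (𝓡 3) (𝓡 3) (⊤ : ℕ∞) h
  involutive : Function.Involutive h
  invariant : h '' K = K
  fixCircle : IsCircleSet (Function.fixedPoints h)
  fixMeetsK : (Function.fixedPoints h ∩ K).ncard = 2

/-- The endpoints of an arc `A`: the non-cut points of `A`. -/
def arcEndpoints (A : Set S3) : Set S3 := {x ∈ A | IsPreconnected (A \ {x})}

/-- The interior of an arc. -/
def arcInterior (A : Set S3) : Set S3 := A \ arcEndpoints A

/-- `δ` is one of the two subarcs of `Fix(h)` bounded by the two points of `Fix(h) ∩ K`. -/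
def IsMarking (K : Set S3) (h : S3 → S3) (δ : Set S3) : Prop :=
  δ ⊆ Function.fixedPoints h ∧ IsArcSet δ ∧ arcEndpoints δ = Function.fixedPoints h ∩ K

/-- A marked strongly invertible knot `(K, h, δ)`. -/
structure MarkedSIK where
  K : Set S3
  isKnot : IsKnot K
  h : S3 → S3
  smooth : ContMDiff (𝓡 3) (𝓡 3) (⊤ : ℕ∞) h
  involutive : Function.Involutive h
  invariant : h '' K = K
  fixCircle : IsCircleSet (Function.fixedPoints h)
  fixMeetsK : (Function.fixedPoints h ∩ K).ncard = 2
  δ : Set S3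
  marking : IsMarking K h δ

/-- An invariant Seifert surface for a marked strongly invertible knot `(K,h,δ)`:
a Seifert surface `S` for `K` with `h(S) = S` and `Fix(h) ∩ S = δ`. -/
def IsInvariantSeifertSurface (K : Set S3) (h : S3 → S3) (δ S : Set S3) : Prop :=
  IsSeifertSurface K S ∧ h '' S = S ∧ Function.fixedPoints h ∩ S = δ

/-- The equivariant genus `g(K,h,δ)`. -/
def equivGenus (K : Set S3) (h : S3 → S3) (δ : Set S3) : ℕ :=
  sInf {g | ∃ S, IsInvariantSeifertSurface K h δ S ∧ HasGenus S g}

/-! ### Equivalence of inversions and marked knots -/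

/-- Two strong inversions are equivalent iff they are conjugate by an
orientation-preserving diffeomorphism of `S³`. -/
def InversionEquiv (h h' : S3 → S3) : Prop :=
  ∃ φ : S3 → S3, IsDiffeo φ ∧ OrientationPreserving φ ∧ ∀ x, h' (φ x) = φ (h x)

/-- Equivalence of marked strongly invertible knots. -/
def MarkedEquiv (M M' : MarkedSIK) : Prop :=
  ∃ φ : S3 → S3, IsDiffeo φ ∧ OrientationPreserving φ ∧
    φ '' M.K = M'.K ∧ (∀ x, M'.h (φ x) = φ (M.h x)) ∧ φ '' M.δ = M'.δ

/-- Isotopy of (Seifert) surfaces: ambient isotopy of `S³` preserving `K` throughout. -/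
def SurfIsotopic (K S S' : Set S3) : Prop :=
  ∃ F : ℝ → S3 → S3, IsIsotopy F ∧ (∀ t, F t '' K = K) ∧ F 1 '' S = S'

/-! ### Special knots -/

/-- The unknot: a knot bounding an embedded disk. -/
def IsUnknot (K : Set S3) : Prop :=
  IsKnot K ∧ ∃ D : Set S3, IsSurfaceWithBoundary D K ∧
    Nonempty (D ≃ₜ (Metric.closedBall (0:E2) 1))

/-- The standard `(p,q)` torus knot on the Clifford torus in `S³`. -/
def stdTorusKnot (p q : ℤ) : Set S3 :=
  {x | ∃ θ : ℝ, ∀ i : Fin 4,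
    (x : E4) i = (Real.sqrt 2)⁻¹ *
      ![Real.cos (p * θ), Real.sin (p * θ), Real.cos (q * θ), Real.sin (q * θ)] i}

/-- A torus knot: the image of a standard torus knot under a diffeomorphism of `S³`. -/
def IsTorusKnot (K : Set S3) : Prop :=
  ∃ p q : ℤ, ∃ φ : S3 → S3, IsDiffeo φ ∧ φ '' stdTorusKnot p q = K

/-- `f` maps `K` to itself preserving its orientation. -/
def PreservesKnotOrientation (f : S3 → S3) (K : Set S3) : Prop :=
  ∃ (γ : Circle1 → S3) (g : Circle1 → Circle1), IsEmbedding γ ∧ Set.range γ = K ∧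
    IsHomeomorph g ∧ (∀ t, f (γ t) = γ (g t)) ∧ CircleOrientationPreserving g

/-- `f` maps `K` to itself reversing its orientation. -/
def ReversesKnotOrientation (f : S3 → S3) (K : Set S3) : Prop :=
  ∃ (γ : Circle1 → S3) (g : Circle1 → Circle1), IsEmbedding γ ∧ Set.range γ = K ∧
    IsHomeomorph g ∧ (∀ t, f (γ t) = γ (g t)) ∧ ¬ CircleOrientationPreserving g

/-- An invertible knot: some orientation-preserving diffeomorphism of `S³` maps `K`
to itself reversing its orientation. -/
def IsInvertibleKnot (K : Set S3) : Prop :=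
  ∃ φ : S3 → S3, IsDiffeo φ ∧ OrientationPreserving φ ∧ φ '' K = K ∧
    ReversesKnotOrientation φ K

/-! ### Hyperbolicity -/

/-- Inverse hyperbolic cosine. -/
def arcosh (x : ℝ) : ℝ := Real.log (x + Real.sqrt (x ^ 2 - 1))

/-- The upper half space model of hyperbolic 3-space. -/
abbrev H3 : Type := {p : E3 // 0 < p 2}

/-- The hyperbolic distance on the upper half space. -/
def hypDist (p q : H3) : ℝ :=
  arcosh (1 + (dist (p : E3) (q : E3)) ^ 2 / (2 * (p : E3) 2 * (q : E3) 2))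

/-- A knot is hyperbolic iff its complement carries a complete metric, compatible with
its topology, which is locally isometric to hyperbolic 3-space. -/
def IsHyperbolicKnot (K : Set S3) : Prop :=
  ∃ d : ↥(Kᶜ) → ↥(Kᶜ) → ℝ,
    (∀ x y, d x y = d y x) ∧
    (∀ x y, d x y = 0 ↔ x = y) ∧
    (∀ x y z, d x z ≤ d x y + d y z) ∧
    (∀ (x : ↥(Kᶜ)) (U : Set ↥(Kᶜ)), U ∈ nhds x ↔ ∃ ε > 0, {y | d x y < ε} ⊆ U) ∧
    (∀ u : ℕ → ↥(Kᶜ), (∀ ε > 0, ∃ N, ∀ m n, N ≤ m → N ≤ n → d (u m) (u n) < ε) →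
      ∃ x, Filter.Tendsto u Filter.atTop (nhds x)) ∧
    (∀ x : ↥(Kᶜ), ∃ ε > 0, ∃ φ : ↥(Kᶜ) → H3,
      (∀ y z : ↥(Kᶜ), d x y < ε → d x z < ε → hypDist (φ y) (φ z) = d y z) ∧
      (∃ r > 0, {w : H3 | hypDist (φ x) w < r} ⊆ φ '' {y | d x y < ε}))

/-! ### Periods -/

/-- `K` has cyclic period 2. -/
def HasCyclicPeriod2 (K : Set S3) : Prop :=
  ∃ f : S3 → S3, ContMDiff (𝓡 3) (𝓡 3) (⊤ : ℕ∞) f ∧ Function.Involutive f ∧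
    OrientationPreserving f ∧ f '' K = K ∧ PreservesKnotOrientation f K ∧
    IsCircleSet (Function.fixedPoints f)

/-- `K` has free period 2. -/
def HasFreePeriod2 (K : Set S3) : Prop :=
  ∃ f : S3 → S3, ContMDiff (𝓡 3) (𝓡 3) (⊤ : ℕ∞) f ∧ Function.Involutive f ∧
    OrientationPreserving f ∧ f '' K = K ∧ PreservesKnotOrientation f K ∧
    Function.fixedPoints f = ∅

/-- `K` admits exactly one strong inversion up to equivalence. -/
def ExactlyOneInversion (K : Set S3) : Prop :=
  ∃ h1 : StrongInversion K, ∀ h2 : StrongInversion K, InversionEquiv h2.toFun h1.toFun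

/-- `K` admits exactly two strong inversions up to equivalence. -/
def ExactlyTwoInversions (K : Set S3) : Prop :=
  ∃ h1 h2 : StrongInversion K, ¬ InversionEquiv h1.toFun h2.toFun ∧
    ∀ h3 : StrongInversion K, InversionEquiv h3.toFun h1.toFun ∨ InversionEquiv h3.toFun h2.toFun

/-! ### Bridge number -/

/-- The height function on `S³`. -/
def heightFn : S3 → ℝ := fun x => (x : E4) 3

/-- A 2-bridge knot: after a diffeomorphism of `S³`, the standard height function
restricted to the knot has exactly two local maxima and two local minima. -/
def Is2Bridge (K : Set S3) : Prop :=
  ∃ φ : S3 → S3, IsDiffeo φ ∧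
    {x : S3 | x ∈ φ '' K ∧ IsLocalMaxOn heightFn (φ '' K) x}.ncard = 2 ∧
    {x : S3 | x ∈ φ '' K ∧ IsLocalMinOn heightFn (φ '' K) x}.ncard = 2

/-! ### Fibered knots -/

/-- `p` exhibits the complement of `K` as a fiber bundle over the circle whose fibers
(together with `K`) are minimal genus Seifert surfaces for `K`. -/
def IsFibration (K : Set S3) (p : ↥(Kᶜ) → Circle1) : Prop :=
  Continuous p ∧ Function.Surjective p ∧
  (∀ c : Circle1, ∃ U : Set Circle1, IsOpen U ∧ c ∈ U ∧
    ∃ φ : ↥(p ⁻¹' U) ≃ₜ U × ↥(p ⁻¹' {c}), ∀ y : ↥(p ⁻¹' U), ((φ y).1 : Circle1) = p y.val) ∧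
  (∀ c : Circle1, IsMinimalSeifertSurface K (closure (Subtype.val '' (p ⁻¹' {c}))))

/-- A fibered knot. -/
def IsFiberedKnot (K : Set S3) : Prop := ∃ p, IsFibration K p

/-- A fiber surface for `K`: the closure of a fiber of a fibration of the complement. -/
def IsFiberSurface (K S : Set S3) : Prop :=
  ∃ p, IsFibration K p ∧ ∃ c : Circle1, S = closure (Subtype.val '' (p ⁻¹' {c}))

/-! ### The quotient under a strong inversion -/

/-- `π : S³ → S³/h ≅ S³` realizes the quotient of `S³` by the involution `h`. -/
def IsQuotProj (h : S3 → S3) (π : S3 → S3) : Prop :=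
  Continuous π ∧ Function.Surjective π ∧ ∀ x y, π x = π y ↔ (y = x ∨ y = h x)

/-- `γ` (a loop disjoint from `O`) has even mod 2 linking number with `O`: it lifts
to any connected double cover of the complement of `O`, i.e. has disconnected preimage. -/
def EvenLinking (O γ : Set S3) : Prop :=
  γ ⊆ Oᶜ ∧
  ∀ (Y : Type) [_i : TopologicalSpace Y] (p : Y → ↥(Oᶜ)),
    IsCoveringMap p → ConnectedSpace Y → (∀ x : ↥(Oᶜ), (p ⁻¹' {x}).ncard = 2) →
    ¬ IsPreconnected (p ⁻¹' {y : ↥(Oᶜ) | (y : S3) ∈ γ})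

/-- `γ` has odd mod 2 linking number with `O`: its preimage in any connected double
cover of the complement of `O` is connected. -/
def OddLinking (O γ : Set S3) : Prop :=
  γ ⊆ Oᶜ ∧
  ∀ (Y : Type) [_i : TopologicalSpace Y] (p : Y → ↥(Oᶜ)),
    IsCoveringMap p → ConnectedSpace Y → (∀ x : ↥(Oᶜ), (p ⁻¹' {x}).ncard = 2) →
    IsPreconnected (p ⁻¹' {y : ↥(Oᶜ) | (y : S3) ∈ γ})

/-- The loop `γ` has an annulus neighbourhood in the surface `S`
(i.e. it is orientation-preserving in `S`). -/
def HasAnnulusNbhd (S γ : Set S3) : Prop :=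
  ∃ N : Set S3, γ ⊆ N ∧ N ⊆ S ∧ (∀ x ∈ γ, N ∈ nhdsWithin x S) ∧
    Nonempty (N ≃ₜ (Circle1 × (Set.Icc (-1:ℝ) 1)))

/-- The loop `γ` has a Möbius band neighbourhood in the surface `S`
(i.e. it is orientation-reversing in `S`). -/
def HasMobiusNbhd (S γ : Set S3) : Prop :=
  ∃ N : Set S3, γ ⊆ N ∧ N ⊆ S ∧ (∀ x ∈ γ, N ∈ nhdsWithin x S) ∧
    Nonempty (N ≃ₜ MobiusBand)

/-- Condition (C): every (embedded) loop in the interior of the surface `Sq` (with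
boundary `bd`) is orientation-preserving or -reversing in `Sq` according to whether its
linking number with `O` is even or odd. -/
def ConditionC (O Sq bd : Set S3) : Prop :=
  ∀ γ : Set S3, γ ⊆ Sq \ bd → IsCircleSet γ →
    (EvenLinking O γ → HasAnnulusNbhd Sq γ) ∧ (OddLinking O γ → HasMobiusNbhd Sq γ)

/-- The band number of a knot `L`: the minimum first Betti number of all
(not necessarily orientable) spanning surfaces for `L`. -/
def bandNumber (L : Set S3) : ℕ :=
  sInf {b | ∃ G : Set S3, IsSurfaceWithBoundary G L ∧ HasBetti1 G b}

/-! ### Two-bridge knots via continued fractions (Schubert presentations) -/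

/-- The value of the continued fraction `[a₁,…,aₘ] = 1/(a₁ - 1/(a₂ - ⋯))`. -/
def cfValQ : List ℤ → ℚ
  | [] => 0
  | a :: t => (a - cfValQ t)⁻¹

/-- The continued fraction `[2,4,2,4,…,2,4]` of length `2n`. -/
def cf24 (n : ℕ) : List ℤ := (List.replicate n [(2:ℤ), 4]).flatten

/-- The Schubert relator word `w = b^{ε₁} a^{ε₂} b^{ε₃} ⋯` with
`εᵢ = (-1)^{⌊iq/p⌋}` for the two-bridge knot `b(p,q)`. -/
def tbWord (p q : ℕ) : FreeGroup (Fin 2) :=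
  ((List.range (p - 1)).map (fun i =>
    (FreeGroup.of (if (i + 1) % 2 = 1 then (1 : Fin 2) else 0)) ^
      ((-1 : ℤ) ^ (((i + 1) * q) / p)))).prod

/-- The relation set of the Schubert presentation `⟨a,b | a w = w b⟩` of the
two-bridge knot group of `b(p,q)`. -/
def twoBridgeRel (p q : ℕ) : Set (FreeGroup (Fin 2)) :=
  { FreeGroup.of 0 * tbWord p q * (FreeGroup.of 1)⁻¹ * (tbWord p q)⁻¹ }

/-- The two-bridge knot group of `b(p,q)`. -/
def TwoBridgeGroup (p q : ℕ) : Type := PresentedGroup (twoBridgeRel p q)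

instance (p q : ℕ) : Group (TwoBridgeGroup p q) := by unfold TwoBridgeGroup; infer_instance

/-- The knot group (fundamental group of the complement) of `K` is isomorphic to `G`. -/
def HasKnotGroup (K : Set S3) (G : Type) [Group G] : Prop :=
  ∃ x : ↥(Kᶜ), Nonempty (FundamentalGroup ↥(Kᶜ) x ≃* G)

/-- `K` is the 2-bridge knot whose slope has the continued fraction expansion
`[2,4,2,4,…,2,4]` of length `2n`: it is a 2-bridge knot whose knot group is the
corresponding two-bridge knot group. -/
def IsCF24TwoBridgeKnot (n : ℕ) (K : Set S3) : Prop :=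
  IsKnot K ∧ Is2Bridge K ∧
  HasKnotGroup K (TwoBridgeGroup (cfValQ (cf24 n)).den (cfValQ (cf24 n)).num.toNat)

/-! ### Exteriors, longitudes, metrics and area (for the minimal surface argument) -/

/-- `A` is isotopic to `B` through embeddings whose images stay in `X`. -/
def IsotopicWithin (A B X : Set S3) : Prop :=
  ∃ H : ℝ → ↥A → S3, Continuous (fun p : ℝ × ↥A => H p.1 p.2) ∧
    (∀ t, IsEmbedding (H t) ∧ Set.range (H t) ⊆ X) ∧
    (H 0 = Subtype.val) ∧ Set.range (H 1) = B

/-- `N` is a (closed) tubular neighbourhood of the knot `K`. -/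
def IsTubularNbhd (K N : Set S3) : Prop :=
  IsCompact N ∧ K ⊆ interior N ∧
  Nonempty (N ≃ₜ (Circle1 × (Metric.closedBall (0:E2) 1)))

/-- `ℓ` is a preferred longitude on the boundary of the tubular neighbourhood `N` of `K`:
a circle in `∂N`, isotopic to `K` within `N`, having linking number `0` with `K`
(equivalently, bounding an orientable surface disjoint from `K`). -/
def IsPreferredLongitude (K N ℓ : Set S3) : Prop :=
  ℓ ⊆ frontier N ∧ IsCircleSet ℓ ∧ IsotopicWithin ℓ K N ∧
  ∃ W : Set S3, IsSurfaceWithBoundary W ℓ ∧ Orientable W ∧ W ∩ K = ∅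

/-- The distance function of a bundled metric space structure. -/
def mdist {X : Type} (m : MetricSpace X) (x y : X) : ℝ :=
  @dist X (m.toPseudoMetricSpace.toDist) x y

/-- The 2-dimensional Hausdorff measure ("area") of a subset, with respect to a
bundled metric space structure. -/
def mArea {X : Type} (m : MetricSpace X) (A : Set X) : ENNReal := by
  letI := m
  letI : MeasurableSpace X := borel X
  letI : BorelSpace X := ⟨rfl⟩
  exact MeasureTheory.Measure.hausdorffMeasure 2 A

/-! ### Local cocycles and their holonomy -/

section Holonomy

open unitInterval Filter

variable {T X A : Type*} [Group A]

/-- `f` satisfies the cocycle identity on `V`. -/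
def CocycleOn (f : X → X → A) (V : Set X) : Prop :=
  ∀ u ∈ V, ∀ v ∈ V, ∀ w ∈ V, f v w * f u v = f u w

/-- `f` satisfies the cocycle identity near `x`. -/
def LocCocycleAt [TopologicalSpace X] (f : X → X → A) (x : X) : Prop :=
  ∃ V ∈ 𝓝 x, CocycleOn f V

lemma CocycleOn.self {f : X → X → A} {V : Set X} (hf : CocycleOn f V) {u : X} (hu : u ∈ V) :
    f u u = 1 := by
  simpa using hf u hu u hu u hu

lemma CocycleOn.swap {f : X → X → A} {V : Set X} (hf : CocycleOn f V) {u v : X} (hu : u ∈ V)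
    (hv : v ∈ V) : f v u * f u v = 1 := by
  rw [hf u hu v hv u hu, hf.self hu]

lemma CocycleOn.mono {f : X → X → A} {V W : Set X} (hf : CocycleOn f V) (h : W ⊆ V) :
    CocycleOn f W :=
  fun u hu v hv w hw => hf u (h hu) v (h hv) w (h hw)

lemma LocCocycleAt.self [TopologicalSpace X] {f : X → X → A} {x : X} (hf : LocCocycleAt f x) :
    f x x = 1 := by
  obtain ⟨V, hV, h⟩ := hf
  exact h.self (mem_of_mem_nhds hV)

lemma LocCocycleAt.comap [TopologicalSpace X] [TopologicalSpace T] {f : X → X → A} {g : T → X}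
    {t : T} (hf : LocCocycleAt f (g t)) (hg : ContinuousAt g t) :
    LocCocycleAt (fun s t => f (g s) (g t)) t := by
  obtain ⟨V, hV, h⟩ := hf
  exact ⟨g ⁻¹' V, hg hV, fun u hu v hv w hw => h _ hu _ hv _ hw⟩

/-- `b` is a primitive of `f`: its local increments are given by `f`. -/
def IsPrim [TopologicalSpace T] (f : T → T → A) (b : T → A) : Prop :=
  ∀ t, ∀ᶠ s in 𝓝 t, b s = f t s * b t

lemma IsPrim.comap [TopologicalSpace X] [TopologicalSpace T] {f : X → X → A} {b : X → A}
    (hb : IsPrim f b) {g : T → X} (hg : Continuous g) :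
    IsPrim (fun s t => f (g s) (g t)) (b ∘ g) :=
  fun t => hg.continuousAt.eventually (hb (g t))

lemma IsPrim.unique [TopologicalSpace T] [PreconnectedSpace T] {f : T → T → A} {b b' : T → A}
    (hb : IsPrim f b) (hb' : IsPrim f b') (s t : T) :
    b s * (b t)⁻¹ = b' s * (b' t)⁻¹ := by
  have : IsLocallyConstant fun t => (b t)⁻¹ * b' t := by
    rw [IsLocallyConstant.iff_eventually_eq]
    intro t
    filter_upwards [hb t, hb' t] with s h1 h2
    rw [h1, h2]; group
  have h := this.apply_eq_of_isPreconnected isPreconnected_univ (mem_univ s) (mem_univ t)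
  have h' : b' s = b s * ((b t)⁻¹ * b' t) := by rw [← h]; group
  rw [h']; group

lemma exists_pos_cocycle [PseudoMetricSpace T] [CompactSpace T] {f : T → T → A}
    (hf : ∀ t, LocCocycleAt f t) :
    ∃ r > 0, ∀ t, CocycleOn f (ball t r) := by
  choose V hV h using hf
  obtain ⟨r, hr, H⟩ := lebesgue_number_lemma_of_metric (s := univ) (c := fun t => interior (V t))
    isCompact_univ (fun _ => isOpen_interior)
    (fun t _ => mem_iUnion.2 ⟨t, mem_interior_iff_mem_nhds.2 (hV t)⟩)
  refine ⟨r, hr, fun t => ?_⟩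
  obtain ⟨i, hi⟩ := H t (mem_univ t)
  exact (h i).mono (hi.trans interior_subset)

lemma exists_prim_unitInterval {f : I → I → A} (hf : ∀ t, LocCocycleAt f t) :
    ∃ b, IsPrim f b := by
  obtain ⟨r, hr, H⟩ := exists_pos_cocycle hf
  have key : ∀ n : ℕ, ∃ b : I → A, ∀ s t : I, (s : ℝ) ≤ n * (r / 2) → (t : ℝ) ≤ n * (r / 2) →
      dist s t < r / 2 → b s = f t s * b t := by
    intro n
    induction n with
    | zero =>
      refine ⟨fun _ => 1, fun s t hs ht _ => ?_⟩
      have : s = t := Subtype.ext (by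
        have := s.2.1; have := t.2.1
        simp at hs ht; linarith)
      subst this
      simp [(H s).self (mem_ball_self hr)]
    | succ n ih =>
      obtain ⟨b, hb⟩ := ih
      by_cases hn : (n : ℝ) * (r / 2) ≤ 1
      swap
      · refine ⟨b, fun s t _ _ => hb s t ?_ ?_⟩
        · linarith [s.2.2]
        · linarith [t.2.2]
      let m : I := ⟨n * (r / 2), by positivity, hn⟩
      have hmm : (m : ℝ) = n * (r / 2) := rfl
      have hloc : ∀ s : I, (s : ℝ) ≤ m → dist s m < r / 2 → b s = f m s * b m :=
        fun s hs hd => hb s m hs le_rfl hd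
      refine ⟨fun s => if s ≤ m then b s else f m s * b m, fun s t hs ht hd => ?_⟩
      push_cast at hs ht
      by_cases h : s ≤ m ∧ t ≤ m
      · simpa [h.1, h.2] using hb s t h.1 h.2 hd
      have hd' : |(s : ℝ) - t| < r / 2 := hd
      rw [abs_lt] at hd'
      have hclose : dist s m < r ∧ dist t m < r ∧ (s ≤ m → dist s m < r / 2) ∧
          (t ≤ m → dist t m < r / 2) := by
        simp only [Subtype.dist_eq, Real.dist_eq, abs_lt]
        have h' : ¬ ((s : ℝ) ≤ m ∧ (t : ℝ) ≤ m) := h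
        have e1 : s ≤ m ↔ (s : ℝ) ≤ m := Iff.rfl
        have e2 : t ≤ m ↔ (t : ℝ) ≤ m := Iff.rfl
        rw [e1, e2]
        by_cases h1 : (s : ℝ) ≤ m <;> by_cases h2 : (t : ℝ) ≤ m <;>
          simp only [h1, h2, and_self, not_true_eq_false, forall_true_left] at h' ⊢ <;>
          refine ⟨⟨?_, ?_⟩, ⟨?_, ?_⟩, ?_, ?_⟩ <;>
          first
          | (constructor <;> linarith)
          | linarith
          | (intro h; exact h.elim)
      have es : (if s ≤ m then b s else f m s * b m) = f m s * b m := by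
        split_ifs with h1
        · exact hloc s h1 (hclose.2.2.1 h1)
        · rfl
      have et : (if t ≤ m then b t else f m t * b m) = f m t * b m := by
        split_ifs with h1
        · exact hloc t h1 (hclose.2.2.2 h1)
        · rfl
      beta_reduce
      rw [es, et, ← mul_assoc, H m m (mem_ball_self hr) t hclose.2.1 s hclose.1]
  obtain ⟨n, hn⟩ := exists_nat_gt (1 / (r / 2))
  obtain ⟨b, hb⟩ := key n
  have h1 : 1 ≤ n * (r / 2) := by
    rw [div_lt_iff₀ (by positivity)] at hn; exact hn.le
  refine ⟨b, fun t => ?_⟩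
  filter_upwards [ball_mem_nhds t (half_pos hr)] with s hs
  exact hb s t (s.2.2.trans h1) (t.2.2.trans h1) hs

open Classical in
/-- The holonomy of a function `f` of pairs along a path. -/
def hol [TopologicalSpace X] (f : X → X → A) (γ : I → X) : A :=
  if h : ∃ b, IsPrim (fun s t => f (γ s) (γ t)) b then h.choose 1 * (h.choose 0)⁻¹ else 1

variable [TopologicalSpace X]

lemma hol_eq {f : X → X → A} {γ : I → X} {b : I → A}
    (hb : IsPrim (fun s t => f (γ s) (γ t)) b) : hol f γ = b 1 * (b 0)⁻¹ := by
  have h : ∃ b, IsPrim (fun s t => f (γ s) (γ t)) b := ⟨b, hb⟩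
  rw [hol, dif_pos h]
  exact h.choose_spec.unique hb 1 0

lemma exists_prim {f : X → X → A} {γ : I → X} (hγ : Continuous γ)
    (hf : ∀ t, LocCocycleAt f (γ t)) : ∃ b, IsPrim (fun s t => f (γ s) (γ t)) b :=
  exists_prim_unitInterval fun t => (hf t).comap hγ.continuousAt

lemma hol_comp_prim [TopologicalSpace T] {f : X → X → A} {g : T → X} {b : T → A}
    (hb : IsPrim (fun s t => f (g s) (g t)) b) {γ : I → T} (hγ : Continuous γ) :
    hol f (g ∘ γ) = b (γ 1) * (b (γ 0))⁻¹ :=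
  hol_eq (hb.comap hγ)

lemma hol_congr {f f' : X → X → A} {γ : I → X} (hγ : Continuous γ)
    (hf : ∀ t, LocCocycleAt f (γ t))
    (h : ∀ t, ∃ V ∈ 𝓝 (γ t), ∀ u ∈ V, ∀ v ∈ V, f u v = f' u v) : hol f γ = hol f' γ := by
  obtain ⟨b, hb⟩ := exists_prim hγ hf
  rw [hol_eq hb, hol_eq (b := b)]
  intro t
  obtain ⟨V, hV, h⟩ := h t
  filter_upwards [hb t, hγ.continuousAt hV] with s hs hs'
  rw [hs, h _ (mem_of_mem_nhds hV) _ hs']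

lemma hol_map {B : Type*} [Group B] {f : X → X → A} {γ : I → X} (hγ : Continuous γ)
    (hf : ∀ t, LocCocycleAt f (γ t)) (φ : A →* B) :
    hol (fun u v => φ (f u v)) γ = φ (hol f γ) := by
  obtain ⟨b, hb⟩ := exists_prim hγ hf
  rw [hol_eq hb, hol_eq (b := fun t => φ (b t))]
  · simp
  intro t
  filter_upwards [hb t] with s hs
  rw [hs, map_mul]

lemma hol_trans {f : X → X → A} (hf : ∀ x, LocCocycleAt f x) {x y z : X} (γ : Path x y)
    (γ' : Path y z) : hol f (γ.trans γ') = hol f γ' * hol f γ := by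
  obtain ⟨b, hb⟩ := exists_prim (f := f) (γ.trans γ').continuous (fun t => hf _)
  let l : I → I := fun t => ⟨(t : ℝ) / 2, by have := t.2.1; have := t.2.2; constructor <;> linarith⟩
  let r : I → I := fun t => ⟨((t : ℝ) + 1) / 2,
    by have := t.2.1; have := t.2.2; constructor <;> linarith⟩
  have hl : Continuous l := by fun_prop
  have hr : Continuous r := by fun_prop
  have el : (γ.trans γ') ∘ l = γ := by
    ext t
    have := t.2.2
    simp only [comp_apply, Path.trans_apply, l]
    rw [dif_pos (by linarith)]
    congr 1; ext; simp; ring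
  have er : (γ.trans γ') ∘ r = γ' := by
    ext t
    have := t.2.1
    simp only [comp_apply, Path.trans_apply, r]
    split_ifs with h
    · have h0 : (t : ℝ) = 0 := by linarith
      have : t = 0 := Subtype.ext h0
      subst this
      convert γ.target.trans γ'.source.symm using 2
      ext; simp
    · congr 1; ext; simp; ring
  have h1 := hol_comp_prim hb hl
  have h2 := hol_comp_prim hb hr
  rw [el] at h1
  rw [er] at h2
  have e1 : l 1 = r 0 := by ext; simp [l, r]
  have e2 : l 0 = 0 := by ext; simp [l]
  have e3 : r 1 = 1 := by ext; simp [r]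
  rw [h1, h2, hol_eq hb, e1, e2, e3]
  group

lemma hol_homotopic {f : X → X → A} (hf : ∀ x, LocCocycleAt f x) {x y : X} {γ γ' : Path x y}
    (h : γ.Homotopic γ') : hol f γ = hol f γ' := by
  obtain ⟨H⟩ := h
  obtain ⟨r, hr, hc⟩ := exists_pos_cocycle (f := fun p q : I × I => f (H p) (H q))
    (fun p => (hf _).comap H.continuous.continuousAt)
  have hlc : IsLocallyConstant fun s : I => hol f fun t => H (s, t) := by
    rw [IsLocallyConstant.iff_eventually_eq]
    intro s
    obtain ⟨b, hb⟩ := exists_prim (f := f) (γ := fun t => H (s, t)) (by fun_prop) (fun t => hf _)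
    filter_upwards [ball_mem_nhds s hr] with s' hs'
    have hb' : IsPrim (fun t t' => f (H (s', t)) (H (s', t')))
        (fun t => f (H (s, t)) (H (s', t)) * b t) := by
      intro t
      filter_upwards [hb t, ball_mem_nhds t hr] with t' h1 h2
      have m1 : (s, t) ∈ ball (s, t) r := mem_ball_self hr
      have m2 : (s', t) ∈ ball (s, t) r := by simpa [Prod.dist_eq, hr] using hs'
      have m3 : (s, t') ∈ ball (s, t) r := by simpa [Prod.dist_eq, hr] using h2
      have m4 : (s', t') ∈ ball (s, t) r := by simpa [Prod.dist_eq] using ⟨hs', h2⟩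
      have c1 := hc (s, t) _ m1 _ m3 _ m4
      have c2 := hc (s, t) _ m1 _ m2 _ m4
      rw [h1, ← mul_assoc, ← mul_assoc]
      beta_reduce at c1 c2
      rw [c1, c2]
    rw [hol_eq hb', hol_eq hb]
    have e0 : f (H (s, 0)) (H (s', 0)) = 1 := by simp [(hf x).self]
    have e1 : f (H (s, 1)) (H (s', 1)) = 1 := by simp [(hf y).self]
    rw [e0, e1]; simp
  have := hlc.apply_eq_of_isPreconnected isPreconnected_univ (mem_univ 0) (mem_univ 1)
  simpa using this

/-- The holonomy homomorphism of a local cocycle. -/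
def holHom (f : X → X → A) (hf : ∀ x, LocCocycleAt f x) (x : X) : FundamentalGroup X x →* A :=
  MonoidHom.mk' (fun p => Quotient.liftOn p (fun γ : Path x x => hol f γ)
    fun _ _ h => hol_homotopic hf h) (by
    intro p q
    induction p using Quotient.inductionOn with | _ p =>
    induction q using Quotient.inductionOn with | _ q =>
    exact hol_trans hf q p)

lemma holHom_mk (f : X → X → A) (hf : ∀ x, LocCocycleAt f x) {x : X} (γ : Path x x) :
    holHom f hf x (Path.Homotopic.Quotient.mk γ) = hol f γ := rfl

end Holonomy

/-! ### Free groups with an involution -/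

section FreeInvolution

variable {G G' : Type} [Group G'] [Group G]

/-- The swap of the two copies of the generators. -/
def swapHom (G : Type) : FreeGroup (G ⊕ G) →* FreeGroup (G ⊕ G) := FreeGroup.map Sum.swap

/-- Evaluation of words in two copies of `G`, the second one twisted by `τ`. -/
def twistedEval (τ : G →* G) : FreeGroup (G ⊕ G) →* G := FreeGroup.lift (Sum.elim id τ)

lemma swapHom_swapHom {G : Type} (w : FreeGroup (G ⊕ G)) : swapHom G (swapHom G w) = w := by
  have : (swapHom G).comp (swapHom G) = MonoidHom.id _ := by
    ext x; simp [swapHom]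
  exact DFunLike.congr_fun this w

lemma twistedEval_swap {τ : G →* G} (hτ : ∀ g, τ (τ g) = g) (w : FreeGroup (G ⊕ G)) :
    twistedEval τ (swapHom G w) = τ (twistedEval τ w) := by
  have : (twistedEval τ).comp (swapHom G) = τ.comp (twistedEval τ) := by
    ext x; rcases x with x | x <;> simp [swapHom, twistedEval, hτ]
  exact DFunLike.congr_fun this w

lemma twistedEval_surjective (τ : G →* G) : Surjective (twistedEval τ) :=
  fun g => ⟨FreeGroup.of (Sum.inl g), by simp [twistedEval]⟩

lemma exists_equiv_freeGroup_of_retract {α : Type} (s : G →* FreeGroup α) (e : FreeGroup α →* G)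
    (h : ∀ g, e (s g) = g) : ∃ β : Type, Nonempty (G ≃* FreeGroup β) := by
  have hinj : Injective s := LeftInverse.injective h
  have e1 : G ≃* s.range := MonoidHom.ofInjective hinj
  have : IsFreeGroup s.range := inferInstance
  exact ⟨_, ⟨e1.trans (IsFreeGroup.toFreeGroup s.range)⟩⟩

/-- Homomorphisms to the group of order two. -/
abbrev Hom2 (G : Type) [Group G] : Type := G →* Multiplicative (ZMod 2)

lemma hom2_mul_self (φ : Hom2 G) : φ * φ = 1 := by
  have h : ∀ c : Multiplicative (ZMod 2), c * c = 1 := by decide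
  ext g
  simp only [MonoidHom.mul_apply, h, MonoidHom.one_apply]

lemma card_hom2_freeGroup (α : Type) [Finite α] :
    Nat.card (Hom2 (FreeGroup α)) = 2 ^ Nat.card α := by
  rw [Nat.card_congr (FreeGroup.lift (α := α) (β := Multiplicative (ZMod 2))).symm, Nat.card_fun]
  simp [Nat.card_eq_fintype_card, ZMod.card, Fintype.card_multiplicative]

lemma finite_of_finite_hom2 (α : Type) [Finite (Hom2 (FreeGroup α))] : Finite α := by
  have : Finite (α → Multiplicative (ZMod 2)) :=
    Finite.of_equiv _ (FreeGroup.lift (α := α) (β := Multiplicative (ZMod 2))).symm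
  classical
  refine Finite.of_injective (fun a : α => (Pi.mulSingle a (Multiplicative.ofAdd 1) :
    α → Multiplicative (ZMod 2))) ?_
  intro a b hab
  by_contra hne
  have := congrFun hab a
  simp [Pi.mulSingle_eq_of_ne hne] at this

lemma card_hom2_congr (e : G ≃* G') : Nat.card (Hom2 G) = Nat.card (Hom2 G') :=
  Nat.card_congr
    { toFun := fun φ => φ.comp e.symm.toMonoidHom
      invFun := fun φ => φ.comp e.toMonoidHom
      left_inv := fun φ => by ext; simp
      right_inv := fun φ => by ext; simp }

lemma nat_card_hom2_ne_zero {α : Type} (e : G ≃* FreeGroup α) (h : Nat.card (Hom2 G) ≠ 0) :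
    ∃ n : ℕ, Nat.card (Hom2 G) = 2 ^ n ∧ Nonempty (G ≃* FreeGroup (Fin n)) := by
  rw [card_hom2_congr e] at h ⊢
  have : Finite (Hom2 (FreeGroup α)) := Nat.finite_of_card_ne_zero h
  have := finite_of_finite_hom2 α
  exact ⟨_, card_hom2_freeGroup α, ⟨e.trans (FreeGroup.freeGroupCongr (Finite.equivFin α))⟩⟩

theorem card_hom2_eq_sq {τ : G →* G} (hτ : ∀ g, τ (τ g) = g) {q : G →* G'}
    (hq : Surjective q) (hqτ : ∀ g, q (τ g) = q g)
    (hfac : ∀ Ψ : Hom2 G, (∀ g, Ψ (τ g) = Ψ g) → ∃ Ψ' : Hom2 G', ∀ g, Ψ' (q g) = Ψ g)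
    {s : G →* FreeGroup (G ⊕ G)} (hs : ∀ g, twistedEval τ (s g) = g)
    (hsτ : ∀ g, s (τ g) = swapHom G (s g)) :
    Nat.card (Hom2 G) = Nat.card (Hom2 G') ^ 2 := by
  let tr : Hom2 G →* Hom2 G :=
    { toFun := fun φ => φ * φ.comp τ
      map_one' := by ext; simp
      map_mul' := fun φ ψ => by ext g; simp [mul_mul_mul_comm] }
  let qs : Hom2 G' →* Hom2 G :=
    { toFun := fun φ => φ.comp q
      map_one' := by ext; simp
      map_mul' := fun φ ψ => by ext g; simp }
  have hqs : Injective qs := fun φ ψ h => by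
    ext g
    obtain ⟨g, rfl⟩ := hq g
    have := DFunLike.congr_fun h g
    exact congrArg _ this
  have hinv : ∀ φ : Hom2 G, φ ∈ qs.range ↔ ∀ g, φ (τ g) = φ g := by
    intro φ
    constructor
    · rintro ⟨ψ, rfl⟩ g
      exact congrArg ψ (hqτ g)
    · intro h
      obtain ⟨ψ, hψ⟩ := hfac φ h
      exact ⟨ψ, by ext g; exact congrArg _ (hψ g)⟩
  have hker : tr.ker = qs.range := by
    ext φ
    rw [hinv, MonoidHom.mem_ker]
    have e : tr φ = φ * φ.comp τ := rfl
    rw [e, mul_eq_one_iff_eq_inv', mul_eq_one_iff_inv_eq.1 (hom2_mul_self φ)]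
    exact ⟨fun h g => DFunLike.congr_fun h g, fun h => MonoidHom.ext h⟩
  have hrange : tr.range = qs.range := by
    apply le_antisymm
    · rintro _ ⟨φ, rfl⟩
      rw [hinv]
      intro g
      simp [tr, hτ, mul_comm]
    · rintro _ ⟨ψ, rfl⟩
      let Φ : Hom2 (FreeGroup (G ⊕ G)) := FreeGroup.lift (Sum.elim (fun g => ψ (q g)) fun _ => 1)
      have hΦ : Φ * Φ.comp (swapHom G) = (ψ.comp q).comp (twistedEval τ) := by
        ext x
        rcases x with x | x <;> simp [Φ, swapHom, twistedEval, hqτ]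
      refine ⟨Φ.comp s, ?_⟩
      ext g
      have := DFunLike.congr_fun hΦ (s g)
      simp only [MonoidHom.mul_apply, MonoidHom.comp_apply, hs] at this
      simp [tr, qs, hsτ, this]
  have h1 := Subgroup.card_eq_card_quotient_mul_card_subgroup tr.ker
  rw [Nat.card_congr (QuotientGroup.quotientKerEquivRange tr).toEquiv, hrange, hker,
    ← Nat.card_congr (MonoidHom.ofInjective hqs).toEquiv] at h1
  rw [h1, sq]

theorem free_rank_double {τ : G →* G} (hτ : ∀ g, τ (τ g) = g) {q : G →* G'}
    (hq : Surjective q) (hqτ : ∀ g, q (τ g) = q g)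
    (hfac : ∀ (A : Type) [Group A] (Ψ : G →* A), (∀ g, Ψ (τ g) = Ψ g) →
      ∃ Ψ' : G' →* A, ∀ g, Ψ' (q g) = Ψ g)
    {s : G →* FreeGroup (G ⊕ G)} (hs : ∀ g, twistedEval τ (s g) = g)
    (hsτ : ∀ g, s (τ g) = swapHom G (s g)) (b : ℕ) :
    (Nonempty (G' ≃* FreeGroup (Fin b)) → Nonempty (G ≃* FreeGroup (Fin (2 * b)))) ∧
    (Nonempty (G ≃* FreeGroup (Fin b)) →
      ∃ b', b = 2 * b' ∧ Nonempty (G' ≃* FreeGroup (Fin b'))) := by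
  have hcard := card_hom2_eq_sq hτ hq hqτ (hfac _) hs hsτ
  obtain ⟨α, ⟨e⟩⟩ := exists_equiv_freeGroup_of_retract s _ hs
  have hG' : ∃ β : Type, Nonempty (G' ≃* FreeGroup β) := by
    let F : FreeGroup (G ⊕ G) →* FreeGroup G' := FreeGroup.map (Sum.elim q q)
    have hF : F.comp (swapHom G) = F := by
      ext x; rcases x with x | x <;> simp [F, swapHom]
    obtain ⟨s', hs'⟩ := hfac _ (F.comp s) (fun g => by
      rw [MonoidHom.comp_apply, hsτ]
      exact DFunLike.congr_fun hF (s g))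
    refine exists_equiv_freeGroup_of_retract s' (FreeGroup.lift id) fun g => ?_
    obtain ⟨g, rfl⟩ := hq g
    have hE : (FreeGroup.lift id).comp F = q.comp (twistedEval τ) := by
      ext x; rcases x with x | x <;> simp [F, twistedEval, hqτ]
    rw [hs']
    have := DFunLike.congr_fun hE (s g)
    simpa [hs] using this
  obtain ⟨β, ⟨e'⟩⟩ := hG'
  constructor
  · rintro ⟨f⟩
    have h' := card_hom2_congr f
    rw [card_hom2_freeGroup, Nat.card_fin] at h'
    have hne : Nat.card (Hom2 G) ≠ 0 := by rw [hcard, h']; positivity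
    obtain ⟨n, hn, hiso⟩ := nat_card_hom2_ne_zero e hne
    rw [hcard, h', ← pow_mul] at hn
    have : n = 2 * b := by
      have := Nat.pow_right_injective le_rfl hn
      omega
    rwa [← this]
  · rintro ⟨f⟩
    have h := card_hom2_congr f
    rw [card_hom2_freeGroup, Nat.card_fin] at h
    have hne : Nat.card (Hom2 G') ≠ 0 := by
      intro h0
      rw [hcard, h0] at h
      have : 0 < 2 ^ b := by positivity
      omega
    obtain ⟨n, hn, hiso⟩ := nat_card_hom2_ne_zero e' hne
    refine ⟨n, ?_, hiso⟩
    rw [hcard, hn, ← pow_mul] at h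
    have := Nat.pow_right_injective le_rfl h
    omega

end FreeInvolution

/-! ### Extending cocycles in the plane, up to finitely many points -/

section PlanarGrid

open Filter

/-- `t'` is so close to `t` that no integer separates them, except possibly `t` itself. -/
def GridNear (t t' : ℝ) : Prop :=
  (∀ c : ℤ, (c : ℝ) ≤ t' → (c : ℝ) ≤ t) ∧ (∀ c : ℤ, t' ≤ c → t ≤ c) ∧ |t' - t| < 1 / 2

lemma eventually_grid (t : ℝ) : ∀ᶠ t' in 𝓝 t, GridNear t t' := by
  have h1 : ∀ᶠ t' in 𝓝 t, (⌈t⌉ : ℝ) - 1 < t' := lt_mem_nhds (by linarith [Int.ceil_lt_add_one t])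
  have h2 : ∀ᶠ t' in 𝓝 t, t' < (⌊t⌋ : ℝ) + 1 := gt_mem_nhds (Int.lt_floor_add_one t)
  have h3 : ∀ᶠ t' in 𝓝 t, |t' - t| < 1 / 2 := Metric.ball_mem_nhds t (by norm_num)
  filter_upwards [h1, h2, h3] with t' h1 h2 h3
  refine ⟨fun c hc => ?_, fun c hc => ?_, h3⟩
  · have : (c : ℝ) < ((⌊t⌋ + 1 : ℤ) : ℝ) := by push_cast; linarith
    have : c < ⌊t⌋ + 1 := by exact_mod_cast this
    exact Int.le_floor.1 (by omega)
  · have : ((⌈t⌉ - 1 : ℤ) : ℝ) < c := by push_cast; linarith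
    have : ⌈t⌉ - 1 < c := by exact_mod_cast this
    exact Int.ceil_le.1 (by omega)

/-- A real number is an integer. -/
def IsZ (t : ℝ) : Prop := ∃ k : ℤ, (k : ℝ) = t

lemma isZ_near {t t' : ℝ} (ht : IsZ t) (h : |t' - t| < 1 / 2) (ht' : IsZ t') : t' = t := by
  obtain ⟨k, rfl⟩ := ht
  obtain ⟨k', rfl⟩ := ht'
  have : |((k' - k : ℤ) : ℝ)| < 1 := by push_cast; linarith
  have : |k' - k| < 1 := by exact_mod_cast this
  have : k' - k = 0 := Int.abs_lt_one_iff.1 this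
  simp only [Int.cast_inj]; omega

lemma round_near {t t' : ℝ} (ht : IsZ t) (h : |t' - t| < 1 / 2) : ((round t' : ℤ) : ℝ) = t := by
  obtain ⟨k, rfl⟩ := ht
  have h1 := abs_sub_round t'
  have : |((round t' - k : ℤ) : ℝ)| < 1 := by
    push_cast
    rw [abs_le] at h1
    rw [abs_lt] at h ⊢
    constructor <;> linarith
  have : |round t' - k| < 1 := by exact_mod_cast this
  have : round t' - k = 0 := Int.abs_lt_one_iff.1 this
  simp only [Int.cast_inj]; omega

lemma floor_near {t t' : ℝ} (ht : ¬ IsZ t) (h : GridNear t t') : ⌊t'⌋ = ⌊t⌋ ∧ ¬ IsZ t' := by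
  obtain ⟨h1, h2, h3⟩ := h
  have h0 : ⌊t'⌋ = ⌊t⌋ := by
    apply le_antisymm
    · exact Int.le_floor.2 (h1 _ (Int.floor_le t'))
    · refine Int.le_floor.2 ?_
      by_contra hlt
      exact ht ⟨⌊t⌋, le_antisymm (Int.floor_le t) (h2 _ (not_le.1 hlt).le)⟩
  refine ⟨h0, fun ⟨k, hk⟩ => ht ⟨k, le_antisymm (h1 k hk.le) (h2 k hk.ge)⟩⟩

lemma floor_bounds {t : ℝ} {c : ℤ} (ht : ¬ IsZ t) (h1 : (c : ℝ) ≤ t) (h2 : t ≤ c + 1) :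
    c = ⌊t⌋ := by
  have : t < c + 1 := lt_of_le_of_ne h2 fun h => ht ⟨c + 1, by push_cast; exact h.symm⟩
  exact (Int.floor_eq_iff.2 ⟨h1, this⟩).symm

lemma round_eq_floor_or (t : ℝ) : round t = ⌊t⌋ ∨ round t = ⌊t⌋ + 1 := by
  have h := abs_le.1 (abs_sub_round t)
  have h1 := Int.floor_le t
  have h2 := Int.lt_floor_add_one t
  have a : ((round t : ℤ) : ℝ) < ((⌊t⌋ + 2 : ℤ) : ℝ) := by push_cast; linarith
  have b : ((⌊t⌋ - 1 : ℤ) : ℝ) < ((round t : ℤ) : ℝ) := by push_cast; linarith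
  have a' : round t < ⌊t⌋ + 2 := by exact_mod_cast a
  have b' : ⌊t⌋ - 1 < round t := by exact_mod_cast b
  omega

/-- The closed unit cell of the grid with lower left corner `c`. -/
def gridCell (c : ℤ × ℤ) : Set (ℝ × ℝ) :=
  {x | ((c.1 : ℝ) ≤ x.1 ∧ x.1 ≤ c.1 + 1) ∧ ((c.2 : ℝ) ≤ x.2 ∧ x.2 ≤ c.2 + 1)}

/-- The lower left corner of a cell containing `x`. -/
def gridCorner (x : ℝ × ℝ) : ℤ × ℤ := (⌊x.1⌋, ⌊x.2⌋)

/-- The centre of a cell containing `x`. -/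
def gridCentre (x : ℝ × ℝ) : ℝ × ℝ := (⌊x.1⌋ + 1 / 2, ⌊x.2⌋ + 1 / 2)

/-- The union of the edges of the grid. -/
def gridSkel : Set (ℝ × ℝ) := {x | IsZ x.1 ∨ IsZ x.2}

lemma not_mem_gridSkel {x : ℝ × ℝ} : x ∉ gridSkel ↔ ¬ IsZ x.1 ∧ ¬ IsZ x.2 := not_or

/-- The union of a set of cells. -/
def gridUnion (𝒜 : Set (ℤ × ℤ)) : Set (ℝ × ℝ) := {x | ∃ c ∈ 𝒜, x ∈ gridCell c}

lemma mem_gridCell_corner (x : ℝ × ℝ) : x ∈ gridCell (gridCorner x) :=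
  ⟨⟨Int.floor_le _, (Int.lt_floor_add_one _).le⟩, ⟨Int.floor_le _, (Int.lt_floor_add_one _).le⟩⟩

lemma eventually_grid_prod (x : ℝ × ℝ) :
    ∀ᶠ y in 𝓝 x, GridNear x.1 y.1 ∧ GridNear x.2 y.2 :=
  (continuous_fst.continuousAt.eventually (eventually_grid x.1)).and
    (continuous_snd.continuousAt.eventually (eventually_grid x.2))

lemma eventually_gridCell (x : ℝ × ℝ) : ∀ᶠ y in 𝓝 x, ∀ c, y ∈ gridCell c → x ∈ gridCell c := by
  filter_upwards [eventually_grid_prod x] with y ⟨h1, h2⟩ c ⟨⟨a, b⟩, ⟨a', b'⟩⟩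
  have e := h1.2.1 (c.1 + 1)
  have e' := h2.2.1 (c.2 + 1)
  push_cast at e e'
  exact ⟨⟨h1.1 _ a, e b⟩, ⟨h2.1 _ a', e' b'⟩⟩

lemma eventually_gridCorner {x : ℝ × ℝ} (hx : x ∉ gridSkel) :
    ∀ᶠ y in 𝓝 x, y ∉ gridSkel ∧ gridCorner y = gridCorner x ∧ gridCentre y = gridCentre x := by
  filter_upwards [eventually_grid_prod x] with y ⟨h1, h2⟩
  rw [not_mem_gridSkel] at hx ⊢
  have a := floor_near hx.1 h1
  have b := floor_near hx.2 h2
  exact ⟨⟨a.2, b.2⟩, by simp [gridCorner, a.1, b.1], by simp [gridCentre, a.1, b.1]⟩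

lemma mem_gridUnion_iff {𝒜 : Set (ℤ × ℤ)} {x : ℝ × ℝ} (hx : x ∉ gridSkel) :
    x ∈ gridUnion 𝒜 ↔ gridCorner x ∈ 𝒜 := by
  rw [not_mem_gridSkel] at hx
  constructor
  · rintro ⟨c, hc, ⟨⟨a, b⟩, ⟨a', b'⟩⟩⟩
    have : c = gridCorner x := Prod.ext (floor_bounds hx.1 a b) (floor_bounds hx.2 a' b')
    rwa [← this]
  · exact fun h => ⟨_, h, mem_gridCell_corner x⟩

lemma norm_sub_gridCentre (x : ℝ × ℝ) :
    ‖x - gridCentre x‖ ≤ 1 / 2 ∧ (x ∈ gridSkel → ‖x - gridCentre x‖ = 1 / 2) := by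
  have key : ∀ t : ℝ, |t - (⌊t⌋ + 1 / 2)| ≤ 1 / 2 ∧ (IsZ t → |t - (⌊t⌋ + 1 / 2)| = 1 / 2) := by
    intro t
    constructor
    · rw [abs_le]
      constructor <;> linarith [Int.floor_le t, Int.lt_floor_add_one t]
    · rintro ⟨k, rfl⟩
      rw [Int.floor_intCast]
      norm_num
  have e : ‖x - gridCentre x‖ = max |x.1 - (⌊x.1⌋ + 1 / 2)| |x.2 - (⌊x.2⌋ + 1 / 2)| := by
    rw [Prod.norm_def]; rfl
  rw [e]
  refine ⟨max_le (key _).1 (key _).1, ?_⟩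
  rintro (h | h)
  · rw [(key _).2 h]; exact max_eq_left (key _).1
  · rw [(key x.2).2 h]; exact max_eq_right (key _).1

open Classical in
/-- Radial projection of the cells outside `𝒜` to their boundaries. -/
def gridProj (𝒜 : Set (ℤ × ℤ)) (x : ℝ × ℝ) : ℝ × ℝ :=
  if x ∈ gridUnion 𝒜 then x
  else gridCentre x + (2 * ‖x - gridCentre x‖)⁻¹ • (x - gridCentre x)

open Classical in
/-- Rounding of the points outside `gridUnion 𝒜`. -/
def gridRound (𝒜 : Set (ℤ × ℤ)) (y : ℝ × ℝ) : ℝ × ℝ :=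
  if y ∈ gridUnion 𝒜 then y else ((round y.1 : ℤ), (round y.2 : ℤ))

lemma gridProj_sub {𝒜 : Set (ℤ × ℤ)} {x : ℝ × ℝ} (hx : x ≠ gridCentre x) :
    ‖gridProj 𝒜 x - x‖ ≤ 1 / 2 - ‖x - gridCentre x‖ := by
  have h := (norm_sub_gridCentre x).1
  unfold gridProj
  split_ifs
  · simpa using h
  set v := x - gridCentre x with hv
  have hpos : 0 < ‖v‖ := norm_pos_iff.2 (sub_ne_zero.2 hx)
  have e : gridCentre x + (2 * ‖v‖)⁻¹ • v - x = ((2 * ‖v‖)⁻¹ - 1) • v := by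
    rw [sub_smul, one_smul, hv]; abel
  have h1 : 1 ≤ (2 * ‖v‖)⁻¹ := (one_le_inv₀ (by positivity)).2 (by linarith)
  rw [e, norm_smul, Real.norm_of_nonneg (by linarith), sub_mul, one_mul]
  apply le_of_eq
  congr 1
  field_simp

lemma gridProj_mem_skel {𝒜 : Set (ℤ × ℤ)} {x : ℝ × ℝ} (hx : x ≠ gridCentre x)
    (hA : x ∉ gridUnion 𝒜) : gridProj 𝒜 x ∈ gridSkel := by
  rw [gridProj, if_neg hA]
  set v := x - gridCentre x with hv
  have hpos : 0 < ‖v‖ := norm_pos_iff.2 (sub_ne_zero.2 hx)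
  have key : ∀ (m : ℤ) (t : ℝ), |t| = ‖v‖ → IsZ (m + 1 / 2 + (2 * ‖v‖)⁻¹ * t) := by
    intro m t ht
    rcases abs_choice t with h | h
    · refine ⟨m + 1, ?_⟩
      have : t = ‖v‖ := by rw [← ht, h]
      rw [this]; field_simp; push_cast; ring
    · refine ⟨m, ?_⟩
      have : t = -‖v‖ := by rw [← ht, h]; ring
      rw [this]; field_simp; ring
  rcases max_choice ‖v.1‖ ‖v.2‖ with h | h
  · left
    exact key _ _ (by rw [Prod.norm_def v, h]; rfl)
  · right
    exact key _ _ (by rw [Prod.norm_def v, h]; rfl)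

lemma gridProj_mem {𝒜 : Set (ℤ × ℤ)} {x : ℝ × ℝ} (hx : x ≠ gridCentre x) :
    gridProj 𝒜 x ∈ gridUnion 𝒜 ∪ gridSkel := by
  by_cases hA : x ∈ gridUnion 𝒜
  · left; simp [gridProj, hA]
  · exact Or.inr (gridProj_mem_skel hx hA)

lemma gridProj_skel {𝒜 : Set (ℤ × ℤ)} {x : ℝ × ℝ} (hx : x ∈ gridSkel) : gridProj 𝒜 x = x := by
  have h := (norm_sub_gridCentre x).2 hx
  unfold gridProj
  split_ifs
  · rfl
  · rw [h]; norm_num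

lemma half_le_abs_floor (t : ℝ) (k : ℤ) : 1 / 2 ≤ |t - (⌊t⌋ + 1 / 2)| + |t - k| := by
  have h1 : (1 : ℝ) ≤ |((2 * (k - ⌊t⌋) - 1 : ℤ) : ℝ)| := by
    rw [← Int.cast_abs]
    exact_mod_cast Int.one_le_abs (by omega)
  have h2 : ((2 * (k - ⌊t⌋) - 1 : ℤ) : ℝ) = 2 * ((t - (⌊t⌋ + 1 / 2)) - (t - k)) := by
    push_cast; ring
  rw [h2, abs_mul, abs_two] at h1
  linarith [abs_sub (t - (⌊t⌋ + 1 / 2)) (t - k)]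

lemma half_sub_norm_le {x y : ℝ × ℝ} (hx : x ∈ gridSkel) :
    1 / 2 - ‖y - gridCentre y‖ ≤ ‖y - x‖ := by
  rcases hx with ⟨k, hk⟩ | ⟨k, hk⟩
  · have h1 := half_le_abs_floor y.1 k
    have h2 : |y.1 - (⌊y.1⌋ + 1 / 2)| ≤ ‖y - gridCentre y‖ := norm_fst_le (y - gridCentre y)
    have h3 : |y.1 - k| ≤ ‖y - x‖ := by rw [hk]; exact norm_fst_le (y - x)
    linarith
  · have h1 := half_le_abs_floor y.2 k
    have h2 : |y.2 - (⌊y.2⌋ + 1 / 2)| ≤ ‖y - gridCentre y‖ := norm_snd_le (y - gridCentre y)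
    have h3 : |y.2 - k| ≤ ‖y - x‖ := by rw [hk]; exact norm_snd_le (y - x)
    linarith

lemma eventually_ne_gridCentre {x : ℝ × ℝ} (hx : x ≠ gridCentre x) :
    ∀ᶠ y in 𝓝 x, y ≠ gridCentre y := by
  by_cases hs : x ∈ gridSkel
  · filter_upwards [ball_mem_nhds x (show (0 : ℝ) < 1 / 2 by norm_num)] with y hy h
    have h1 := half_sub_norm_le (y := y) hs
    rw [← h, sub_self, norm_zero, ← dist_eq_norm] at h1
    linarith [mem_ball.1 hy]
  · filter_upwards [eventually_gridCorner hs, isOpen_ne.mem_nhds hx] with y h1 h2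
    rw [h1.2.2]
    exact h2

lemma continuousAt_gridProj {𝒜 : Set (ℤ × ℤ)} {x : ℝ × ℝ} (hx : x ≠ gridCentre x) :
    ContinuousAt (gridProj 𝒜) x := by
  by_cases hs : x ∈ gridSkel
  · rw [ContinuousAt, gridProj_skel hs, tendsto_iff_norm_sub_tendsto_zero]
    have h2 : Tendsto (fun y => 2 * ‖y - x‖) (𝓝 x) (𝓝 0) := by
      have : Continuous fun y : ℝ × ℝ => 2 * ‖y - x‖ := by fun_prop
      simpa using this.tendsto x
    refine tendsto_of_tendsto_of_tendsto_of_le_of_le' tendsto_const_nhds h2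
      (Eventually.of_forall fun _ => norm_nonneg _) ?_
    filter_upwards [eventually_ne_gridCentre hx] with y hy
    have a := gridProj_sub (𝒜 := 𝒜) hy
    have b := half_sub_norm_le (y := y) hs
    calc ‖gridProj 𝒜 y - x‖ = ‖(gridProj 𝒜 y - y) + (y - x)‖ := by congr 1; abel
      _ ≤ _ := norm_add_le _ _
      _ ≤ 2 * ‖y - x‖ := by linarith
  · by_cases hA : gridCorner x ∈ 𝒜
    · refine continuousAt_id.congr ?_
      filter_upwards [eventually_gridCorner hs] with y hy
      have : y ∈ gridUnion 𝒜 := (mem_gridUnion_iff hy.1).2 (by rwa [hy.2.1])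
      simp [gridProj, this]
    · have hpos : ‖x - gridCentre x‖ ≠ 0 := norm_ne_zero_iff.2 (sub_ne_zero.2 hx)
      have hc : ContinuousAt (fun y => gridCentre x +
          (2 * ‖y - gridCentre x‖)⁻¹ • (y - gridCentre x)) x := by
        have h1 : ContinuousAt (fun y => (2 * ‖y - gridCentre x‖)⁻¹) x :=
          ContinuousAt.inv₀ (by fun_prop) (by simpa using hpos)
        fun_prop
      refine hc.congr ?_
      filter_upwards [eventually_gridCorner hs] with y hy
      have : y ∉ gridUnion 𝒜 := fun h => hA (by
        rw [← hy.2.1]; exact (mem_gridUnion_iff hy.1).1 h)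
      simp only [gridProj, this, if_false, hy.2.2]

lemma gridRound_near_union {𝒜 : Set (ℤ × ℤ)} {y : ℝ × ℝ} (hy : y ∈ gridUnion 𝒜) :
    ∀ᶠ y' in 𝓝 y, y' ∈ gridUnion 𝒜 ∪ gridSkel → gridRound 𝒜 y' = y' ∨ gridRound 𝒜 y' = y := by
  filter_upwards [eventually_grid_prod y] with y' ⟨h1, h2⟩ hy'
  by_cases hA : y' ∈ gridUnion 𝒜
  · left; simp [gridRound, hA]
  by_cases hv : IsZ y.1 ∧ IsZ y.2
  · right
    simp only [gridRound, hA, if_false]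
    exact Prod.ext (round_near hv.1 h1.2.2) (round_near hv.2 h2.2.2)
  exfalso
  apply hA
  obtain ⟨c, hc, ⟨⟨a, b⟩, ⟨a', b'⟩⟩⟩ := hy
  refine ⟨c, hc, ?_⟩
  have inner : ∀ {t t' : ℝ} {m : ℤ}, ¬ IsZ t → GridNear t t' → (m : ℝ) ≤ t → t ≤ m + 1 →
      (m : ℝ) ≤ t' ∧ t' ≤ m + 1 := by
    intro t t' m hz hn h1 h2
    rw [floor_bounds hz h1 h2, ← (floor_near hz hn).1]
    exact ⟨Int.floor_le _, (Int.lt_floor_add_one _).le⟩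
  rcases hy'.resolve_left hA with hz | hz
  · have hy1 : IsZ y.1 := by_contra fun h => (floor_near h h1).2 hz
    have hy2 : ¬ IsZ y.2 := fun h => hv ⟨hy1, h⟩
    refine ⟨?_, inner hy2 h2 a' b'⟩
    rw [isZ_near hy1 h1.2.2 hz]; exact ⟨a, b⟩
  · have hy2 : IsZ y.2 := by_contra fun h => (floor_near h h2).2 hz
    have hy1 : ¬ IsZ y.1 := fun h => hv ⟨h, hy2⟩
    refine ⟨inner hy1 h1 a b, ?_⟩
    rw [isZ_near hy2 h2.2.2 hz]; exact ⟨a', b'⟩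

lemma gridRound_near_skel {𝒜 : Set (ℤ × ℤ)} {y : ℝ × ℝ} (hy : y ∉ gridUnion 𝒜)
    (hs : y ∈ gridSkel) : ∃ a b, ∀ᶠ y' in 𝓝 y, y' ∈ gridUnion 𝒜 ∪ gridSkel →
      gridRound 𝒜 y' = a ∨ gridRound 𝒜 y' = b := by
  have hout : ∀ᶠ y' in 𝓝 y, y' ∉ gridUnion 𝒜 := by
    filter_upwards [eventually_gridCell y] with y' h ⟨c, hc, hcy⟩
    exact hy ⟨c, hc, h c hcy⟩
  have two : ∀ {t t' : ℝ}, ¬ IsZ t → GridNear t t' →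
      ((round t' : ℤ) : ℝ) = ⌊t⌋ ∨ ((round t' : ℤ) : ℝ) = (⌊t⌋ : ℝ) + 1 := by
    intro t t' hz hn
    rw [← (floor_near hz hn).1]
    rcases round_eq_floor_or t' with h | h
    · left; rw [h]
    · right; rw [h]; push_cast; rfl
  by_cases h1 : IsZ y.1
  · by_cases h2 : IsZ y.2
    · refine ⟨y, y, ?_⟩
      filter_upwards [hout, eventually_grid_prod y] with y' ho hn _
      simp only [gridRound, ho, if_false, or_self]
      exact Prod.ext (round_near h1 hn.1.2.2) (round_near h2 hn.2.2.2)
    · refine ⟨(y.1, ⌊y.2⌋), (y.1, ⌊y.2⌋ + 1), ?_⟩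
      filter_upwards [hout, eventually_grid_prod y] with y' ho hn _
      simp only [gridRound, ho, if_false, round_near h1 hn.1.2.2]
      rcases two h2 hn.2 with h | h <;> simp [h]
  · have h2 : IsZ y.2 := hs.resolve_left h1
    refine ⟨(⌊y.1⌋, y.2), (⌊y.1⌋ + 1, y.2), ?_⟩
    filter_upwards [hout, eventually_grid_prod y] with y' ho hn _
    simp only [gridRound, ho, if_false, round_near h2 hn.2.2.2]
    rcases two h1 hn.1 with h | h <;> simp [h]

variable {N : Type*} [Group N]

theorem locCocycleAt_grid {n : ℝ × ℝ → ℝ × ℝ → N} (hself : ∀ x, n x x = 1)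
    (hswap : ∀ x y, n y x * n x y = 1) {𝒜 : Set (ℤ × ℤ)} {P : Set (ℝ × ℝ)}
    (hn : ∀ x ∈ gridUnion 𝒜, x ∉ P → LocCocycleAt n x) (hP : ∀ x ∈ gridSkel, x ∉ P)
    {x : ℝ × ℝ} (hx : x ≠ gridCentre x) (hxP : x ∉ P) :
    LocCocycleAt (fun u v => n (gridRound 𝒜 (gridProj 𝒜 u)) (gridRound 𝒜 (gridProj 𝒜 v))) x := by
  have hF := continuousAt_gridProj (𝒜 := 𝒜) hx
  have hmem : ∀ᶠ u in 𝓝 x, gridProj 𝒜 u ∈ gridUnion 𝒜 ∪ gridSkel :=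
    (eventually_ne_gridCentre hx).mono fun u hu => gridProj_mem hu
  by_cases hA : gridProj 𝒜 x ∈ gridUnion 𝒜
  · have hyP : gridProj 𝒜 x ∉ P := by
      by_cases hxA : x ∈ gridUnion 𝒜
      · simpa [gridProj, hxA] using hxP
      · exact hP _ (gridProj_mem_skel hx hxA)
    obtain ⟨V, hV, hc⟩ := hn _ hA hyP
    have hg : ∀ᶠ u in 𝓝 x, gridRound 𝒜 (gridProj 𝒜 u) ∈ V := by
      filter_upwards [hF.eventually (gridRound_near_union hA), hmem, hF hV] with u h1 h2 h3
      rcases h1 h2 with h | h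
      · rwa [h]
      · rw [h]; exact mem_of_mem_nhds hV
    exact ⟨_, hg, fun u hu v hv w hw => hc _ hu _ hv _ hw⟩
  · obtain ⟨a, b, hab⟩ := gridRound_near_skel hA
      ((gridProj_mem hx).resolve_left hA)
    refine ⟨_, (hF.eventually hab).and hmem, ?_⟩
    rintro u ⟨hu, hu'⟩ v ⟨hv, hv'⟩ w ⟨hw, hw'⟩
    beta_reduce
    rcases hu hu' with h | h <;> rcases hv hv' with h' | h' <;> rcases hw hw' with h'' | h'' <;>
      simp [h, h', h'', hself, hswap]

lemma gridRound_gridProj_of_mem {𝒜 : Set (ℤ × ℤ)} {x : ℝ × ℝ} (hx : x ∈ gridUnion 𝒜) :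
    gridRound 𝒜 (gridProj 𝒜 x) = x := by
  simp [gridRound, gridProj, hx]

open Classical in
/-- A local cocycle made globally antisymmetrizeetric. -/
def antisymmetrize {X : Type*} (n : X → X → N) (x y : X) : N :=
  if n x x = 1 ∧ n y y = 1 ∧ n y x * n x y = 1 then n x y else 1

lemma antisymmetrize_self {X : Type*} (n : X → X → N) (x : X) : antisymmetrize n x x = 1 := by
  unfold antisymmetrize; split_ifs with h <;> simp [h]

lemma antisymmetrize_swap {X : Type*} (n : X → X → N) (x y : X) :
    antisymmetrize n y x * antisymmetrize n x y = 1 := by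
  unfold antisymmetrize
  by_cases h : n x x = 1 ∧ n y y = 1 ∧ n y x * n x y = 1
  · have h' : n y y = 1 ∧ n x x = 1 ∧ n x y * n y x = 1 :=
      ⟨h.2.1, h.1, mul_eq_one_comm.1 h.2.2⟩
    rw [if_pos h, if_pos h', h.2.2]
  · have h' : ¬ (n y y = 1 ∧ n x x = 1 ∧ n x y * n y x = 1) :=
      fun h' => h ⟨h'.2.1, h'.1, mul_eq_one_comm.1 h'.2.2⟩
    rw [if_neg h, if_neg h', one_mul]

lemma antisymmetrize_eq {X : Type*} {n : X → X → N} {V : Set X} (hV : CocycleOn n V) {x y : X}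
    (hx : x ∈ V) (hy : y ∈ V) : antisymmetrize n x y = n x y :=
  if_pos ⟨hV.self hx, hV.self hy, hV.swap hx hy⟩

lemma antisymmetrize_locCocycleAt {X : Type*} [TopologicalSpace X] {n : X → X → N} {x : X}
    (h : LocCocycleAt n x) : LocCocycleAt (antisymmetrize n) x := by
  obtain ⟨V, hV, h⟩ := h
  refine ⟨V, hV, fun u hu v hv w hw => ?_⟩
  rw [antisymmetrize_eq h hv hw, antisymmetrize_eq h hu hv, antisymmetrize_eq h hu hw,
    h u hu v hv w hw]

/-- A cocycle defined near the closed set `C`, off finitely many points, can be extended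
to a bounded region, off finitely many points. -/
theorem planar_extension (n : ℝ × ℝ → ℝ × ℝ → N) {W C P : Set (ℝ × ℝ)} (hW : IsOpen W)
    (hC : IsClosed C) (hCW : C ⊆ W) (hP : P.Finite)
    (hn : ∀ x ∈ W, x ∉ P → LocCocycleAt n x) (R : ℝ) :
    ∃ (n' : ℝ × ℝ → ℝ × ℝ → N) (P' : Set (ℝ × ℝ)), P'.Finite ∧
      (∀ x ∈ ball 0 R, x ∉ P' → LocCocycleAt n' x) ∧
      ∀ x ∈ C, x ∈ ball 0 R → x ∉ P → ∃ V ∈ 𝓝 x, ∀ u ∈ V, ∀ v ∈ V, n' u v = n u v := by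
  have hK : IsCompact (C ∩ closedBall 0 R) := (isCompact_closedBall 0 R).inter_left hC
  obtain ⟨ε, hε, hεW⟩ := hK.exists_thickening_subset_open hW (inter_subset_left.trans hCW)
  set m := ε / 2 with hm
  have hm0 : 0 < m := by positivity
  obtain ⟨a, ha⟩ : ∃ a : ℝ, ∀ p ∈ P, ¬ IsZ ((p.1 - a) / m) ∧ ¬ IsZ ((p.2 - a) / m) := by
    have hcount : (⋃ p ∈ P, (range fun k : ℤ => p.1 - m * k) ∪
        range fun k : ℤ => p.2 - m * k).Countable :=
      hP.countable.biUnion fun p _ => (countable_range _).union (countable_range _)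
    obtain ⟨a, ha⟩ := (Set.Countable.dense_compl ℝ hcount).nonempty
    refine ⟨a, fun p hp => ⟨?_, ?_⟩⟩
    · rintro ⟨k, hk⟩
      refine ha (mem_biUnion hp (Or.inl ⟨k, ?_⟩))
      beta_reduce; rw [hk]; field_simp; ring
    · rintro ⟨k, hk⟩
      refine ha (mem_biUnion hp (Or.inr ⟨k, ?_⟩))
      beta_reduce; rw [hk]; field_simp; ring
  let T : ℝ × ℝ → ℝ × ℝ := fun x => (a + m * x.1, a + m * x.2)
  let T' : ℝ × ℝ → ℝ × ℝ := fun x => ((x.1 - a) / m, (x.2 - a) / m)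
  have hT : Continuous T := by fun_prop
  have hT' : Continuous T' := by fun_prop
  have hTT' : ∀ x, T (T' x) = x := fun x => by
    ext <;> simp only [T, T'] <;> field_simp <;> ring
  let 𝒜 : Set (ℤ × ℤ) := {c | ∃ y ∈ gridCell c, T y ∈ C ∩ closedBall 0 R}
  have hAW : ∀ x ∈ gridUnion 𝒜, T x ∈ W := by
    rintro x ⟨c, ⟨y, hy, hyK⟩, hx⟩
    refine hεW (mem_thickening_iff.2 ⟨T y, hyK, ?_⟩)
    have aux : ∀ {s t : ℝ} {k : ℤ}, (k : ℝ) ≤ s ∧ s ≤ k + 1 → (k : ℝ) ≤ t ∧ t ≤ k + 1 →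
        dist (a + m * s) (a + m * t) < ε := by
      intro s t k hs ht
      rw [Real.dist_eq, add_sub_add_left_eq_sub, ← mul_sub, abs_mul, abs_of_pos hm0]
      have : |s - t| ≤ 1 := by rw [abs_le]; constructor <;> linarith
      nlinarith
    exact max_lt (aux hx.1 hy.1) (aux hx.2 hy.2)
  let ν : ℝ × ℝ → ℝ × ℝ → N := fun x y => antisymmetrize n (T x) (T y)
  let n₁ : ℝ × ℝ → ℝ × ℝ → N := fun u v =>
    ν (gridRound 𝒜 (gridProj 𝒜 u)) (gridRound 𝒜 (gridProj 𝒜 v))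
  let Z : Set (ℝ × ℝ) := {x | x ∈ ball 0 R ∧ T' x = gridCentre (T' x)}
  have hZ : Z.Finite := by
    let f : ℤ × ℤ → ℝ × ℝ := fun c => T (c.1 + 1 / 2, c.2 + 1 / 2)
    obtain ⟨B, hB⟩ : ∃ B : ℤ, (|R| + |a|) / m + 1 ≤ B := ⟨_, Int.le_ceil _⟩
    refine ((Set.finite_Icc (-B) B).prod (Set.finite_Icc (-B) B) |>.image f).subset ?_
    rintro x ⟨hx, hc⟩
    have hxn : ‖x‖ < R := by simpa using hx
    have bd : ∀ t : ℝ, |t| ≤ R → ⌊(t - a) / m⌋ ∈ Set.Icc (-B) B := by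
      intro t ht
      have h1 : |(t - a) / m| ≤ (|R| + |a|) / m := by
        rw [abs_div, abs_of_pos hm0]
        gcongr
        exact (abs_sub _ _).trans (by linarith [le_abs_self R])
      rw [abs_le] at h1
      constructor
      · rw [Int.le_floor]; push_cast; linarith
      · have := Int.floor_le ((t - a) / m)
        have : ((⌊(t - a) / m⌋ : ℤ) : ℝ) ≤ B := by linarith
        exact_mod_cast this
    refine ⟨gridCorner (T' x), ⟨bd _ ((norm_fst_le x).trans hxn.le),
      bd _ ((norm_snd_le x).trans hxn.le)⟩, ?_⟩
    exact (congrArg T hc.symm).trans (hTT' x)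
  refine ⟨fun u v => n₁ (T' u) (T' v), P ∪ Z, hP.union hZ, fun x hx hxP => ?_,
    fun x hxC hxR hxP => ?_⟩
  · refine LocCocycleAt.comap (f := n₁) ?_ hT'.continuousAt
    refine locCocycleAt_grid (n := ν) (P := T ⁻¹' P) (fun _ => antisymmetrize_self _ _)
      (fun _ _ => antisymmetrize_swap _ _ _) (fun y hy hyP => ?_)
      (fun y hy hyP => ?_) (fun h => ?_) ?_
    · exact LocCocycleAt.comap (antisymmetrize_locCocycleAt (hn _ (hAW y hy) hyP)) hT.continuousAt
    · have e1 : (T y).1 = a + m * y.1 := rfl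
      have e2 : (T y).2 = a + m * y.2 := rfl
      have := ha _ hyP
      rw [e1, e2, add_sub_cancel_left, add_sub_cancel_left, mul_div_cancel_left₀ _ hm0.ne',
        mul_div_cancel_left₀ _ hm0.ne'] at this
      exact hy.elim this.1 this.2
    · exact hxP (Or.inr ⟨hx, h⟩)
    · intro h
      rw [mem_preimage, hTT'] at h
      exact hxP (Or.inl h)
  · obtain ⟨V, hV, hcoc⟩ := hn x (hCW hxC) hxP
    have hnear : ∀ᶠ y in 𝓝 (T' x), y ∈ gridUnion 𝒜 := by
      filter_upwards [eventually_gridCell (T' x)] with y hy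
      refine ⟨gridCorner y, ⟨T' x, hy _ (mem_gridCell_corner y), ?_⟩, mem_gridCell_corner y⟩
      rw [hTT']
      exact ⟨hxC, ball_subset_closedBall hxR⟩
    refine ⟨_, (hT'.continuousAt.eventually hnear).and hV, ?_⟩
    rintro u ⟨hu, huV⟩ v ⟨hv, hvV⟩
    simp only [n₁, ν]
    rw [gridRound_gridProj_of_mem hu, gridRound_gridProj_of_mem hv, hTT', hTT',
      antisymmetrize_eq hcoc huV hvV]

end PlanarGrid

/-! ### Folded charts of surfaces -/

section Charts

open unitInterval Filter

/-- The folding of the plane onto the closed right half plane. -/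
def foldMap (w : ℝ × ℝ) : ℝ × ℝ := (|w.1|, w.2)

/-- A chart of a surface, parametrised by the whole plane: either a homeomorphism of the plane onto
an open set, or the composition of the folding of the plane onto the closed half plane with a
homeomorphism of the half plane onto an open set. -/
structure SurfChart (X : Type*) [TopologicalSpace X] where
  /-- The identity, or the folding. -/
  ρ : ℝ × ℝ → ℝ × ℝ
  /-- The parametrisation. -/
  ψ : ℝ × ℝ → X
  /-- The coordinates. -/
  j : X → ℝ × ℝ
  ρ_eq : ρ = id ∨ ρ = foldMap
  cont : Continuous ψ
  isOpen : IsOpen (range ψ)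
  contj : ContinuousOn j (range ψ)
  j_ψ : ∀ w, j (ψ w) = ρ w
  ψ_ρ : ∀ w, ψ (ρ w) = ψ w

variable {X : Type*} [TopologicalSpace X]

namespace SurfChart

variable (χ : SurfChart X)

lemma norm_ρ (w : ℝ × ℝ) : ‖χ.ρ w‖ = ‖w‖ := by
  rcases χ.ρ_eq with h | h <;> simp [h, foldMap, Prod.norm_def]

lemma ρ_smul {a : ℝ} (ha : 0 ≤ a) (w : ℝ × ℝ) : χ.ρ (a • w) = a • χ.ρ w := by
  rcases χ.ρ_eq with h | h <;> simp [h, foldMap, abs_mul, abs_of_nonneg ha]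

lemma ρ_zero : χ.ρ 0 = 0 := by
  rcases χ.ρ_eq with h | h <;> simp [h, foldMap]

lemma continuous_ρ : Continuous χ.ρ := by
  rcases χ.ρ_eq with h | h
  · rw [h]; exact continuous_id
  · rw [h]; unfold foldMap; fun_prop

lemma ψ_j {x : X} (hx : x ∈ range χ.ψ) : χ.ψ (χ.j x) = x := by
  obtain ⟨w, rfl⟩ := hx
  rw [χ.j_ψ, χ.ψ_ρ]

lemma ρ_j {x : X} (hx : x ∈ range χ.ψ) : χ.ρ (χ.j x) = χ.j x := by
  rw [← χ.j_ψ, χ.ψ_j hx]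

lemma image_ball (r : ℝ) : χ.ψ '' ball 0 r = range χ.ψ ∩ χ.j ⁻¹' ball 0 r := by
  ext x
  constructor
  · rintro ⟨w, hw, rfl⟩
    exact ⟨mem_range_self w, by simpa [χ.j_ψ, χ.norm_ρ] using hw⟩
  · rintro ⟨hx, h⟩
    exact ⟨χ.j x, h, χ.ψ_j hx⟩

lemma isOpen_inter_preimage {O : Set (ℝ × ℝ)} (hO : IsOpen O) :
    IsOpen (range χ.ψ ∩ χ.j ⁻¹' O) :=
  χ.contj.isOpen_inter_preimage χ.isOpen hO

lemma isOpen_image_ball (r : ℝ) : IsOpen (χ.ψ '' ball 0 r) := by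
  rw [χ.image_ball]
  exact χ.isOpen_inter_preimage isOpen_ball

lemma continuousAt_j {x : X} (hx : x ∈ range χ.ψ) : ContinuousAt χ.j x :=
  χ.contj.continuousAt (χ.isOpen.mem_nhds hx)

lemma j_centre : χ.j (χ.ψ 0) = 0 := by rw [χ.j_ψ, χ.ρ_zero]

/-- Two paths with the same end points in the range of a chart are homotopic. -/
lemma homotopic {u v : X} {p q : Path u v} (hp : range p ⊆ range χ.ψ)
    (hq : range q ⊆ range χ.ψ) : p.Homotopic q := by
  have cp : Continuous fun t => χ.j (p t) :=
    χ.contj.comp_continuous p.continuous fun t => hp (mem_range_self t)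
  have cq : Continuous fun t => χ.j (q t) :=
    χ.contj.comp_continuous q.continuous fun t => hq (mem_range_self t)
  have hu : χ.ψ (χ.j u) = u := χ.ψ_j (hp ⟨0, p.source⟩)
  have hv : χ.ψ (χ.j v) = v := χ.ψ_j (hp ⟨1, p.target⟩)
  have hc := χ.cont
  refine ⟨⟨⟨⟨fun z => χ.ψ ((1 - (z.1 : ℝ)) • χ.j (p z.2) + (z.1 : ℝ) • χ.j (q z.2)), ?_⟩, ?_, ?_⟩,
    ?_⟩⟩
  · have cp' : Continuous fun z : I × I => χ.j (p z.2) := cp.comp continuous_snd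
    have cq' : Continuous fun z : I × I => χ.j (q z.2) := cq.comp continuous_snd
    have h1 : Continuous fun z : I × I => (z.1 : ℝ) := by fun_prop
    exact hc.comp (((continuous_const.sub h1).smul cp').add (h1.smul cq'))
  · intro t
    simp [χ.ψ_j (hp (mem_range_self t))]
  · intro t
    simp [χ.ψ_j (hq (mem_range_self t))]
  · rintro s t (rfl | rfl)
    · simp [← add_smul, hu]
    · simp [← add_smul, hv]

lemma exists_path {u v : X} (hu : u ∈ range χ.ψ) (hv : v ∈ range χ.ψ) :
    ∃ p : Path u v, range p ⊆ range χ.ψ := by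
  obtain ⟨a, rfl⟩ := hu
  obtain ⟨b, rfl⟩ := hv
  have hc := χ.cont
  refine ⟨⟨⟨fun t => χ.ψ ((1 - (t : ℝ)) • a + (t : ℝ) • b), by fun_prop⟩, by simp, by simp⟩, ?_⟩
  rintro _ ⟨t, rfl⟩
  exact mem_range_self _

/-- A chart may be shrunk around its centre. -/
lemma exists_shrink {O : Set X} (hO : O ∈ 𝓝 (χ.ψ 0)) :
    ∃ χ' : SurfChart X, χ'.ψ 0 = χ.ψ 0 ∧ χ'.ρ = χ.ρ ∧ range χ'.ψ ⊆ O ∩ range χ.ψ := by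
  obtain ⟨r, hr, hrO⟩ := Metric.mem_nhds_iff.1 (χ.cont.continuousAt hO)
  have hpos : ∀ w : ℝ × ℝ, 0 < 1 + ‖w‖ := fun w => by positivity
  have hnorm : ∀ w : ℝ × ℝ, ‖(r / (1 + ‖w‖)) • w‖ = r * ‖w‖ / (1 + ‖w‖) := fun w => by
    rw [norm_smul, Real.norm_of_nonneg (by have := hpos w; positivity)]; ring
  have hlt : ∀ w : ℝ × ℝ, ‖(r / (1 + ‖w‖)) • w‖ < r := fun w => by
    rw [hnorm, div_lt_iff₀ (hpos w)]; nlinarith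
  have hinv : ∀ w : ℝ × ℝ, ‖w‖ < r →
      (r / (1 + ‖(1 / (r - ‖w‖)) • w‖)) • (1 / (r - ‖w‖)) • w = w := fun w hw => by
    have h1 : 0 < r - ‖w‖ := by linarith
    rw [norm_smul, Real.norm_of_nonneg (by positivity), smul_smul]
    have : r / (1 + 1 / (r - ‖w‖) * ‖w‖) * (1 / (r - ‖w‖)) = 1 := by
      have : 1 + 1 / (r - ‖w‖) * ‖w‖ = r / (r - ‖w‖) := by field_simp; ring
      rw [this]; field_simp
    rw [this, one_smul]
  have hinv' : ∀ w : ℝ × ℝ, (1 / (r - ‖(r / (1 + ‖w‖)) • w‖)) • (r / (1 + ‖w‖)) • w = w :=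
    fun w => by
    have h0 := hpos w
    rw [hnorm, smul_smul]
    have : 1 / (r - r * ‖w‖ / (1 + ‖w‖)) * (r / (1 + ‖w‖)) = 1 := by
      have : r - r * ‖w‖ / (1 + ‖w‖) = r / (1 + ‖w‖) := by field_simp; ring
      rw [this]; field_simp
    rw [this, one_smul]
  have hrange : range (fun w : ℝ × ℝ => χ.ψ ((r / (1 + ‖w‖)) • w)) = χ.ψ '' ball 0 r := by
    ext x
    constructor
    · rintro ⟨w, rfl⟩
      exact ⟨_, by simpa using hlt w, rfl⟩
    · rintro ⟨w, hw, rfl⟩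
      refine ⟨(1 / (r - ‖w‖)) • w, ?_⟩
      beta_reduce
      rw [hinv w (by simpa using hw)]
  have hc := χ.cont
  refine ⟨⟨χ.ρ, fun w => χ.ψ ((r / (1 + ‖w‖)) • w), fun x => (1 / (r - ‖χ.j x‖)) • χ.j x, χ.ρ_eq,
    ?_, ?_, ?_, ?_, ?_⟩, by simp, rfl, ?_⟩
  · exact hc.comp (Continuous.smul (continuous_const.div (by fun_prop) fun w => (hpos w).ne')
      continuous_id)
  · rw [hrange]; exact χ.isOpen_image_ball r
  · rw [hrange, χ.image_ball]
    have hj : ContinuousOn χ.j (range χ.ψ ∩ χ.j ⁻¹' ball 0 r) := χ.contj.mono inter_subset_left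
    refine ContinuousOn.smul (ContinuousOn.div continuousOn_const (continuousOn_const.sub hj.norm)
      fun x hx => ?_) hj
    have : ‖χ.j x‖ < r := by simpa using hx.2
    simpa [sub_eq_zero] using this.ne'
  · intro w
    have h0 := hpos w
    rw [χ.j_ψ, χ.norm_ρ, χ.ρ_smul (by positivity)]
    have := hinv' (χ.ρ w)
    rwa [χ.norm_ρ, norm_smul, χ.norm_ρ, ← norm_smul] at this
  · intro w
    have h0 := hpos w
    rw [χ.norm_ρ, ← χ.ρ_smul (by positivity), χ.ψ_ρ]
  · change range (fun w : ℝ × ℝ => χ.ψ ((r / (1 + ‖w‖)) • w)) ⊆ _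
    rw [hrange]
    rintro _ ⟨w, hw, rfl⟩
    exact ⟨hrO hw, mem_range_self w⟩

end SurfChart

/-- A surface in the sense of folded charts. -/
def HasCharts (X : Type*) [TopologicalSpace X] : Prop := ∀ x : X, ∃ χ : SurfChart X, χ.ψ 0 = x

lemma HasCharts.exists_chart (hX : HasCharts X) {x : X} {O : Set X} (hO : O ∈ 𝓝 x) :
    ∃ χ : SurfChart X, χ.ψ 0 = x ∧ range χ.ψ ⊆ O := by
  obtain ⟨χ, rfl⟩ := hX x
  obtain ⟨χ', h1, -, h2⟩ := χ.exists_shrink hO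
  exact ⟨χ', h1, h2.trans inter_subset_left⟩

lemma HasCharts.pathConnectedSpace [ConnectedSpace X] (hX : HasCharts X) :
    PathConnectedSpace X := by
  have : LocallyPathConnectedSpace X := by
    refine LocallyPathConnectedSpace.of_bases (p := fun x (χ : SurfChart X) => χ.ψ 0 = x)
      (s := fun x χ => range χ.ψ) (fun x => ⟨fun t => ⟨fun ht => ?_, ?_⟩⟩) ?_
    · exact hX.exists_chart ht
    · rintro ⟨χ, rfl, h⟩
      exact mem_of_superset (χ.isOpen.mem_nhds (mem_range_self 0)) h
    · rintro x χ rfl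
      exact isPathConnected_range χ.cont
  exact pathConnectedSpace_iff_connectedSpace.2 inferInstance

end Charts

/-! ### The canonical cocycle of a surface with an involution fixing an arc -/

section Canonical

open unitInterval Filter

lemma exists_half_of_involutive {X : Type*} {h : X → X} (hh : Involutive h) :
    ∃ D : Set X, ∀ x, h x ≠ x → (h x ∈ D ↔ x ∉ D) := by
  refine ⟨{x | WellOrderingRel x (h x)}, fun x hx => ?_⟩
  change WellOrderingRel (h x) (h (h x)) ↔ ¬ WellOrderingRel x (h x)
  rw [hh x]
  constructor
  · intro h1 h2
    exact asymm h1 h2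
  · intro h1
    rcases trichotomous_of WellOrderingRel x (h x) with h2 | h2 | h2
    · exact absurd h2 h1
    · exact absurd h2.symm hx
    · exact h2

/-- An involution whose fixed point set is an arc. -/
structure ArcInvolution (X : Type*) [TopologicalSpace X] where
  /-- The involution. -/
  h : X → X
  cont : Continuous h
  invol : Involutive h
  /-- The arc. -/
  θ : I → X
  contθ : Continuous θ
  injθ : Injective θ
  fix : ∀ x, h x = x ↔ x ∈ range θ

namespace ArcInvolution

section Top

variable {X : Type*} [TopologicalSpace X] (D : ArcInvolution X)

lemma h_θ (t : I) : D.h (D.θ t) = D.θ t := (D.fix _).2 (mem_range_self t)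

lemma h_mem {x : X} : D.h x ∈ range D.θ ↔ x ∈ range D.θ := by
  rw [← D.fix, ← D.fix, D.invol x]
  exact eq_comm

/-- The action of the involution on the fundamental group. -/
def τ : FundamentalGroup X (D.θ 0) →* FundamentalGroup X (D.θ 0) :=
  FundamentalGroup.mapOfEq ⟨D.h, D.cont⟩ (D.h_θ 0)

lemma τ_mk (γ : Path (D.θ 0) (D.θ 0)) : D.τ (Path.Homotopic.Quotient.mk γ) =
    Path.Homotopic.Quotient.mk ((γ.map D.cont).cast (D.h_θ 0).symm (D.h_θ 0).symm) := by
  rw [τ, FundamentalGroup.mapOfEq_apply]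
  rfl

lemma τ_τ (g : FundamentalGroup X (D.θ 0)) : D.τ (D.τ g) = g := by
  induction g using Path.Homotopic.Quotient.ind with | _ γ =>
  rw [D.τ_mk, D.τ_mk]
  congr 1
  ext t
  exact D.invol _

/-- The path in the arc from `θ 0` to `θ t`. -/
def arcPath (t : I) : Path (D.θ 0) (D.θ t) :=
  ((⟨⟨D.θ, D.contθ⟩, rfl, rfl⟩ : Path (D.θ 0) (D.θ 1)).subpath 0 t).cast rfl rfl

lemma exists_base [PathConnectedSpace X] : ∃ b : ∀ x, Path (D.θ 0) x,
    (∀ x t, b (D.h x) t = D.h (b x t)) ∧ ∀ s t, (b (D.θ s)) t = D.arcPath s t := by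
  classical
  obtain ⟨E, hE⟩ := exists_half_of_involutive D.invol
  let p : ∀ x, Path (D.θ 0) x := fun x => PathConnectedSpace.somePath _ _
  let b : ∀ x, Path (D.θ 0) x := fun x =>
    if hx : x ∈ range D.θ then (D.arcPath hx.choose).cast rfl hx.choose_spec.symm
    else if x ∈ E then p x
      else ((p (D.h x)).map D.cont).cast (D.h_θ 0).symm (D.invol x).symm
  have hb1 : ∀ s t, b (D.θ s) t = D.arcPath s t := fun s t => by
    have hx : D.θ s ∈ range D.θ := mem_range_self s
    have : hx.choose = s := D.injθ hx.choose_spec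
    simp only [b, dif_pos hx, Path.cast_coe]
    rw [this]
  refine ⟨b, fun x t => ?_, hb1⟩
  by_cases hx : x ∈ range D.θ
  · obtain ⟨s, rfl⟩ := hx
    have : D.h (b (D.θ s) t) = b (D.θ s) t := by
      rw [hb1, D.fix]
      exact ⟨_, rfl⟩
    rw [this]
    have e : D.h (D.θ s) = D.θ s := D.h_θ s
    generalize D.h (D.θ s) = z at e
    subst e
    rfl
  · have hx' : D.h x ∉ range D.θ := fun h => hx (D.h_mem.1 h)
    have hne : D.h x ≠ x := fun h => hx ((D.fix x).1 h)
    by_cases hxE : x ∈ E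
    · have : D.h x ∉ E := fun h => (hE x hne).1 h hxE
      simp only [b, dif_neg hx, dif_neg hx', if_pos hxE, if_neg this, Path.cast_coe, Path.map_coe,
        comp_apply]
      have e : D.h (D.h x) = x := D.invol x
      generalize D.h (D.h x) = z at e
      subst e
      rfl
    · have : D.h x ∈ E := (hE x hne).2 hxE
      simp only [b, dif_neg hx, dif_neg hx', if_pos this, if_neg hxE, Path.cast_coe, Path.map_coe,
        comp_apply]
      exact (D.invol _).symm

end Top

section Metric

variable {X : Type*} [MetricSpace X] (D : ArcInvolution X)

/-- A path which stays close to its starting point, together with its image. -/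
def SmallPath (ε : ℝ) {u v : X} (q : Path u v) : Prop :=
  ∀ t, dist (q t) u < ε ∧ dist (D.h (q t)) (D.h u) < ε

variable {D} in
lemma SmallPath.map {ε : ℝ} {u v : X} {q : Path u v} (hq : D.SmallPath ε q) :
    D.SmallPath ε (q.map D.cont) := fun t => by
  refine ⟨(hq t).2, ?_⟩
  change dist (D.h (D.h (q t))) (D.h (D.h u)) < ε
  rw [D.invol, D.invol]
  exact (hq t).1

variable (b : ∀ x, Path (D.θ 0) x)

open Classical in
/-- The canonical cocycle: the class of a small loop based with the paths `b`. -/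
def canonCocycle (ε : ℝ) (u v : X) : FundamentalGroup X (D.θ 0) :=
  if h : ∃ q : Path u v, D.SmallPath ε q then
    Path.Homotopic.Quotient.mk ((b u).trans (h.choose.trans (b v).symm)) else 1

/-- Paths with the same end points in a common ball of radius `ε` are homotopic. -/
def HomotopicInBalls (X : Type*) [MetricSpace X] (ε : ℝ) : Prop :=
  ∀ (z u v : X) (p q : Path u v), (∀ t, dist (p t) z < ε) → (∀ t, dist (q t) z < ε) → p.Homotopic q

variable {D} {b} {ε : ℝ}

lemma canonCocycle_eq (hε : HomotopicInBalls X ε) {u v : X} {q : Path u v}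
    (hq : D.SmallPath ε q) : D.canonCocycle b ε u v =
      Path.Homotopic.Quotient.mk ((b u).trans (q.trans (b v).symm)) := by
  have h : ∃ q : Path u v, D.SmallPath ε q := ⟨q, hq⟩
  rw [canonCocycle, dif_pos h]
  simp only [Path.Homotopic.Quotient.mk_trans]
  rw [Path.Homotopic.Quotient.eq.2 (hε u u v _ _ (fun t => (h.choose_spec t).1)
    (fun t => (hq t).1))]

lemma canonCocycle_h (hε : HomotopicInBalls X ε) (hb : ∀ x t, b (D.h x) t = D.h (b x t))
    (u v : X) : D.canonCocycle b ε (D.h u) (D.h v) = D.τ (D.canonCocycle b ε u v) := by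
  by_cases h : ∃ q : Path u v, D.SmallPath ε q
  · obtain ⟨q, hq⟩ := h
    rw [canonCocycle_eq hε hq, canonCocycle_eq hε hq.map, D.τ_mk]
    congr 1
    ext t
    simp only [Path.trans_apply, Path.symm_apply, Path.cast_coe, Path.map_coe, comp_apply]
    split_ifs <;> simp [hb]
  · have h' : ¬ ∃ q : Path (D.h u) (D.h v), D.SmallPath ε q := by
      rintro ⟨q, hq⟩
      refine h ⟨(q.map D.cont).cast (D.invol u).symm (D.invol v).symm, fun t => ?_⟩
      have := hq.map t
      simpa [D.invol u] using this
    rw [canonCocycle, canonCocycle, dif_neg h, dif_neg h', map_one]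

lemma exists_small_nhd (hX : HasCharts X) (hε : 0 < ε) (x : X) :
    ∃ χ : SurfChart X, χ.ψ 0 = x ∧ ∀ u v : X, ∀ q : Path u v, range q ⊆ range χ.ψ →
      D.SmallPath ε q := by
  have hO : ball x (ε / 2) ∩ D.h ⁻¹' ball (D.h x) (ε / 2) ∈ 𝓝 x :=
    inter_mem (ball_mem_nhds _ (half_pos hε))
      (D.cont.continuousAt (ball_mem_nhds _ (half_pos hε)))
  obtain ⟨χ, h0, h⟩ := hX.exists_chart hO
  refine ⟨χ, h0, fun u v q hq t => ?_⟩
  have h1 := h (hq (mem_range_self t))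
  have h2 := h (hq ⟨0, q.source⟩)
  simp only [mem_inter_iff, mem_preimage, mem_ball] at h1 h2
  constructor
  · linarith [dist_triangle_right (q t) u x]
  · linarith [dist_triangle_right (D.h (q t)) (D.h u) (D.h x)]

lemma canonCocycle_loc (hX : HasCharts X) (hε0 : 0 < ε) (hε : HomotopicInBalls X ε) (x : X) :
    LocCocycleAt (D.canonCocycle b ε) x := by
  obtain ⟨χ, rfl, h⟩ := D.exists_small_nhd hX hε0 x
  refine ⟨range χ.ψ, χ.isOpen.mem_nhds (mem_range_self 0), fun u hu v hv w hw => ?_⟩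
  obtain ⟨p, hp⟩ := χ.exists_path hu hv
  obtain ⟨q, hq⟩ := χ.exists_path hv hw
  rw [canonCocycle_eq hε (h _ _ p hp), canonCocycle_eq hε (h _ _ q hq),
    canonCocycle_eq hε (h _ _ (p.trans q) (by rw [Path.trans_range]; exact union_subset hp hq)),
    FundamentalGroup.mul_def]
  simp only [Path.Homotopic.Quotient.mk_trans, Path.Homotopic.Quotient.mk_symm,
    Path.Homotopic.Quotient.trans_assoc]
  rw [← Path.Homotopic.Quotient.trans_assoc (Path.Homotopic.Quotient.mk (b v)).symm]
  simp

lemma canonCocycle_hol (hε0 : 0 < ε) (hε : HomotopicInBalls X ε)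
    (γ : Path (D.θ 0) (D.θ 0)) (hb0 : b (D.θ 0) = Path.refl _) :
    hol (D.canonCocycle b ε) γ = Path.Homotopic.Quotient.mk γ := by
  let g : ∀ s t : I, Path.Homotopic.Quotient (γ s) (γ t) := fun s t =>
    Path.Homotopic.Quotient.mk (γ.subpath s t)
  have hg : ∀ s t u, (g s t).trans (g t u) = g s u := fun s t u =>
    Path.Homotopic.Quotient.eq.2 ⟨Path.Homotopy.subpathTransSubpath γ s t u⟩
  let B : I → FundamentalGroup X (D.θ 0) := fun t =>
    ((g 0 t).cast γ.source.symm rfl).trans (Path.Homotopic.Quotient.mk (b (γ t))).symm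
  have hB : IsPrim (fun s t => D.canonCocycle b ε (γ s) (γ t)) B := by
    intro t
    have hN : ∀ᶠ s in 𝓝 t, dist (γ s) (γ t) < ε ∧ dist (D.h (γ s)) (D.h (γ t)) < ε :=
      (γ.continuous.continuousAt.eventually (ball_mem_nhds _ hε0)).and
        ((D.cont.comp γ.continuous).continuousAt.eventually (ball_mem_nhds _ hε0))
    obtain ⟨r, hr, H⟩ := Metric.eventually_nhds_iff.1 hN
    filter_upwards [ball_mem_nhds t hr] with s hs
    have hsm : D.SmallPath ε (γ.subpath t s) := by
      intro a
      have : (γ.subpath t s) a ∈ range (γ.subpath t s) := mem_range_self a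
      rw [Path.range_subpath] at this
      obtain ⟨c, hc, hc'⟩ := this
      rw [← hc']
      apply H
      rw [uIcc_comm] at hc
      have h1 : |(c : ℝ) - t| ≤ |(s : ℝ) - t| := by
        rcases le_total s t with hst | hst
        · rw [uIcc_of_le hst] at hc
          have a1 : (s : ℝ) ≤ c := hc.1
          have a2 : (c : ℝ) ≤ t := hc.2
          rw [abs_of_nonpos (by linarith), abs_of_nonpos (by linarith)]; linarith
        · rw [uIcc_of_ge hst] at hc
          have a1 : (t : ℝ) ≤ c := hc.1
          have a2 : (c : ℝ) ≤ s := hc.2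
          rw [abs_of_nonneg (by linarith), abs_of_nonneg (by linarith)]; linarith
      exact lt_of_le_of_lt h1 hs
    rw [canonCocycle_eq hε hsm, FundamentalGroup.mul_def]
    have e : (g 0 s).cast γ.source.symm rfl =
        ((g 0 t).cast γ.source.symm rfl).trans (g t s) := by
      rw [← hg 0 t s]
      rfl
    simp only [B]
    rw [e]
    simp only [Path.Homotopic.Quotient.mk_trans, Path.Homotopic.Quotient.mk_symm,
      Path.Homotopic.Quotient.trans_assoc]
    rw [← Path.Homotopic.Quotient.trans_assoc (Path.Homotopic.Quotient.mk (b (γ t))).symm]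
    simp [g]
  have hsymm : ∀ t, γ t = D.θ 0 → ∀ h, (Path.Homotopic.Quotient.mk (b (γ t))).symm =
      (Path.Homotopic.Quotient.refl (D.θ 0)).cast h rfl := by
    intro t ht
    generalize γ t = z at ht
    subst ht
    intro h
    rw [hb0]
    rfl
  have hb0' : B 0 = 1 := by
    simp only [B, g, Path.subpath_self]
    rw [hsymm 0 γ.source γ.source]
    have h1 := Path.Homotopic.Quotient.refl_trans (Path.Homotopic.Quotient.refl (D.θ 0))
    rw [FundamentalGroup.one_def]
    refine Eq.trans ?_ h1
    simp only [← Path.Homotopic.Quotient.mk_refl, ← Path.Homotopic.Quotient.mk_cast,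
      ← Path.Homotopic.Quotient.mk_trans]
    congr 1
    ext t
    simp [Path.trans_apply]
  have hb1' : B 1 = Path.Homotopic.Quotient.mk γ := by
    simp only [B, g, Path.subpath_zero_one]
    rw [hsymm 1 γ.target γ.target]
    have h1 := Path.Homotopic.Quotient.trans_refl (Path.Homotopic.Quotient.mk γ)
    refine Eq.trans ?_ h1
    simp only [← Path.Homotopic.Quotient.mk_refl, ← Path.Homotopic.Quotient.mk_cast,
      ← Path.Homotopic.Quotient.mk_trans]
    congr 1
  rw [hol_eq hB, hb0', hb1', inv_one, mul_one]

lemma canonCocycle_arc (hε0 : 0 < ε) (hε : HomotopicInBalls X ε)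
    (hb : ∀ s t, (b (D.θ s)) t = D.arcPath s t) (s : I) :
    ∃ V ∈ 𝓝 (D.θ s), ∀ u ∈ V, ∀ v ∈ V, u ∈ range D.θ → v ∈ range D.θ →
      D.canonCocycle b ε u v = 1 := by
  obtain ⟨r, hr, H⟩ := Metric.eventually_nhds_iff.1
    (D.contθ.continuousAt.eventually (ball_mem_nhds (D.θ s) (half_pos hε0)))
  refine ⟨(D.θ '' (ball s r)ᶜ)ᶜ, ?_, ?_⟩
  · refine ((isOpen_ball.isClosed_compl.isCompact.image D.contθ).isClosed.isOpen_compl).mem_nhds ?_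
    rintro ⟨t, ht, hts⟩
    exact ht (by rw [D.injθ hts]; exact mem_ball_self hr)
  rintro _ hu _ hv ⟨s', rfl⟩ ⟨s'', rfl⟩
  have hu' : s' ∈ ball s r := by by_contra h; exact hu ⟨s', h, rfl⟩
  have hv' : s'' ∈ ball s r := by by_contra h; exact hv ⟨s'', h, rfl⟩
  let Θ : Path (D.θ 0) (D.θ 1) := ⟨⟨D.θ, D.contθ⟩, rfl, rfl⟩
  have hsm : D.SmallPath ε (Θ.subpath s' s'') := by
    intro a
    have : (Θ.subpath s' s'') a ∈ range (Θ.subpath s' s'') := mem_range_self a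
    rw [Path.range_subpath] at this
    obtain ⟨c, hc, hc'⟩ := this
    rw [← hc']
    have hcs : dist c s < r := by
      have hu1 : |(s' : ℝ) - s| < r := hu'
      have hv1 : |(s'' : ℝ) - s| < r := hv'
      change |(c : ℝ) - s| < r
      rw [abs_lt] at *
      rcases le_total s' s'' with hst | hst
      · rw [uIcc_of_le hst] at hc
        have a1 : (s' : ℝ) ≤ c := hc.1
        have a2 : (c : ℝ) ≤ s'' := hc.2
        constructor <;> linarith
      · rw [uIcc_of_ge hst] at hc
        have a1 : (s'' : ℝ) ≤ c := hc.1
        have a2 : (c : ℝ) ≤ s' := hc.2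
        constructor <;> linarith
    have h1 : dist (D.θ c) (D.θ s') < ε := by
      have e1 : dist (D.θ c) (D.θ s) < ε / 2 := H hcs
      have e2 : dist (D.θ s') (D.θ s) < ε / 2 := H hu'
      linarith [dist_triangle_right (D.θ c) (D.θ s') (D.θ s)]
    refine ⟨h1, ?_⟩
    change dist (D.h (D.θ c)) (D.h (D.θ s')) < ε
    rwa [D.h_θ, D.h_θ]
  have e : ∀ t, b (D.θ t) = D.arcPath t := fun t => by ext a; exact hb t a
  have hc : D.canonCocycle b ε (D.θ s') (D.θ s'') =
      Path.Homotopic.Quotient.mk ((b (D.θ s')).trans ((Θ.subpath s' s'').trans (b (D.θ s'')).symm)) :=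
    canonCocycle_eq hε hsm
  rw [hc, e, e, FundamentalGroup.one_def]
  have h2 : (Path.Homotopic.Quotient.mk (D.arcPath s')).trans
      (Path.Homotopic.Quotient.mk (Θ.subpath s' s'')) =
      Path.Homotopic.Quotient.mk (D.arcPath s'') :=
    Path.Homotopic.Quotient.eq.2 ⟨Path.Homotopy.subpathTransSubpath Θ 0 s' s''⟩
  simp only [Path.Homotopic.Quotient.mk_trans, Path.Homotopic.Quotient.mk_symm]
  refine (Path.Homotopic.Quotient.trans_assoc (Path.Homotopic.Quotient.mk (D.arcPath s'))
    (Path.Homotopic.Quotient.mk (Θ.subpath s' s''))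
    (Path.Homotopic.Quotient.mk (D.arcPath s'')).symm).symm.trans ?_
  rw [h2]
  exact Path.Homotopic.Quotient.trans_symm _

lemma exists_homotopicInBalls [CompactSpace X] (hX : HasCharts X) :
    ∃ ε > 0, HomotopicInBalls X ε := by
  choose χ hχ using hX
  obtain ⟨ε, hε, H⟩ := lebesgue_number_lemma_of_metric (s := univ) (c := fun x => range (χ x).ψ)
    isCompact_univ (fun x => (χ x).isOpen) (fun x _ => mem_iUnion.2 ⟨x, 0, hχ x⟩)
  refine ⟨ε, hε, fun z u v p q hp hq => ?_⟩
  obtain ⟨x, hx⟩ := H z (mem_univ z)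
  refine (χ x).homotopic ?_ ?_
  · rintro _ ⟨t, rfl⟩
    exact hx (hp t)
  · rintro _ ⟨t, rfl⟩
    exact hx (hq t)

variable (D)

/-- There is an equivariant local cocycle with values in the fundamental group, trivial along the
arc, whose holonomy is the identity. -/
theorem exists_canonical [CompactSpace X] [ConnectedSpace X] (hX : HasCharts X) :
    ∃ c : X → X → FundamentalGroup X (D.θ 0), (∀ x, LocCocycleAt c x) ∧
      (∀ x y, c (D.h x) (D.h y) = D.τ (c x y)) ∧
      (∀ s, ∃ V ∈ 𝓝 (D.θ s), ∀ u ∈ V, ∀ v ∈ V, u ∈ range D.θ → v ∈ range D.θ → c u v = 1) ∧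
      ∀ γ : Path (D.θ 0) (D.θ 0), hol c γ = Path.Homotopic.Quotient.mk γ := by
  have := hX.pathConnectedSpace
  obtain ⟨b, hb, hbθ⟩ := D.exists_base
  obtain ⟨ε, hε0, hε⟩ := exists_homotopicInBalls hX
  refine ⟨D.canonCocycle b ε, canonCocycle_loc hX hε0 hε, canonCocycle_h hε hb,
    canonCocycle_arc hε0 hε hbθ, fun γ => canonCocycle_hol hε0 hε γ ?_⟩
  ext t
  rw [hbθ]
  simp [arcPath]

end Metric

end ArcInvolution

end Canonical

/-! ### Equivariant lifting of a cocycle away from finitely many points -/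

section Lifting

open Filter

/-- Near `x`, `f` is a cocycle which lifts `c` along `p`. -/
def LiftsAt {X F G : Type*} [TopologicalSpace X] [Group F] [Group G] (p : F →* G)
    (c : X → X → G) (f : X → X → F) (x : X) : Prop :=
  ∃ V ∈ 𝓝 x, CocycleOn f V ∧ ∀ u ∈ V, ∀ v ∈ V, p (f u v) = c u v

/-- The preimage of a finite set under a folded chart is finite. -/
lemma SurfChart.finite_preimage {X : Type*} [TopologicalSpace X] (χ : SurfChart X) {P : Set X}
    (hP : P.Finite) : (χ.ψ ⁻¹' P).Finite := by
  have hρ : (χ.ρ ⁻¹' (χ.j '' P)).Finite := by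
    refine (hP.image χ.j).preimage' fun z _ => ?_
    rcases χ.ρ_eq with h | h
    · rw [h]; exact (finite_singleton z)
    · rw [h]
      refine ((finite_singleton z).union (finite_singleton (-z.1, z.2))).subset ?_
      rintro ⟨a, b⟩ hab
      simp only [foldMap, mem_preimage, mem_singleton_iff] at hab
      subst hab
      rcases abs_choice a with h | h <;> simp [h]
  refine hρ.subset fun w hw => ?_
  exact ⟨χ.ψ w, hw, χ.j_ψ w⟩

variable {X F G : Type*} [Group F] [Group G] {σ : F →* F} {τ : G →* G} {p : F →* G}

section Top

variable [TopologicalSpace X] {D : ArcInvolution X} {c : X → X → G}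

lemma LiftsAt.h {f : X → X → F} {x : X} (hf : LiftsAt p c f x)
    (hpσ : ∀ w, p (σ w) = τ (p w)) (hcτ : ∀ x y, c (D.h x) (D.h y) = τ (c x y))
    (hfσ : ∀ x y, f (D.h x) (D.h y) = σ (f x y)) : LiftsAt p c f (D.h x) := by
  obtain ⟨V, hV, h1, h2⟩ := hf
  have e : ∀ u v, f u v = σ (f (D.h u) (D.h v)) := fun u v => by rw [← hfσ, D.invol, D.invol]
  refine ⟨D.h ⁻¹' V, D.cont.continuousAt (by rwa [D.invol x]), fun u hu v hv w hw => ?_,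
    fun u hu v hv => ?_⟩
  · rw [e v w, e u v, e u w, ← map_mul, h1 _ hu _ hv _ hw]
  · rw [e, hpσ, h2 _ hu _ hv, ← hcτ, D.invol, D.invol]

/-- There is an equivariant `f`, which lifts `c` on a neighbourhood of `L` away from a finite
invariant set disjoint from the arc. -/
def LiftsNear (D : ArcInvolution X) (σ : F →* F) (p : F →* G) (c : X → X → G) (L : Set X) :
    Prop :=
  ∃ (f : X → X → F) (P U : Set X), P.Finite ∧ (∀ x ∈ P, D.h x ∈ P) ∧ Disjoint P (range D.θ) ∧
    (∀ x y, f (D.h x) (D.h y) = σ (f x y)) ∧ IsOpen U ∧ L ⊆ U ∧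
    ∀ x ∈ U, x ∉ P → LiftsAt p c f x

lemma exists_equivariant_lift (D : ArcInvolution X) (hσ : ∀ w, σ (σ w) = w) (hp : Surjective p)
    (hpσ : ∀ w, p (σ w) = τ (p w)) {β : X → G} (hβ : ∀ x, β (D.h x) = τ (β x))
    (hβ1 : ∀ x ∈ range D.θ, β x = 1) :
    ∃ B : X → F, (∀ x, B (D.h x) = σ (B x)) ∧ ∀ x, p (B x) = β x := by
  classical
  obtain ⟨E, hE⟩ := exists_half_of_involutive D.invol
  choose l hl using hp
  refine ⟨fun x => if x ∈ range D.θ then 1 else if x ∈ E then l (β x) else σ (l (β (D.h x))),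
    fun x => ?_, fun x => ?_⟩
  · by_cases hx : x ∈ range D.θ
    · simp only [if_pos hx, if_pos (D.h_mem.2 hx), map_one]
    · have hne : D.h x ≠ x := fun h => hx ((D.fix x).1 h)
      have hx' : D.h x ∉ range D.θ := fun h => hx (D.h_mem.1 h)
      by_cases hxE : x ∈ E
      · have : D.h x ∉ E := fun h => (hE x hne).1 h hxE
        simp only [if_neg hx, if_neg hx', if_pos hxE, if_neg this, D.invol x]
      · have : D.h x ∈ E := (hE x hne).2 hxE
        simp only [if_neg hx, if_neg hx', if_pos this, if_neg hxE, hσ]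
  · by_cases hx : x ∈ range D.θ
    · simp only [if_pos hx, map_one, hβ1 x hx]
    · by_cases hxE : x ∈ E
      · simp only [if_neg hx, if_pos hxE, hl]
      · simp only [if_neg hx, if_neg hxE, hpσ, hl, ← hβ, D.invol x]

end Top

variable [MetricSpace X] {D : ArcInvolution X} {c : X → X → G}

lemma liftsNear_arc [CompactSpace X] (hσ : ∀ w, σ (σ w) = w) (hp : Surjective p)
    (hpσ : ∀ w, p (σ w) = τ (p w)) (hc : ∀ x, LocCocycleAt c x)
    (hcτ : ∀ x y, c (D.h x) (D.h y) = τ (c x y))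
    (hcθ : ∀ s, ∃ V ∈ 𝓝 (D.θ s), ∀ u ∈ V, ∀ v ∈ V, u ∈ range D.θ → v ∈ range D.θ → c u v = 1) :
    LiftsNear D σ p c (range D.θ) := by
  classical
  obtain ⟨r, hr, hcr⟩ := exists_pos_cocycle hc
  choose V hV hV1 using hcθ
  obtain ⟨r', hr', hcr'⟩ := lebesgue_number_lemma_of_metric (s := range D.θ)
    (c := fun t => interior (V t)) (isCompact_range D.contθ) (fun _ => isOpen_interior)
    (by rintro _ ⟨t, rfl⟩; exact mem_iUnion.2 ⟨t, mem_interior_iff_mem_nhds.2 (hV t)⟩)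
  have hone : ∀ u ∈ range D.θ, ∀ v ∈ range D.θ, dist v u < r' → c u v = 1 := by
    intro u hu v hv huv
    obtain ⟨t, ht⟩ := hcr' u hu
    exact hV1 t u (interior_subset (ht (mem_ball_self hr'))) v (interior_subset (ht huv)) hu hv
  let η := min r r' / 4
  have hη : 0 < η := by have := lt_min hr hr'; positivity
  have hηr : 4 * η ≤ r := by have := min_le_left r r'; simp only [η]; linarith
  have hηr' : 4 * η ≤ r' := by have := min_le_right r r'; simp only [η]; linarith
  let N : X → Set X := fun x => {y | y ∈ range D.θ ∧ dist x y < η ∧ dist (D.h x) y < η}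
  have hN : ∀ x, N (D.h x) = N x := fun x => by
    ext y
    change (_ ∧ _ ∧ dist (D.h (D.h x)) y < η) ↔ (_ ∧ _ ∧ _)
    rw [D.invol x, and_comm (a := dist (D.h x) y < η)]
  let ch : Set X → X := fun A => if h : A.Nonempty then h.choose else D.θ 0
  let O : Set X := {x | (N x).Nonempty}
  have hO : IsOpen O := by
    have : O = ⋃ y ∈ range D.θ, ball y η ∩ D.h ⁻¹' ball y η := by
      ext x
      simp only [O, N, mem_iUnion, Set.Nonempty]
      simp
    rw [this]
    exact isOpen_biUnion fun y _ => isOpen_ball.inter (isOpen_ball.preimage D.cont)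
  let ν : X → X := fun x => ch (N x)
  have hν : ∀ x ∈ O, ν x ∈ N x := fun x hx => by
    have hx' : (N x).Nonempty := hx
    simp only [ν, ch, dif_pos hx']
    exact hx'.choose_spec
  have hOh : ∀ x, D.h x ∈ O ↔ x ∈ O := fun x => by
    change (N (D.h x)).Nonempty ↔ (N x).Nonempty
    rw [hN]
  have hθO : range D.θ ⊆ O := fun x hx =>
    ⟨x, hx, by simpa using hη, by rw [(D.fix x).2 hx]; simpa using hη⟩
  let β : X → G := fun x => if x ∈ O then c (ν x) x else 1
  have hβ : ∀ x, β (D.h x) = τ (β x) := fun x => by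
    by_cases hx : x ∈ O
    · simp only [β, if_pos hx, if_pos ((hOh x).2 hx), ← hcτ]
      congr 1
      simp only [ν, hN]
      exact ((D.fix _).2 (hν x hx).1).symm
    · simp only [β, if_neg hx, if_neg (mt (hOh x).1 hx), map_one]
  have hβ1 : ∀ x ∈ range D.θ, β x = 1 := fun x hx => by
    simp only [β, if_pos (hθO hx)]
    have := hν x (hθO hx)
    exact hone _ this.1 _ hx (by linarith [this.2.1])
  obtain ⟨B, hB, hpB⟩ := exists_equivariant_lift D hσ hp hpσ hβ hβ1
  refine ⟨fun x y => B y * (B x)⁻¹, ∅, O, finite_empty, by simp, by simp, fun x y => ?_, hO, hθO,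
    fun x hx _ => ⟨ball x η ∩ O, inter_mem (ball_mem_nhds x hη) (hO.mem_nhds hx), ?_, ?_⟩⟩
  · simp [hB]
  · intro u _ v _ w _
    group
  · rintro u ⟨hu, huO⟩ v ⟨hv, hvO⟩
    rw [map_mul, map_inv, hpB, hpB]
    simp only [β, if_pos huO, if_pos hvO]
    have h1 := hν u huO
    have h2 := hν v hvO
    have hu' : dist u x < η := hu
    have hv' : dist v x < η := hv
    have d1 : dist (ν u) x < 2 * η := by
      linarith [dist_triangle_left (ν u) x u, h1.2.1]
    have d2 : dist (ν v) x < 2 * η := by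
      linarith [dist_triangle_left (ν v) x v, h2.2.1]
    have m : ∀ z, dist z x < 2 * η → z ∈ ball x r := fun z hz => by
      have : dist z x < r := by linarith
      exact this
    have mu := m u (by linarith)
    have mv := m v (by linarith)
    have e1 := hcr x _ (m _ d1) _ mu _ mv
    have e2 := hcr x _ (m _ d1) _ (m _ d2) _ mv
    rw [hone _ h1.1 _ h2.1 (by linarith [dist_triangle_right (ν v) (ν u) x]), mul_one] at e2
    rw [e2, ← e1]
    group

lemma LiftsNear.union_chart {L : Set X} (hL : IsClosed L) (H : LiftsNear D σ p c L)
    (hσ : ∀ w, σ (σ w) = w) (hp : Surjective p)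
    (hpσ : ∀ w, p (σ w) = τ (p w)) (hcτ : ∀ x y, c (D.h x) (D.h y) = τ (c x y))
    (χ : SurfChart X) (hχθ : Disjoint (range χ.ψ) (range D.θ))
    (hχh : ∀ x ∈ range χ.ψ, D.h x ∉ range χ.ψ) (hχc : CocycleOn c (range χ.ψ)) :
    LiftsNear D σ p c (L ∪ χ.ψ '' closedBall 0 1) := by
  classical
  obtain ⟨f, P, U, hP, hPh, hPθ, hf, hU, hLU, hUf⟩ := H
  obtain ⟨O, hO, hLO, hOU⟩ := normal_exists_closure_subset hL hU hLU
  set U2 : Set X := U ∪ D.h ⁻¹' U with hU2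
  have hU2o : IsOpen U2 := hU.union (hU.preimage D.cont)
  have hPh' : ∀ x, D.h x ∈ P ↔ x ∈ P := fun x =>
    ⟨fun h => by simpa [D.invol x] using hPh _ h, hPh x⟩
  have hU2f : ∀ x ∈ U2, x ∉ P → LiftsAt p c f x := by
    rintro x (hx | hx) hxP
    · exact hUf x hx hxP
    · have := (hUf _ hx (mt (hPh' x).1 hxP)).h hpσ hcτ hf
      rwa [D.invol x] at this
  set L1 : Set X := closure O ∪ D.h ⁻¹' closure O with hL1
  have hL1c : IsClosed L1 := isClosed_closure.union (isClosed_closure.preimage D.cont)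
  have hL1U : L1 ⊆ U2 := union_subset_union hOU (preimage_mono hOU)
  have hL1h : ∀ x, D.h x ∈ L1 ↔ x ∈ L1 := fun x => by
    simp only [hL1, mem_union, mem_preimage, D.invol x]
    exact or_comm
  choose l hl using hp
  set d := χ.ψ 0 with hd
  let g : X → F := fun x => l (c d x)
  have hg : ∀ x, p (g x) = c d x := fun x => hl _
  have hdR : d ∈ range χ.ψ := mem_range_self 0
  let n : ℝ × ℝ → ℝ × ℝ → p.ker := fun a b =>
    if h : (g (χ.ψ b))⁻¹ * f (χ.ψ a) (χ.ψ b) * g (χ.ψ a) ∈ p.ker then ⟨_, h⟩ else 1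
  have hn : ∀ x ∈ range χ.ψ, LiftsAt p c f x → ∃ V ∈ 𝓝 x, V ⊆ range χ.ψ ∧ CocycleOn f V ∧
      ∀ a b, χ.ψ a ∈ V → χ.ψ b ∈ V →
        (n a b : F) = (g (χ.ψ b))⁻¹ * f (χ.ψ a) (χ.ψ b) * g (χ.ψ a) := by
    rintro x hx ⟨V, hV, h1, h2⟩
    refine ⟨V ∩ range χ.ψ, inter_mem hV (χ.isOpen.mem_nhds hx), inter_subset_right,
      h1.mono inter_subset_left, fun a b ha hb => ?_⟩
    have hk : (g (χ.ψ b))⁻¹ * f (χ.ψ a) (χ.ψ b) * g (χ.ψ a) ∈ p.ker := by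
      rw [MonoidHom.mem_ker, map_mul, map_mul, map_inv, hg, hg, h2 _ ha.1 _ hb.1, mul_assoc,
        hχc _ hdR _ ha.2 _ hb.2, inv_mul_cancel]
    simp only [n, dif_pos hk]
  obtain ⟨n', Q, hQ, hn'Q, hn'n⟩ := planar_extension n (W := χ.ψ ⁻¹' U2) (C := χ.ψ ⁻¹' L1)
    (P := χ.ψ ⁻¹' P) (hU2o.preimage χ.cont) (hL1c.preimage χ.cont) (preimage_mono hL1U)
    (χ.finite_preimage hP) (by
      intro w hw hwP
      obtain ⟨V, hV, -, hVf, hVn⟩ := hn _ (mem_range_self w) (hU2f _ hw hwP)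
      refine ⟨χ.ψ ⁻¹' V, χ.cont.continuousAt hV, fun u hu v hv w hw => ?_⟩
      apply Subtype.ext
      rw [Subgroup.coe_mul, hVn _ _ hv hw, hVn _ _ hu hv, hVn _ _ hu hw,
        ← hVf _ hu _ hv _ hw]
      group) 3
  let F' : X → X → F := fun x y => g y * (n' (χ.j x) (χ.j y) : F) * (g x)⁻¹
  set B : Set X := χ.ψ '' ball 0 2 with hB
  have hBR : B ⊆ range χ.ψ := image_subset_range _ _
  have hBo : IsOpen B := χ.isOpen_image_ball 2
  have hBh : ∀ x ∈ B, D.h x ∉ B := fun x hx hx' => hχh x (hBR hx) (hBR hx')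
  let f' : X → X → F := fun x y =>
    if x ∈ B ∧ y ∈ B then F' x y else
      if D.h x ∈ B ∧ D.h y ∈ B then σ (F' (D.h x) (D.h y)) else f x y
  have hf' : ∀ x y, f' (D.h x) (D.h y) = σ (f' x y) := by
    intro x y
    simp only [f', D.invol x, D.invol y]
    by_cases h1 : x ∈ B ∧ y ∈ B
    · rw [if_neg (fun h => hBh x h1.1 h.1), if_pos h1, if_pos h1]
    · by_cases h2 : D.h x ∈ B ∧ D.h y ∈ B
      · rw [if_pos h2, if_neg h1, if_pos h2, hσ]
      · rw [if_neg h2, if_neg h1, if_neg h1, if_neg h2, hf]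
  let P' : Set X := P ∪ (χ.ψ '' Q ∪ D.h '' (χ.ψ '' Q))
  have hP'h : ∀ x ∈ P', D.h x ∈ P' := by
    rintro x (hx | hx | ⟨y, hy, rfl⟩)
    · exact Or.inl (hPh x hx)
    · exact Or.inr (Or.inr ⟨x, hx, rfl⟩)
    · rw [D.invol y]; exact Or.inr (Or.inl hy)
  -- on the modified region
  have hin : ∀ x ∈ B, x ∉ P' → LiftsAt p c f' x := by
    intro x hxB hxP
    have hxR := hBR hxB
    have hjx : χ.j x ∈ ball 0 3 := by
      rw [hB, χ.image_ball] at hxB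
      exact ball_subset_ball (by norm_num) hxB.2
    have hjQ : χ.j x ∉ Q := fun h => hxP (Or.inr (Or.inl ⟨_, h, χ.ψ_j hxR⟩))
    obtain ⟨V, hV, hVc⟩ := hn'Q _ hjx hjQ
    refine ⟨χ.j ⁻¹' V ∩ B, inter_mem (χ.continuousAt_j hxR hV) (hBo.mem_nhds hxB), ?_, ?_⟩
    · rintro u ⟨hu, huB⟩ v ⟨hv, hvB⟩ w ⟨hw, hwB⟩
      simp only [f', if_pos (And.intro hvB hwB), if_pos (And.intro huB hvB),
        if_pos (And.intro huB hwB), F']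
      rw [← hVc _ hu _ hv _ hw, Subgroup.coe_mul]
      group
    · rintro u ⟨hu, huB⟩ v ⟨hv, hvB⟩
      simp only [f', if_pos (And.intro huB hvB), F']
      rw [map_mul, map_mul, map_inv, hg, hg, MonoidHom.mem_ker.1 (n' _ _).2, mul_one,
        ← hχc _ hdR _ (hBR huB) _ (hBR hvB)]
      group
  -- near the old region
  have hR3 : ∀ x ∈ L1, x ∉ P' → x ∈ χ.ψ '' ball 0 3 → LiftsAt p c f' x := by
    intro x hxL hxP hx3
    have hxR : x ∈ range χ.ψ := image_subset_range _ _ hx3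
    have hxP0 : x ∉ P := fun h => hxP (Or.inl h)
    have hjx : χ.j x ∈ ball 0 3 := by
      rw [χ.image_ball] at hx3
      exact hx3.2
    have hfx := hU2f x (hL1U hxL) hxP0
    obtain ⟨V, hV, hVn⟩ := hn'n (χ.j x) (by simpa [χ.ψ_j hxR] using hxL) hjx
      (by simpa [χ.ψ_j hxR] using hxP0)
    obtain ⟨V', hV', hV'R, -, hV'n⟩ := hn x hxR hfx
    obtain ⟨V'', hV'', hc1, hc2⟩ := hfx
    have heq : ∀ u ∈ χ.j ⁻¹' V ∩ V', ∀ v ∈ χ.j ⁻¹' V ∩ V', f' u v = f u v := by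
      rintro u ⟨hu, hu'⟩ v ⟨hv, hv'⟩
      have h2 : ¬ (D.h u ∈ B ∧ D.h v ∈ B) := fun h => hχh u (hV'R hu') (hBR h.1)
      by_cases h1 : u ∈ B ∧ v ∈ B
      · simp only [f', if_pos h1, F']
        have eu := χ.ψ_j (hV'R hu')
        have ev := χ.ψ_j (hV'R hv')
        rw [hVn _ hu _ hv, hV'n _ _ (by rwa [eu]) (by rwa [ev]), eu, ev]
        group
      · simp only [f', if_neg h1, if_neg h2]
    refine ⟨χ.j ⁻¹' V ∩ V' ∩ V'', inter_mem (inter_mem (χ.continuousAt_j hxR hV) hV') hV'', ?_, ?_⟩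
    · intro u hu v hv w hw
      rw [heq _ hu.1 _ hv.1, heq _ hu.1 _ hw.1, heq _ hv.1 _ hw.1, hc1 _ hu.2 _ hv.2 _ hw.2]
    · intro u hu v hv
      rw [heq _ hu.1 _ hv.1, hc2 _ hu.2 _ hv.2]
  have hold : ∀ x ∈ L1, x ∉ P' → LiftsAt p c f' x := by
    intro x hxL hxP
    by_cases h3 : x ∈ χ.ψ '' ball 0 3
    · exact hR3 x hxL hxP h3
    by_cases h3' : D.h x ∈ χ.ψ '' ball 0 3
    · have := (hR3 _ ((hL1h x).2 hxL) (fun h => hxP (by simpa [D.invol x] using hP'h _ h)) h3').h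
        hpσ hcτ hf'
      rwa [D.invol x] at this
    obtain ⟨V, hV, hc1, hc2⟩ := hU2f x (hL1U hxL) (fun h => hxP (Or.inl h))
    set Z : Set X := χ.ψ '' closedBall 0 2 with hZ
    have hZc : IsClosed Z := ((isCompact_closedBall 0 2).image χ.cont).isClosed
    have hBZ : B ⊆ Z := image_mono ball_subset_closedBall
    have hZ3 : Z ⊆ χ.ψ '' ball 0 3 := image_mono (closedBall_subset_ball (by norm_num))
    have hN : Zᶜ ∩ D.h ⁻¹' Zᶜ ∈ 𝓝 x :=
      (hZc.isOpen_compl.inter (hZc.isOpen_compl.preimage D.cont)).mem_nhds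
        ⟨fun h => h3 (hZ3 h), fun h => h3' (hZ3 h)⟩
    have heq : ∀ u ∈ Zᶜ ∩ D.h ⁻¹' Zᶜ, ∀ v, f' u v = f u v := by
      intro u hu v
      have h1 : ¬ (u ∈ B ∧ v ∈ B) := fun h => hu.1 (hBZ h.1)
      have h2 : ¬ (D.h u ∈ B ∧ D.h v ∈ B) := fun h => hu.2 (hBZ h.1)
      simp only [f', if_neg h1, if_neg h2]
    refine ⟨_, inter_mem hN hV, ?_, ?_⟩
    · intro u hu v hv w hw
      rw [heq _ hu.1, heq _ hu.1, heq _ hv.1, hc1 _ hu.2 _ hv.2 _ hw.2]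
    · intro u hu v hv
      rw [heq _ hu.1, hc2 _ hu.2 _ hv.2]
  refine ⟨f', P', O ∪ B, hP.union ((hQ.image _).union ((hQ.image _).image _)), hP'h, ?_, hf',
    hO.union hBo, union_subset_union hLO (image_mono (closedBall_subset_ball (by norm_num))), ?_⟩
  · rw [disjoint_union_left, disjoint_union_left]
    have h1 : Disjoint (χ.ψ '' Q) (range D.θ) := hχθ.mono_left (image_subset_range _ _)
    refine ⟨hPθ, h1, ?_⟩
    rw [Set.disjoint_left] at h1 ⊢
    rintro _ ⟨y, hy, rfl⟩ h2
    exact h1 hy (D.h_mem.1 h2)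
  · rintro x (hx | hx) hxP
    · exact hold x (Or.inl (subset_closure hx)) hxP
    · exact hin x hx hxP

/-- An equivariant cocycle, trivial along the arc, lifts equivariantly off a finite set. -/
theorem exists_equivariant_lift_off_finite [CompactSpace X] (hX : HasCharts X)
    (hσ : ∀ w, σ (σ w) = w)
    (hp : Surjective p) (hpσ : ∀ w, p (σ w) = τ (p w)) (hc : ∀ x, LocCocycleAt c x)
    (hcτ : ∀ x y, c (D.h x) (D.h y) = τ (c x y))
    (hcθ : ∀ s, ∃ V ∈ 𝓝 (D.θ s), ∀ u ∈ V, ∀ v ∈ V, u ∈ range D.θ → v ∈ range D.θ → c u v = 1) :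
    ∃ (f : X → X → F) (P : Set X), P.Finite ∧ (∀ x ∈ P, D.h x ∈ P) ∧ Disjoint P (range D.θ) ∧
      (∀ x y, f (D.h x) (D.h y) = σ (f x y)) ∧ ∀ x, x ∉ P → LiftsAt p c f x := by
  classical
  have hθc : IsClosed (range D.θ) := (isCompact_range D.contθ).isClosed
  obtain ⟨f, P, U, hP, hPh, hPθ, hf, hU, hLU, hUf⟩ := liftsNear_arc hσ hp hpσ hc hcτ hcθ
  obtain ⟨O, hO, hθO, hOU⟩ := normal_exists_closure_subset hθc hU hLU
  have hchart : ∀ x : X, ∃ χ : SurfChart X, x ∉ range D.θ → χ.ψ 0 = x ∧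
      Disjoint (range χ.ψ) (range D.θ) ∧ (∀ x ∈ range χ.ψ, D.h x ∉ range χ.ψ) ∧
      CocycleOn c (range χ.ψ) := by
    intro x
    by_cases hx : x ∈ range D.θ
    · exact ⟨(hX x).choose, fun h => absurd hx h⟩
    have hne : x ≠ D.h x := fun h => hx ((D.fix x).1 h.symm)
    obtain ⟨A, A', hA, hA', hxA, hxA', hAA⟩ := t2_separation hne
    obtain ⟨V, hV, hVc⟩ := hc x
    obtain ⟨χ, h0, hχ⟩ := hX.exists_chart (x := x) (O := ((range D.θ)ᶜ ∩ V) ∩ (A ∩ D.h ⁻¹' A'))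
      (inter_mem (inter_mem (hθc.isOpen_compl.mem_nhds hx) hV)
        ((hA.inter (hA'.preimage D.cont)).mem_nhds ⟨hxA, hxA'⟩))
    refine ⟨χ, fun _ => ⟨h0, ?_, ?_, hVc.mono fun y hy => (hχ hy).1.2⟩⟩
    · exact Set.disjoint_left.2 fun y hy => (hχ hy).1.1
    · intro y hy hy'
      exact Set.disjoint_left.1 hAA (hχ hy').2.1 (hχ hy).2.2
  choose χ hχ using hchart
  obtain ⟨s, hs⟩ := (hO.isClosed_compl.isCompact).elim_nhds_subcover (fun x => (χ x).ψ '' ball 0 1)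
    (fun x hx => by
      have h0 := (hχ x fun h => hx (hθO h)).1
      refine ((χ x).isOpen_image_ball 1).mem_nhds ⟨0, mem_ball_self one_pos, h0⟩)
  have key : ∀ t : Finset X, (∀ x ∈ t, x ∈ Oᶜ) →
      LiftsNear D σ p c (closure O ∪ ⋃ x ∈ t, (χ x).ψ '' closedBall 0 1) := by
    intro t
    induction t using Finset.induction_on with
    | empty =>
      intro _
      refine ⟨f, P, U, hP, hPh, hPθ, hf, hU, by simpa using hOU, hUf⟩
    | insert a t _ ih =>
      intro ht
      have h1 := ih fun x hx => ht x (Finset.mem_insert_of_mem hx)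
      obtain ⟨-, h2, h3, h4⟩ := hχ a fun h => ht a (Finset.mem_insert_self a t) (hθO h)
      have hcl : IsClosed (closure O ∪ ⋃ x ∈ t, (χ x).ψ '' closedBall 0 1) :=
        isClosed_closure.union (t.finite_toSet.isClosed_biUnion fun x _ =>
          ((isCompact_closedBall 0 1).image (χ x).cont).isClosed)
      have := LiftsNear.union_chart hcl h1 hσ hp hpσ hcτ (χ a) h2 h3 h4
      rw [Finset.set_biUnion_insert]
      rwa [union_assoc, union_comm (⋃ x ∈ t, _)] at this
  obtain ⟨f, P, U, hP, hPh, hPθ, hf, hU, hLU, hUf⟩ := key s hs.1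
  refine ⟨f, P, hP, hPh, hPθ, hf, fun x => hUf x (hLU ?_)⟩
  by_cases hx : x ∈ O
  · exact Or.inl (subset_closure hx)
  · right
    have := hs.2 hx
    simp only [mem_iUnion] at this ⊢
    obtain ⟨y, hy, hxy⟩ := this
    exact ⟨y, hy, image_mono ball_subset_closedBall hxy⟩

end Lifting

/-! ### An arc does not separate the plane -/

section PlaneArc

open Filter

/-- The logarithmic increments. -/
def logCocycle (u v : ℂ) : Multiplicative ℂ := Multiplicative.ofAdd (Complex.log (v / u))

lemma eventually_logCocycle {T : Type*} [TopologicalSpace T] {g b : T → ℂ} (hb : Continuous b)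
    (hg : ∀ t, Complex.exp (b t) = g t) :
    IsPrim (fun s t => logCocycle (g s) (g t)) (fun t => Multiplicative.ofAdd (b t)) := by
  intro t
  have h1 : ∀ᶠ s in 𝓝 t, |(b s - b t).im| < Real.pi := by
    have : ContinuousAt (fun s => |(b s - b t).im|) t := by fun_prop
    refine this.eventually (gt_mem_nhds ?_)
    simpa using Real.pi_pos
  filter_upwards [h1] with s hs
  rw [abs_lt] at hs
  apply Multiplicative.toAdd.injective
  rw [toAdd_mul]
  simp only [logCocycle, toAdd_ofAdd]
  rw [← hg, ← hg, ← Complex.exp_sub, Complex.log_exp hs.1 hs.2.le]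
  ring

lemma locCocycleAt_logCocycle {z : ℂ} (hz : z ≠ 0) : LocCocycleAt logCocycle z := by
  have hc : ContinuousAt (fun w : ℂ => w / z) z := by fun_prop
  have h1 : ∀ᶠ w in 𝓝 z, 0 < (w / z).re ∧ w ≠ 0 := by
    refine ((Complex.continuous_re.continuousAt.comp hc).eventually (lt_mem_nhds ?_)).and
      (isOpen_ne.mem_nhds hz)
    simp [hz]
  have harg : ∀ w : ℂ, 0 < (w / z).re → |(Complex.log (w / z)).im| < Real.pi / 2 := fun w hw => by
    rw [Complex.log_im]
    exact Complex.abs_arg_lt_pi_div_two_iff.2 (Or.inl hw)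
  have key : ∀ u v : ℂ, u ≠ 0 → v ≠ 0 → 0 < (u / z).re → 0 < (v / z).re →
      Complex.log (v / u) = Complex.log (v / z) - Complex.log (u / z) := by
    intro u v hu hv h1 h2
    have e : v / u = Complex.exp (Complex.log (v / z) - Complex.log (u / z)) := by
      rw [Complex.exp_sub, Complex.exp_log (div_ne_zero hv hz), Complex.exp_log (div_ne_zero hu hz)]
      field_simp
    have a1 := abs_lt.1 (harg u h1)
    have a2 := abs_lt.1 (harg v h2)
    rw [e, Complex.log_exp]
    · rw [Complex.sub_im]; linarith
    · rw [Complex.sub_im]; linarith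
  refine ⟨_, h1, fun u hu v hv w hw => ?_⟩
  apply Multiplicative.toAdd.injective
  rw [toAdd_mul]
  simp only [logCocycle, toAdd_ofAdd]
  rw [key _ _ hv.2 hw.2 hv.1 hw.1, key _ _ hu.2 hv.2 hu.1 hv.1, key _ _ hu.2 hw.2 hu.1 hw.1]
  ring

/-- A nonvanishing function along an interval has a continuous logarithm. -/
lemma exists_log_unitInterval {g : unitInterval → ℂ} (hg : Continuous g) (h0 : ∀ t, g t ≠ 0) :
    ∃ b : unitInterval → ℂ, Continuous b ∧ (∀ t, Complex.exp (b t) = g t) ∧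
      b 1 = Complex.log (g 1) := by
  obtain ⟨b, hb⟩ := exists_prim (f := logCocycle) hg fun t => locCocycleAt_logCocycle (h0 t)
  let β : unitInterval → ℂ := fun t => (b t).toAdd
  have hβ : ∀ t, ∀ᶠ s in 𝓝 t, β s = Complex.log (g s / g t) + β t := fun t => by
    filter_upwards [hb t] with s hs
    simp only [β, hs, toAdd_mul]
    rfl
  have hβc : Continuous β := by
    rw [continuous_iff_continuousAt]
    intro t
    have : ContinuousAt (fun s => Complex.log (g s / g t) + β t) t := by
      refine ContinuousAt.add (ContinuousAt.clog (by fun_prop) ?_) continuousAt_const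
      rw [div_self (h0 t)]
      exact Complex.one_mem_slitPlane
    exact this.congr ((hβ t).mono fun s hs => hs.symm)
  have hlc : IsLocallyConstant fun t => Complex.exp (β t) / g t := by
    rw [IsLocallyConstant.iff_eventually_eq]
    intro t
    filter_upwards [hβ t] with s hs
    have h1 := h0 t
    have h2 := h0 s
    rw [hs, Complex.exp_add, Complex.exp_log (div_ne_zero (h0 s) (h0 t))]
    field_simp
  refine ⟨fun t => β t - β 1 + Complex.log (g 1), by fun_prop, fun t => ?_, by simp⟩
  have h := hlc.apply_eq_of_isPreconnected isPreconnected_univ (mem_univ t) (mem_univ 1)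
  have h1 := h0 1
  have h2 := h0 t
  have h3 := Complex.exp_ne_zero (β 1)
  rw [Complex.exp_add, Complex.exp_sub, Complex.exp_log (h0 1)]
  field_simp at h ⊢
  linear_combination h

/-- A nowhere vanishing function on the plane cannot agree with `w - p` near infinity. -/
lemma not_nonvanishing {Φ : ℂ → ℂ} (hΦ : Continuous Φ) (h0 : ∀ w, Φ w ≠ 0) {p : ℂ} {R : ℝ}
    (hp : ‖p‖ < R) (hR : ∀ w : ℂ, ‖w‖ = R → Φ w = w - p) : False := by
  have hR0 : 0 < R := (norm_nonneg p).trans_lt hp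
  have hloc : ∀ w, LocCocycleAt (fun u v => logCocycle (Φ u) (Φ v)) w := fun w =>
    (locCocycleAt_logCocycle (h0 w)).comap hΦ.continuousAt
  let e : unitInterval → ℂ := fun t => R * Complex.exp (2 * Real.pi * (t : ℝ) * Complex.I)
  have he : Continuous e := by fun_prop
  have hne : ∀ t, ‖e t‖ = R := fun t => by
    have : (2 * Real.pi * (t : ℝ) * Complex.I : ℂ) = ((2 * Real.pi * (t : ℝ) : ℝ) : ℂ) * Complex.I := by
      push_cast; ring
    simp only [e]
    rw [norm_mul, this, Complex.norm_exp_ofReal_mul_I]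
    simp [abs_of_pos hR0]
  have he0 : ∀ t, e t ≠ 0 := fun t h => by
    have := hne t
    rw [h, norm_zero] at this
    exact hR0.ne this
  let γ : Path (R : ℂ) R := ⟨⟨e, he⟩, by simp [e], by simp [e]⟩
  have hγ : γ.Homotopic (Path.refl _) := by
    refine ⟨⟨⟨⟨fun z => (1 - ((z.1 : ℝ) : ℂ)) * e z.2 + ((z.1 : ℝ) : ℂ) * R, by fun_prop⟩, ?_, ?_⟩, ?_⟩⟩
    · intro t; simp [γ]
    · intro t; simp
    · rintro s t (rfl | rfl)
      · simp [e, γ]; ring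
      · simp [e, γ]; ring
  have h1 := hol_homotopic hloc hγ
  have hrefl : hol (fun u v => logCocycle (Φ u) (Φ v)) (Path.refl (R : ℂ)) = 1 := by
    rw [hol_eq (b := fun _ => 1)]
    · simp
    · intro t
      refine Eventually.of_forall fun s => ?_
      simp [logCocycle, h0 R]
  rw [hrefl] at h1
  let b : unitInterval → ℂ := fun t =>
    Complex.log R + 2 * Real.pi * (t : ℝ) * Complex.I + Complex.log (1 - p / e t)
  have hlt : ∀ t, ‖p / e t‖ < 1 := fun t => by
    rw [norm_div, hne, div_lt_one hR0]; exact hp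
  have hsl : ∀ t, 1 - p / e t ∈ Complex.slitPlane := fun t => by
    left
    have := (Complex.abs_re_le_norm (p / e t)).trans_lt (hlt t)
    rw [Complex.sub_re, Complex.one_re]
    linarith [(abs_lt.1 this).2]
  have hb : Continuous b := by
    refine Continuous.add (by fun_prop) (Continuous.clog ?_ hsl)
    exact continuous_const.sub (continuous_const.div he he0)
  have hexp : ∀ t, Complex.exp (b t) = Φ (e t) := fun t => by
    rw [hR _ (hne t)]
    simp only [b]
    rw [Complex.exp_add, Complex.exp_add, Complex.exp_log (by exact_mod_cast hR0.ne'),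
      Complex.exp_log (Complex.slitPlane_ne_zero (hsl t))]
    change e t * (1 - p / e t) = _
    have := he0 t
    field_simp
  have h2 : hol (fun u v => logCocycle (Φ u) (Φ v)) γ =
      Multiplicative.ofAdd (b 1) * (Multiplicative.ofAdd (b 0))⁻¹ :=
    hol_eq (eventually_logCocycle hb hexp)
  rw [h2] at h1
  have h3 := congrArg Multiplicative.toAdd h1
  rw [toAdd_mul, toAdd_inv, toAdd_ofAdd, toAdd_ofAdd, toAdd_one] at h3
  simp [b, e] at h3

/-- An arc does not separate the plane locally: if the frontier of an open set off an arc is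
contained in the union of the arc and a closed set that meets the arc at most at one end, then away
from the closed set no point is in the closure both of the open set and of the remainder of the
complement of the arc. -/
lemma plane_arc_nonseparating {α : unitInterval → ℂ} (hα : Continuous α) (hinj : Injective α)
    {F V : Set ℂ} (hF : IsClosed F) (hF0 : 0 ∉ F) (hαF : ∀ t, α t ∈ F → t = 1)
    (hV : IsOpen V) (hVα : ∀ t, α t ∉ V) (hfr : frontier V ⊆ range α ∪ F) (hcl : 0 ∈ closure V)
    (hz : 0 ∈ closure {z | z ∉ V ∧ z ∉ range α}) : False := by
  obtain ⟨ε, hε, hεF⟩ := Metric.isOpen_iff.1 hF.isOpen_compl 0 hF0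
  obtain ⟨R0, hR0⟩ := (isCompact_range hα).isBounded.exists_norm_le
  obtain ⟨R, hR1, hR2⟩ : ∃ R, R0 < R ∧ ε < R :=
    ⟨max R0 ε + 1, by linarith [le_max_left R0 ε], by linarith [le_max_right R0 ε]⟩
  set F' : Set ℂ := F ∪ {w | R ≤ ‖w‖} with hF'
  have hF'c : IsClosed F' := hF.union (isClosed_le continuous_const continuous_norm)
  have hF'ε : ∀ w ∈ F', ε ≤ ‖w‖ := by
    rintro w (hw | hw)
    · by_contra h
      exact hεF (by simpa using h) hw
    · exact hR2.le.trans hw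
  have hαF' : ∀ t, α t ∈ F' → t = 1 := by
    rintro t (h | h)
    · exact hαF t h
    · exact absurd (hR0 _ (mem_range_self t)) (not_le.2 (hR1.trans_le h))
  obtain ⟨p, hpV, hp⟩ := Metric.mem_closure_iff.1 hcl (ε / 4) (by positivity)
  obtain ⟨z, ⟨hzV, hzα⟩, hzε⟩ := Metric.mem_closure_iff.1 hz (ε / 4) (by positivity)
  rw [dist_zero_left] at hp hzε
  have hpα : ∀ t, α t ≠ p := fun t h => hVα t (h ▸ hpV)
  have hzα' : ∀ t, α t ≠ z := fun t h => hzα ⟨t, h⟩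
  have hne : ∀ w ∈ F', w - z ≠ 0 := fun w hw h => by
    have := hF'ε w hw
    rw [sub_eq_zero.1 h] at this
    linarith
  have hsl : ∀ w ∈ F', (w - p) / (w - z) ∈ Complex.slitPlane := fun w hw => by
    have h1 := hne w hw
    have h2 := hF'ε w hw
    have h3 : (w - p) / (w - z) = 1 - (p - z) / (w - z) := by field_simp; ring
    have h4 : ‖(p - z) / (w - z)‖ < 1 := by
      rw [norm_div, div_lt_one (norm_pos_iff.2 h1)]
      have := norm_sub_le p z
      have := norm_sub_norm_le w z
      linarith
    left
    have := (Complex.abs_re_le_norm ((p - z) / (w - z))).trans_lt h4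
    rw [h3, Complex.sub_re, Complex.one_re]
    linarith [(abs_lt.1 this).2]
  have hg0 : ∀ t, (α t - p) / (α t - z) ≠ 0 := fun t =>
    div_ne_zero (sub_ne_zero.2 (hpα t)) (sub_ne_zero.2 (hzα' t))
  obtain ⟨b, hb, hbe, hb1⟩ := exists_log_unitInterval (g := fun t => (α t - p) / (α t - z))
    ((hα.sub continuous_const).div (hα.sub continuous_const) fun t => sub_ne_zero.2 (hzα' t)) hg0
  classical
  let L : ℂ → ℂ := fun w => if w ∈ F' then Complex.log ((w - p) / (w - z)) else b (invFun α w)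
  have hLα : ∀ t, L (α t) = b t := fun t => by
    simp only [L]
    split_ifs with h
    · rw [hαF' t h, hb1]
    · rw [leftInverse_invFun hinj]
  have hLF : ∀ w ∈ F', L w = Complex.log ((w - p) / (w - z)) := fun w hw => if_pos hw
  have hLc : ContinuousOn L (range α ∪ F') := by
    refine ContinuousOn.union_of_isClosed ?_ ?_ (isCompact_range hα).isClosed hF'c
    · have hemb := (hα.isClosedEmbedding hinj).isEmbedding
      rw [continuousOn_iff_continuous_domRestrict]
      have : (range α).domRestrict L = b ∘ hemb.toHomeomorph.symm := by
        funext x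
        obtain ⟨t, rfl⟩ := hemb.toHomeomorph.surjective x
        simp only [comp_apply, Homeomorph.symm_apply_apply]
        exact hLα t
      rw [this]
      exact hb.comp (Homeomorph.continuous _)
    · refine ContinuousOn.congr (f := fun w => Complex.log ((w - p) / (w - z))) ?_ hLF
      exact ContinuousOn.clog ((continuousOn_id.sub continuousOn_const).div
        (continuousOn_id.sub continuousOn_const) hne) hsl
  have hLe : ∀ w ∈ range α ∪ F', Complex.exp (L w) = (w - p) / (w - z) := by
    rintro w (⟨t, rfl⟩ | hw)
    · rw [hLα, hbe]
    · rw [hLF w hw, Complex.exp_log (Complex.slitPlane_ne_zero (hsl w hw))]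
  obtain ⟨g, hg⟩ := ContinuousMap.exists_restrict_eq
    ((isCompact_range hα).isClosed.union hF'c) ⟨_, continuousOn_iff_continuous_domRestrict.1 hLc⟩
  have hgL : ∀ w ∈ range α ∪ F', g w = L w := fun w hw => congrArg (fun k => k ⟨w, hw⟩) hg
  have hfr' : frontier V ⊆ range α ∪ F' :=
    hfr.trans (union_subset_union_right _ subset_union_left)
  have hzcl : z ∉ closure V := by
    intro h
    have : z ∈ frontier V := by rw [hV.frontier_eq]; exact ⟨h, hzV⟩
    rcases hfr' this with h1 | h1
    · exact hzα h1
    · linarith [hF'ε z h1]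
  have hmul : ∀ w ∈ range α ∪ F', w ≠ z → Complex.exp (g w) * (w - z) = w - p := fun w hw h => by
    rw [hgL w hw, hLe w hw, div_mul_cancel₀ _ (sub_ne_zero.2 h)]
  have hgc := g.continuous
  refine not_nonvanishing (Φ := (closure V).piecewise (fun w => Complex.exp (g w) * (w - z))
    fun w => w - p) ?_ (fun w => ?_) (p := p) (R := R) (by linarith) fun w hw => ?_
  · refine Continuous.piecewise (fun w hw => ?_) (by fun_prop) (by fun_prop)
    have hw1 : w ∈ frontier V := frontier_closure_subset hw
    exact hmul w (hfr' hw1) fun h => hzcl (h ▸ frontier_subset_closure hw1)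
  · by_cases hw : w ∈ closure V
    · rw [piecewise_eq_of_mem _ _ _ hw]
      exact mul_ne_zero (Complex.exp_ne_zero _) (sub_ne_zero.2 fun h => hzcl (h ▸ hw))
    · rw [piecewise_eq_of_notMem _ _ _ hw]
      exact sub_ne_zero.2 fun h => hw (h ▸ subset_closure hpV)
  · by_cases hw1 : w ∈ closure V
    · rw [piecewise_eq_of_mem _ _ _ hw1]
      exact hmul w (Or.inr (Or.inr hw.ge)) fun h => hzcl (h ▸ hw1)
    · rw [piecewise_eq_of_notMem _ _ _ hw1]

/-- The same statement in real coordinates. -/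
lemma plane_arc_nonseparating_prod {α : unitInterval → ℝ × ℝ} (hα : Continuous α)
    (hinj : Injective α) {F V : Set (ℝ × ℝ)} (hF : IsClosed F) (hF0 : 0 ∉ F)
    (hαF : ∀ t, α t ∈ F → t = 1) (hV : IsOpen V) (hVα : ∀ t, α t ∉ V)
    (hfr : frontier V ⊆ range α ∪ F) (hcl : 0 ∈ closure V)
    (hz : 0 ∈ closure {z | z ∉ V ∧ z ∉ range α}) : False := by
  let e : ℂ ≃ₜ ℝ × ℝ := Complex.equivRealProdCLM.toHomeomorph
  have he0 : e 0 = 0 := Complex.equivRealProdCLM.map_zero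
  have hr : range (e.symm ∘ α) = e ⁻¹' range α := by
    rw [range_comp, ← e.image_symm]
  refine plane_arc_nonseparating (α := e.symm ∘ α) (F := e ⁻¹' F) (V := e ⁻¹' V)
    (e.symm.continuous.comp hα) (e.symm.injective.comp hinj) (hF.preimage e.continuous)
    (by rwa [mem_preimage, he0]) (fun t ht => hαF t ?_) (hV.preimage e.continuous)
    (fun t ht => hVα t ?_) ?_ ?_ ?_
  · simpa using ht
  · simpa using ht
  · rw [hr, ← e.preimage_frontier, ← preimage_union]
    exact preimage_mono hfr
  · rw [← e.preimage_closure, mem_preimage, he0]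
    exact hcl
  · have : {z | z ∉ e ⁻¹' V ∧ z ∉ range (e.symm ∘ α)} = e ⁻¹' {z | z ∉ V ∧ z ∉ range α} := by
      rw [hr]; rfl
    rw [this, ← e.preimage_closure, mem_preimage, he0]
    exact hz

end PlaneArc

/-! ### The complement of an arc with end points on the boundary -/

section ArcComplement

open unitInterval Filter

variable {X : Type*} [TopologicalSpace X]

/-- A chart may be translated along its folding line. -/
lemma SurfChart.exists_translate (χ : SurfChart X) {w : ℝ × ℝ}
    (hw : ∀ u, χ.ρ (u + w) = χ.ρ u + w) :
    ∃ χ' : SurfChart X, χ'.ρ = χ.ρ ∧ (∀ u, χ'.ψ u = χ.ψ (u + w)) ∧ range χ'.ψ = range χ.ψ := by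
  have hr : range (fun u => χ.ψ (u + w)) = range χ.ψ :=
    (Equiv.addRight w).surjective.range_comp χ.ψ
  have hc := χ.cont
  refine ⟨⟨χ.ρ, fun u => χ.ψ (u + w), fun x => χ.j x - w, χ.ρ_eq, by fun_prop, ?_, ?_, ?_, ?_⟩,
    rfl, fun _ => rfl, hr⟩
  · rw [hr]; exact χ.isOpen
  · rw [hr]; exact χ.contj.sub continuousOn_const
  · intro u
    rw [χ.j_ψ, hw, add_sub_cancel_right]
  · intro u
    rw [← hw, χ.ψ_ρ]

lemma SurfChart.exists_translate_fold (χ : SurfChart X) (hχ : χ.ρ = foldMap) {w : ℝ × ℝ}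
    (hw : w.1 = 0) : ∃ χ' : SurfChart X, χ'.ρ = foldMap ∧ χ'.ψ 0 = χ.ψ w := by
  obtain ⟨χ', h1, h2, -⟩ := χ.exists_translate (w := w) fun u => by
    rw [hχ]; ext <;> simp [foldMap, hw]
  exact ⟨χ', h1.trans hχ, by simp [h2]⟩

lemma SurfChart.arc_local [T2Space X] (χ : SurfChart X) {θ : I → X} (hθ : Continuous θ)
    (hinj : Injective θ) {t₀ : I} (h₀ : χ.ψ 0 = θ t₀) (ht₀ : t₀ < 1) {V : Set (ℝ × ℝ)}
    (hV : IsOpen V) (hVθ : ∀ w ∈ V, χ.ψ w ∉ range θ) (hcl : 0 ∈ closure V)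
    (hfr : ∀ w ∈ closure V, w ∉ V → χ.ρ w = w ∧ χ.ψ w ∈ θ '' Ici t₀)
    (hz : 0 ∈ closure {z | z ∉ V ∧ (χ.ψ z ∉ θ '' Ici t₀ ∨ χ.ρ z ≠ z)}) : False := by
  obtain ⟨s₁, hs₁, hsub⟩ : ∃ s₁ > t₀, ∀ t ∈ Icc t₀ s₁, θ t ∈ range χ.ψ := by
    have h1 : θ ⁻¹' range χ.ψ ∈ 𝓝 t₀ := (χ.isOpen.preimage hθ).mem_nhds ⟨0, h₀⟩
    obtain ⟨u, hu, hu'⟩ := exists_Ico_subset_of_mem_nhds h1 ⟨1, ht₀⟩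
    obtain ⟨s, hs1, hs2⟩ := exists_between hu
    exact ⟨s, hs1, fun t ht => hu' ⟨ht.1, ht.2.trans_lt hs2⟩⟩
  have hlt : (t₀ : ℝ) < s₁ := hs₁
  have hmem : ∀ u : I, (t₀ : ℝ) + u * (s₁ - t₀) ∈ I := fun u =>
    ⟨by have := u.2.1; have := t₀.2.1; nlinarith, by have := u.2.2; have := s₁.2.2; nlinarith⟩
  let κ : I → I := fun u => ⟨(t₀ : ℝ) + u * (s₁ - t₀), hmem u⟩
  have hκc : Continuous κ := by fun_prop
  have hκi : Injective κ := fun u v h => by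
    have h1 : (t₀ : ℝ) + u * (s₁ - t₀) = t₀ + v * (s₁ - t₀) := congrArg Subtype.val h
    have h2 : (u : ℝ) = v := by
      have : (s₁ - t₀ : ℝ) ≠ 0 := by linarith
      exact mul_right_cancel₀ this (by linarith)
    exact Subtype.ext h2
  have hκm : ∀ u, κ u ∈ Icc t₀ s₁ := fun u => by
    have := u.2.1
    have := u.2.2
    exact ⟨Subtype.coe_le_coe.1 (by simp only [κ]; nlinarith),
      Subtype.coe_le_coe.1 (by simp only [κ]; nlinarith)⟩
  have hκs : ∀ t ∈ Icc t₀ s₁, ∃ u, κ u = t := fun t ht => by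
    have h1 : (t₀ : ℝ) ≤ t := ht.1
    have h2 : (t : ℝ) ≤ s₁ := ht.2
    refine ⟨⟨(t - t₀) / (s₁ - t₀), div_nonneg (by linarith) (by linarith),
      (div_le_one (by linarith)).2 (by linarith)⟩, Subtype.ext ?_⟩
    have : (s₁ - t₀ : ℝ) ≠ 0 := by linarith
    simp only [κ]
    field_simp
    ring
  have hα : Continuous fun u => χ.j (θ (κ u)) :=
    χ.contj.comp_continuous (hθ.comp hκc) fun u => hsub _ (hκm u)
  have hψα : ∀ u, χ.ψ (χ.j (θ (κ u))) = θ (κ u) := fun u => χ.ψ_j (hsub _ (hκm u))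
  refine plane_arc_nonseparating_prod (α := fun u => χ.j (θ (κ u)))
    (F := {w | χ.ρ w = w ∧ χ.ψ w ∈ θ '' Ici s₁}) hα (fun u v h => ?_) ?_ ?_ (fun u hu => ?_) hV
    (fun u hu => ?_) (fun w hw => ?_) hcl ?_
  · apply hκi
    apply hinj
    rw [← hψα u, ← hψα v]
    exact congrArg χ.ψ h
  · exact (isClosed_eq χ.continuous_ρ continuous_id).inter
      ((isClosed_Ici.isCompact.image hθ).isClosed.preimage χ.cont)
  · rintro ⟨-, t, ht, h⟩
    rw [h₀] at h
    exact (hs₁.trans_le ht).ne' (hinj h)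
  · obtain ⟨-, t, ht, h⟩ := hu
    rw [hψα] at h
    have h1 : κ u = s₁ := le_antisymm (hκm u).2 ((hinj h).symm ▸ ht)
    apply hκi
    rw [h1]
    apply Subtype.ext
    simp [κ]
  · exact hVθ _ hu ⟨_, (hψα u).symm⟩
  · rw [hV.frontier_eq] at hw
    obtain ⟨hρ, t, ht, h⟩ := hfr w hw.1 hw.2
    rcases le_total t s₁ with hts | hts
    · obtain ⟨u, rfl⟩ := hκs t ⟨ht, hts⟩
      refine Or.inl ⟨u, ?_⟩
      beta_reduce
      rw [h, χ.j_ψ, hρ]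
    · exact Or.inr ⟨hρ, t, hts, h⟩
  · refine closure_mono ?_ hz
    rintro z ⟨h1, h2⟩
    refine ⟨h1, ?_⟩
    rintro ⟨u, rfl⟩
    rcases h2 with h2 | h2
    · exact h2 ⟨_, (hκm u).1, (hψα u).symm⟩
    · exact h2 (χ.ρ_j (hsub _ (hκm u)))

lemma SurfChart.zero_mem_closure (χ : SurfChart X) {C : Set X} (h : χ.ψ 0 ∈ closure C) :
    (0 : ℝ × ℝ) ∈ closure (χ.j '' (C ∩ range χ.ψ)) := by
  have h1 : χ.ψ 0 ∈ closure (C ∩ range χ.ψ) := by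
    rw [mem_closure_iff_nhds] at h ⊢
    intro t ht
    obtain ⟨y, hy, hy'⟩ := h _ (inter_mem ht (χ.isOpen.mem_nhds (mem_range_self 0)))
    exact ⟨y, hy.1, hy', hy.2⟩
  rw [← χ.j_centre]
  exact mem_closure_image (χ.continuousAt_j (mem_range_self 0)) h1

/-- The end point of an arc on the boundary. -/
lemma arc_end_notMem_closure [T2Space X] {θ : I → X} (hθ : Continuous θ) (hinj : Injective θ)
    {χ : SurfChart X} (hχ : χ.ρ = foldMap) (h₀ : χ.ψ 0 = θ 0) {C : Set X} (hC : IsOpen C)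
    (hCθ : ∀ t, θ t ∉ C) (hcl : closure C ⊆ C ∪ range θ)
    (hb : ∀ χ : SurfChart X, χ.ρ = foldMap → χ.ψ 0 ∉ C) : θ 0 ∉ closure C := by
  intro h0
  have hb' : ∀ w : ℝ × ℝ, w.1 = 0 → χ.ψ w ∉ C := fun w hw => by
    obtain ⟨χ', h1, h2⟩ := χ.exists_translate_fold hχ hw
    rw [← h2]
    exact hb χ' h1
  refine χ.arc_local hθ hinj (t₀ := 0) h₀ zero_lt_one (V := {w | 0 < w.1 ∧ χ.ψ w ∈ C})
    ((isOpen_lt continuous_const continuous_fst).inter (hC.preimage χ.cont)) ?_ ?_ ?_ ?_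
  · rintro w hw ⟨t, ht⟩
    exact hCθ t (ht ▸ hw.2)
  · rw [← h₀] at h0
    refine closure_mono ?_ (χ.zero_mem_closure h0)
    rintro _ ⟨_, ⟨hx, w, rfl⟩, rfl⟩
    rw [χ.j_ψ]
    refine ⟨?_, by rwa [χ.ψ_ρ]⟩
    rw [hχ]
    exact abs_pos.2 fun h => hb' w h hx
  · intro w hw hwV
    have h1 : 0 ≤ w.1 :=
      closure_minimal (t := {w : ℝ × ℝ | 0 ≤ w.1}) (fun w hw => hw.1.le)
        (isClosed_le continuous_const continuous_fst) hw
    have h2 : χ.ψ w ∈ closure C :=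
      map_mem_closure χ.cont hw fun u hu => hu.2
    refine ⟨by rw [hχ]; ext <;> simp [foldMap, h1], ?_⟩
    rcases hcl h2 with h3 | ⟨t, h3⟩
    · exfalso
      rcases h1.eq_or_lt with h4 | h4
      · exact hb' w h4.symm h3
      · exact hwV ⟨h4, h3⟩
    · exact ⟨t, t.2.1, h3⟩
  · have : Tendsto (fun n : ℕ => ((-(1 / ((n : ℝ) + 1)), 0) : ℝ × ℝ)) atTop (𝓝 (0, 0)) := by
      refine Tendsto.prodMk_nhds ?_ tendsto_const_nhds
      simpa using tendsto_one_div_add_atTop_nhds_zero_nat (𝕜 := ℝ).neg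
    refine mem_closure_of_tendsto this (Eventually.of_forall fun n =>
      ⟨fun h => ?_, Or.inr fun h => ?_⟩)
    · have h1 := h.1
      have : (0 : ℝ) < 1 / ((n : ℝ) + 1) := by positivity
      simp only at h1
      linarith
    · rw [hχ] at h
      have h1 := congrArg Prod.fst h
      have : (0 : ℝ) < 1 / ((n : ℝ) + 1) := by positivity
      simp only [foldMap] at h1
      linarith [abs_nonneg (-(1 / ((n : ℝ) + 1)))]

lemma eq_empty_of_closure_subset_arc [T2Space X] [ConnectedSpace X] {θ : I → X}
    (hθ : Continuous θ) (hinj : Injective θ)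
    (hθ0 : ∃ χ : SurfChart X, χ.ρ = foldMap ∧ χ.ψ 0 = θ 0)
    (hθ1 : ∃ χ : SurfChart X, χ.ρ = foldMap ∧ χ.ψ 0 = θ 1)
    (hθi : ∀ t, t ≠ 0 → t ≠ 1 → ∃ χ : SurfChart X, χ.ρ = id ∧ χ.ψ 0 = θ t) {C : Set X}
    (hC : IsOpen C) (hCθ : ∀ t, θ t ∉ C) (hcl : closure C ⊆ C ∪ range θ)
    (hb : ∀ χ : SurfChart X, χ.ρ = foldMap → χ.ψ 0 ∉ C) : C = ∅ := by
  have h0 : θ 0 ∉ closure C := by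
    obtain ⟨χ, h1, h2⟩ := hθ0
    exact arc_end_notMem_closure hθ hinj h1 h2 hC hCθ hcl hb
  have h1 : θ 1 ∉ closure C := by
    obtain ⟨χ, h1, h2⟩ := hθ1
    have := arc_end_notMem_closure (θ := fun t => θ (σ t)) (hθ.comp continuous_symm)
      (hinj.comp symm_bijective.injective) h1 (by simpa using h2) hC (fun t => hCθ _) ?_ hb
    · simpa using this
    · have : range (fun t => θ (σ t)) = range θ := symm_bijective.surjective.range_comp θ
      rwa [this]
  have hT : IsClosed (θ ⁻¹' closure C) := isClosed_closure.preimage hθ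
  rcases (θ ⁻¹' closure C).eq_empty_or_nonempty with he | hne
  · have hCc : IsClosed C := by
      refine isClosed_of_closure_subset fun x hx => ?_
      rcases hcl hx with h | ⟨t, rfl⟩
      · exact h
      · exact (he.subset hx).elim
    rcases isClopen_iff.1 ⟨hCc, hC⟩ with h | h
    · exact h
    · exact absurd (h ▸ mem_univ (θ 0)) (hCθ 0)
  exfalso
  obtain ⟨t₀, ht₀, hmin⟩ := hT.isCompact.exists_isLeast hne
  have ht0 : t₀ ≠ 0 := by rintro rfl; exact h0 ht₀
  have ht1 : t₀ ≠ 1 := by rintro rfl; exact h1 ht₀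
  obtain ⟨χ, hχ, hχ0⟩ := hθi t₀ ht0 ht1
  have hpos : 0 < t₀ := lt_of_le_of_ne t₀.2.1 ht0.symm
  refine χ.arc_local hθ hinj hχ0 (lt_of_le_of_ne t₀.2.2 ht1) (V := χ.ψ ⁻¹' C)
    (hC.preimage χ.cont) ?_ ?_ ?_ ?_
  · rintro w hw ⟨t, ht⟩
    exact hCθ t (ht ▸ hw)
  · have h2 : χ.ψ 0 ∈ closure C := by rw [hχ0]; exact ht₀
    refine closure_mono ?_ (χ.zero_mem_closure h2)
    rintro _ ⟨_, ⟨hx, w, rfl⟩, rfl⟩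
    rw [χ.j_ψ]
    rwa [mem_preimage, χ.ψ_ρ]
  · intro w hw hwV
    have h2 : χ.ψ w ∈ closure C := map_mem_closure χ.cont hw fun u hu => hu
    refine ⟨by rw [hχ]; rfl, ?_⟩
    rcases hcl h2 with h3 | ⟨t, h3⟩
    · exact absurd h3 hwV
    · exact ⟨t, hmin (by rw [mem_preimage, h3]; exact h2), h3⟩
  · have hmem : θ t₀ ∈ range χ.ψ := ⟨0, hχ0⟩
    have hca : ContinuousAt (fun t => χ.j (θ t)) t₀ :=
      (χ.continuousAt_j hmem).comp hθ.continuousAt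
    have hclo : t₀ ∈ closure (Iio t₀ ∩ θ ⁻¹' range χ.ψ) := by
      have h2 : t₀ ∈ closure (Iio t₀) := by
        rw [closure_Iio' (a := t₀) ⟨(0 : I), hpos⟩]; exact self_mem_Iic
      rw [mem_closure_iff_nhds] at h2 ⊢
      intro s hs
      obtain ⟨y, hy, hy'⟩ := h2 _ (inter_mem hs ((χ.isOpen.preimage hθ).mem_nhds hmem))
      exact ⟨y, hy.1, hy', hy.2⟩
    have h3 := mem_closure_image hca hclo
    rw [← hχ0, χ.j_centre] at h3
    refine closure_mono ?_ h3
    rintro _ ⟨t, ⟨ht, ht'⟩, rfl⟩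
    have h4 := χ.ψ_j ht'
    refine ⟨fun h => hCθ t (by rwa [mem_preimage, h4] at h), Or.inl ?_⟩
    rw [h4]
    rintro ⟨s, hs, h5⟩
    rw [hinj h5] at hs
    exact absurd (mem_Ici.1 hs) (not_le.2 (mem_Iio.1 ht))

end ArcComplement

/-! ### Pushing an arc-invariant surface off finitely many points -/

section Pushing

open unitInterval Filter

/-- The point of the plane `w`, moved in the direction `v`, with support in a ball. -/
def planeMove (c v : ℝ × ℝ) (R : ℝ) (z : I × (ℝ × ℝ)) : ℝ × ℝ :=
  z.2 + ((z.1 : ℝ) * max 0 (1 - ‖z.2 - c‖ / R)) • v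

lemma continuous_planeMove (c v : ℝ × ℝ) (R : ℝ) : Continuous (planeMove c v R) := by
  have h : Continuous fun z : I × (ℝ × ℝ) => (z.1 : ℝ) * max 0 (1 - ‖z.2 - c‖ / R) := by fun_prop
  exact continuous_snd.add (h.smul continuous_const)

lemma planeMove_zero (c v w : ℝ × ℝ) (R : ℝ) : planeMove c v R (0, w) = w := by
  simp [planeMove]

lemma planeMove_centre (c v : ℝ × ℝ) (R : ℝ) : planeMove c v R (1, c) = c + v := by
  simp [planeMove]

lemma planeMove_of_le {c v w : ℝ × ℝ} {R : ℝ} (hR : 0 < R) (hw : ‖c‖ + R ≤ ‖w‖) (s : I) :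
    planeMove c v R (s, w) = w := by
  have h1 : R ≤ ‖w - c‖ := by
    have := norm_sub_norm_le w c
    linarith
  have h2 : 1 - ‖w - c‖ / R ≤ 0 := by
    rw [sub_nonpos, le_div_iff₀ hR]; linarith
  simp [planeMove, max_eq_left h2]

lemma injective_planeMove {c v : ℝ × ℝ} {R : ℝ} (hv : ‖v‖ < R) :
    Injective fun w => planeMove c v R (1, w) := by
  have hR : 0 < R := (norm_nonneg v).trans_lt hv
  intro w w' h
  simp only [planeMove, Icc.coe_one, one_mul] at h
  have h1 : w - w' = (max 0 (1 - ‖w' - c‖ / R) - max 0 (1 - ‖w - c‖ / R)) • v := by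
    rw [sub_smul]
    linear_combination (exp := 1) h
  have h2 : |max 0 (1 - ‖w' - c‖ / R) - max 0 (1 - ‖w - c‖ / R)| ≤ ‖w - w'‖ / R := by
    refine (abs_max_sub_max_le_max _ _ _ _).trans ?_
    have h3 : |1 - ‖w' - c‖ / R - (1 - ‖w - c‖ / R)| = |‖w - c‖ - ‖w' - c‖| / R := by
      rw [← abs_of_pos hR, ← abs_div, abs_of_pos hR]; congr 1; ring
    have h4 : |‖w - c‖ - ‖w' - c‖| ≤ ‖w - w'‖ := by
      simpa using abs_norm_sub_norm_le (w - c) (w' - c)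
    rw [h3, sub_zero, abs_zero]
    exact max_le (by positivity) (by gcongr)
  by_contra hne
  have h5 : 0 < ‖w - w'‖ := norm_pos_iff.2 (sub_ne_zero.2 hne)
  have h6 : ‖w - w'‖ ≤ ‖w - w'‖ / R * ‖v‖ := by
    conv_lhs => rw [h1, norm_smul]
    exact mul_le_mul_of_nonneg_right h2 (norm_nonneg v)
  have h7 : ‖w - w'‖ / R * ‖v‖ < ‖w - w'‖ := by
    rw [div_mul_eq_mul_div, div_lt_iff₀ hR]
    exact mul_lt_mul_of_pos_left hv h5
  linarith

lemma SurfChart.exists_move {X : Type*} [TopologicalSpace X] [T2Space X] (χ : SurfChart X)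
    {c v : ℝ × ℝ} {R : ℝ} (hv : ‖v‖ < R)
    (hρ : ∀ s w, χ.ρ w = w → χ.ρ (planeMove c v R (s, w)) = planeMove c v R (s, w)) :
    ∃ H : I × X → X, Continuous H ∧ (∀ x, H (0, x) = x) ∧ (Injective fun x => H (1, x)) ∧
      (∀ s, ∀ x ∈ range χ.ψ, H (s, x) = χ.ψ (planeMove c v R (s, χ.j x))) ∧
      ∀ s, ∀ x ∉ range χ.ψ, H (s, x) = x := by
  classical
  have hR : 0 < R := (norm_nonneg v).trans_lt hv
  let H : I × X → X := fun z =>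
    if z.2 ∈ range χ.ψ then χ.ψ (planeMove c v R (z.1, χ.j z.2)) else z.2
  have hH1 : ∀ s, ∀ x ∈ range χ.ψ, H (s, x) = χ.ψ (planeMove c v R (s, χ.j x)) :=
    fun s x hx => if_pos hx
  have hH2 : ∀ s, ∀ x ∉ range χ.ψ, H (s, x) = x := fun s x hx => if_neg hx
  refine ⟨H, ?_, fun x => ?_, fun x y h => ?_, hH1, hH2⟩
  · rw [continuous_iff_continuousAt]
    rintro ⟨s, x⟩
    by_cases hx : x ∈ range χ.ψ
    · have hO : (univ ×ˢ range χ.ψ : Set (I × X)) ∈ 𝓝 (s, x) :=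
        (isOpen_univ.prod χ.isOpen).mem_nhds ⟨mem_univ _, hx⟩
      have h1 : ContinuousAt (fun z : I × X => χ.ψ (planeMove c v R (z.1, χ.j z.2))) (s, x) := by
        refine χ.cont.continuousAt.comp ((continuous_planeMove c v R).continuousAt.comp ?_)
        exact continuousAt_fst.prodMk
          (ContinuousAt.comp (g := χ.j) (χ.continuousAt_j hx) continuousAt_snd)
      refine h1.congr ?_
      filter_upwards [hO] with z hz
      exact (hH1 z.1 z.2 hz.2).symm
    · have hK : IsClosed (χ.ψ '' closedBall 0 (‖c‖ + R)) :=
        ((isCompact_closedBall _ _).image χ.cont).isClosed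
      have hO : (univ ×ˢ (χ.ψ '' closedBall 0 (‖c‖ + R))ᶜ : Set (I × X)) ∈ 𝓝 (s, x) :=
        (isOpen_univ.prod hK.isOpen_compl).mem_nhds
          ⟨mem_univ _, fun h => hx (image_subset_range _ _ h)⟩
      refine (continuousAt_snd (p := (s, x))).congr ?_
      filter_upwards [hO] with z hz
      by_cases hz' : z.2 ∈ range χ.ψ
      · rw [← Prod.mk.eta (p := z), hH1 z.1 z.2 hz', planeMove_of_le hR, χ.ψ_j hz']
        by_contra hlt
        exact hz.2 ⟨χ.j z.2, by simpa using (not_le.1 hlt).le, χ.ψ_j hz'⟩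
      · exact (hH2 z.1 z.2 hz').symm
  · by_cases hx : x ∈ range χ.ψ
    · rw [hH1 0 x hx, planeMove_zero, χ.ψ_j hx]
    · exact hH2 0 x hx
  · have h : H (1, x) = H (1, y) := h
    by_cases hx : x ∈ range χ.ψ <;> by_cases hy : y ∈ range χ.ψ
    · rw [hH1 1 x hx, hH1 1 y hy] at h
      have h1 := congrArg χ.j h
      rw [χ.j_ψ, χ.j_ψ, hρ _ _ (χ.ρ_j hx), hρ _ _ (χ.ρ_j hy)] at h1
      rw [← χ.ψ_j hx, ← χ.ψ_j hy, injective_planeMove hv h1]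
    · rw [hH1 1 x hx, hH2 1 y hy] at h
      exact absurd ⟨_, h⟩ hy
    · rw [hH2 1 x hx, hH1 1 y hy] at h
      exact absurd ⟨_, h.symm⟩ hx
    · rwa [hH2 1 x hx, hH2 1 y hy] at h

namespace ArcInvolution

variable {X : Type*} [TopologicalSpace X] (D : ArcInvolution X)

/-- Equivariant injective self-maps, homotopic to the identity relative to the arc. -/
def IsPush (e : X → X) : Prop :=
  Injective e ∧ (∀ x, e (D.h x) = D.h (e x)) ∧ ∃ H : I × X → X, Continuous H ∧
    (∀ x, H (0, x) = x) ∧ (∀ x, H (1, x) = e x) ∧ ∀ s t, H (s, D.θ t) = D.θ t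

variable {D}

lemma IsPush.continuous {e : X → X} (he : D.IsPush e) : Continuous e := by
  obtain ⟨-, -, H, hc, -, h1, -⟩ := he
  have : e = fun x => H (1, x) := funext fun x => (h1 x).symm
  rw [this]
  fun_prop

lemma IsPush.apply_θ {e : X → X} (he : D.IsPush e) (t : I) : e (D.θ t) = D.θ t := by
  obtain ⟨-, -, H, -, -, h1, h2⟩ := he
  rw [← h1, h2]

lemma IsPush.comp {e e' : X → X} (he : D.IsPush e) (he' : D.IsPush e') : D.IsPush (e ∘ e') := by
  obtain ⟨hi, hh, H, hc, h0, h1, h2⟩ := he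
  obtain ⟨hi', hh', H', hc', h0', h1', h2'⟩ := he'
  refine ⟨hi.comp hi', fun x => by simp [hh, hh'], fun z => H (z.1, H' z), by fun_prop, fun x => ?_,
    fun x => ?_, fun s t => ?_⟩
  · simp only [h0', h0]
  · simp only [h1', h1, comp_apply]
  · simp only [h2', h2]

lemma isPush_id : D.IsPush id :=
  ⟨injective_id, fun _ => rfl, fun z => z.2, continuous_snd, fun _ => rfl, fun _ => rfl,
    fun _ _ => rfl⟩

/-- A move in a chart that is disjoint from its mirror image. -/
lemma exists_push_of_chart [T2Space X] (χ : SurfChart X) (hδ : ∀ t, D.θ t ∉ range χ.ψ)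
    (hdis : ∀ x ∈ range χ.ψ, D.h x ∉ range χ.ψ) {c v : ℝ × ℝ} {R : ℝ} (hv : ‖v‖ < R)
    (hρ : ∀ s w, χ.ρ w = w → χ.ρ (planeMove c v R (s, w)) = planeMove c v R (s, w)) :
    ∃ e, D.IsPush e ∧ (∀ x ∈ range χ.ψ, e x = χ.ψ (planeMove c v R (1, χ.j x))) ∧
      ∀ x ∉ range χ.ψ, e x ∉ range χ.ψ := by
  obtain ⟨H, hc, h0, hi, hin, hout⟩ := χ.exists_move hv hρ
  have hmem : ∀ s, ∀ x ∈ range χ.ψ, H (s, x) ∈ range χ.ψ := fun s x hx =>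
    hin s x hx ▸ mem_range_self _
  have hc' := D.cont
  have hB : ∀ s, ∀ x ∈ range χ.ψ, D.h (H (s, D.h (H (s, x)))) = H (s, x) := fun s x hx => by
    rw [hout s _ (hdis _ (hmem s x hx)), D.invol]
  have hnB : ∀ s, ∀ x ∉ range χ.ψ, D.h (H (s, D.h (H (s, x)))) = D.h (H (s, D.h x)) :=
    fun s x hx => by rw [hout s x hx]
  refine ⟨fun x => D.h (H (1, D.h (H (1, x)))), ⟨?_, ?_, fun z => D.h (H (z.1, D.h (H z))),
    by fun_prop, fun x => ?_, fun x => rfl, fun s t => ?_⟩, fun x hx => ?_, fun x hx => ?_⟩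
  · exact D.invol.injective.comp (hi.comp (D.invol.injective.comp hi))
  · intro x
    beta_reduce
    by_cases hx : x ∈ range χ.ψ
    · rw [hB 1 x hx, hnB 1 _ (hdis x hx), D.invol]
    · rw [hnB 1 x hx, D.invol]
      by_cases hx' : D.h x ∈ range χ.ψ
      · rw [hB 1 _ hx']
      · rw [hnB 1 _ hx', D.invol, hout 1 x hx, hout 1 _ hx']
  · simp only [h0, D.invol x]
  · simp only [hout s _ (hδ t), D.h_θ]
  · beta_reduce
    rw [hB 1 x hx, hin 1 x hx]
  · beta_reduce
    rw [hnB 1 x hx]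
    by_cases hx' : D.h x ∈ range χ.ψ
    · exact hdis _ (hmem 1 _ hx')
    · rwa [hout 1 _ hx', D.invol]

lemma exists_small_chart [T2Space X] (χ : SurfChart X) (hq : χ.ψ 0 ∉ range D.θ) :
    ∃ χ' : SurfChart X, χ'.ψ 0 = χ.ψ 0 ∧ χ'.ρ = χ.ρ ∧ (∀ t, D.θ t ∉ range χ'.ψ) ∧
      ∀ x ∈ range χ'.ψ, D.h x ∉ range χ'.ψ := by
  have hne : χ.ψ 0 ≠ D.h (χ.ψ 0) := fun h => hq ((D.fix _).1 h.symm)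
  obtain ⟨U, W, hU, hW, hqU, hqW, hUW⟩ := t2_separation hne
  have hcl : IsClosed (range D.θ) := (isCompact_range D.contθ).isClosed
  obtain ⟨χ', h1, h2, h3⟩ := χ.exists_shrink (O := U ∩ D.h ⁻¹' W ∩ (range D.θ)ᶜ)
    (((hU.inter (hW.preimage D.cont)).inter hcl.isOpen_compl).mem_nhds ⟨⟨hqU, hqW⟩, hq⟩)
  refine ⟨χ', h1, h2, fun t ht => (h3 ht).1.2 (mem_range_self t), fun x hx hx' => ?_⟩
  exact disjoint_left.1 hUW (h3 hx').1.1.1 (h3 hx).1.1.2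

/-- The points off the arc that are missed by some push. -/
def Good (D : ArcInvolution X) : Set X := {q | q ∉ range D.θ ∧ ∃ e, D.IsPush e ∧ q ∉ range e}

lemma good_of_fold [T2Space X] (χ : SurfChart X) (hχ : χ.ρ = foldMap)
    (hδ : ∀ t, D.θ t ∉ range χ.ψ) (hdis : ∀ x ∈ range χ.ψ, D.h x ∉ range χ.ψ) :
    range χ.ψ ⊆ D.Good := by
  intro q hq
  have hq0 : 0 ≤ (χ.j q).1 := by
    rw [← χ.ρ_j hq, hχ]; exact abs_nonneg _
  refine ⟨fun ⟨t, ht⟩ => hδ t (ht ▸ hq), ?_⟩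
  set s := (χ.j q).1 with hs
  set t := (χ.j q).2 with ht
  obtain ⟨e, he, hin, hout⟩ := exists_push_of_chart (D := D) χ hδ hdis (c := (0, t))
    (v := (s + 1, 0)) (R := s + 2)
    (by
      rw [Prod.norm_def]
      simp only [norm_zero, Real.norm_of_nonneg (show 0 ≤ s + 1 by linarith)]
      rw [max_eq_left (by linarith)]
      linarith)
    (fun r w hw => by
      rw [hχ] at hw ⊢
      have h0 : 0 ≤ w.1 := by rw [← hw]; exact abs_nonneg _
      have : 0 ≤ (r : ℝ) * max 0 (1 - ‖w - (0, t)‖ / (s + 2)) * (s + 1) :=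
        mul_nonneg (mul_nonneg r.2.1 (le_max_left _ _)) (by linarith)
      ext
      · simp only [foldMap, planeMove, Prod.fst_add, Prod.smul_fst, smul_eq_mul]
        exact abs_of_nonneg (by linarith)
      · rfl)
  refine ⟨e, he, ?_⟩
  rintro ⟨x, rfl⟩
  by_cases hx : x ∈ range χ.ψ
  · have hjx : 0 ≤ (χ.j x).1 := by
      rw [← χ.ρ_j hx, hχ]; exact abs_nonneg _
    have h1 : χ.j (e x) = planeMove (0, t) (s + 1, 0) (s + 2) (1, χ.j x) := by
      rw [hin x hx, χ.j_ψ, hχ]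
      have : 0 ≤ max 0 (1 - ‖χ.j x - (0, t)‖ / (s + 2)) * (s + 1) :=
        mul_nonneg (le_max_left _ _) (by linarith)
      ext
      · simp only [foldMap, planeMove, Prod.fst_add, Prod.smul_fst, smul_eq_mul, Icc.coe_one,
          one_mul]
        exact abs_of_nonneg (by linarith)
      · rfl
    have h2 : t = (χ.j x).2 := by
      rw [ht, h1]; simp [planeMove]
    have h3 : s = (χ.j x).1 + max 0 (1 - (χ.j x).1 / (s + 2)) * (s + 1) := by
      have h4 : ‖χ.j x - (0, t)‖ = (χ.j x).1 := by
        rw [Prod.norm_def]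
        simp [← h2, abs_of_nonneg hjx, hjx]
      have h5 := congrArg Prod.fst h1
      rw [← hs] at h5
      simpa only [planeMove, Prod.fst_add, Prod.smul_fst, smul_eq_mul, Icc.coe_one,
          one_mul, h4] using h5
    have hle : 1 - (χ.j x).1 / (s + 2) ≤ max 0 (1 - (χ.j x).1 / (s + 2)) := le_max_right _ _
    have h6 : (1 - (χ.j x).1 / (s + 2)) * (s + 1) ≤ max 0 (1 - (χ.j x).1 / (s + 2)) * (s + 1) :=
      mul_le_mul_of_nonneg_right hle (by linarith)
    have h7 : (χ.j x).1 / (s + 2) * (s + 1) ≤ (χ.j x).1 := by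
      rw [div_mul_eq_mul_div, div_le_iff₀ (by linarith)]
      nlinarith
    linarith
  · exact hout x hx hq

lemma good_of_mem [T2Space X] (χ : SurfChart X) (hχ : χ.ρ = id)
    (hδ : ∀ t, D.θ t ∉ range χ.ψ) (hdis : ∀ x ∈ range χ.ψ, D.h x ∉ range χ.ψ) {q : X}
    (hq : q ∈ range χ.ψ) (hg : q ∈ D.Good) : range χ.ψ ⊆ D.Good := by
  intro q' hq'
  obtain ⟨-, e₀, he₀, hqe⟩ := hg
  obtain ⟨e, he, hin, -⟩ := exists_push_of_chart (D := D) χ hδ hdis (c := χ.j q)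
    (v := χ.j q' - χ.j q) (R := ‖χ.j q' - χ.j q‖ + 1) (by linarith) (fun r w hw => by rw [hχ]; rfl)
  refine ⟨fun ⟨t, ht⟩ => hδ t (ht ▸ hq'), e ∘ e₀, he.comp he₀, ?_⟩
  rintro ⟨x, hx⟩
  apply hqe
  refine ⟨x, he.1 ?_⟩
  rw [hin q hq, planeMove_centre, add_sub_cancel, χ.ψ_j hq']
  exact hx

/-- The arc has its end points on the boundary and its other points in the interior. -/
def Proper (D : ArcInvolution X) : Prop :=
  (∃ χ : SurfChart X, χ.ρ = foldMap ∧ χ.ψ 0 = D.θ 0) ∧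
  (∃ χ : SurfChart X, χ.ρ = foldMap ∧ χ.ψ 0 = D.θ 1) ∧
  ∀ t, t ≠ 0 → t ≠ 1 → ∃ χ : SurfChart X, χ.ρ = id ∧ χ.ψ 0 = D.θ t

lemma good_eq [T2Space X] [ConnectedSpace X] (hX : HasCharts X) (hD : D.Proper) :
    D.Good = (range D.θ)ᶜ := by
  have hfold : ∀ χ : SurfChart X, χ.ρ = foldMap → χ.ψ 0 ∉ range D.θ →
      ∃ O ∈ 𝓝 (χ.ψ 0), O ⊆ D.Good := fun χ hχ hq => by
    obtain ⟨χ', h1, h2, h3, h4⟩ := exists_small_chart χ hq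
    exact ⟨range χ'.ψ, h1 ▸ χ'.isOpen.mem_nhds (mem_range_self 0),
      good_of_fold χ' (h2.trans hχ) h3 h4⟩
  have hopen : IsOpen D.Good := by
    rw [isOpen_iff_mem_nhds]
    intro q hq
    obtain ⟨χ, rfl⟩ := hX q
    rcases χ.ρ_eq with hχ | hχ
    · obtain ⟨χ', h1, h2, h3, h4⟩ := exists_small_chart χ hq.1
      refine mem_of_superset (h1 ▸ χ'.isOpen.mem_nhds (mem_range_self 0))
        (good_of_mem χ' (h2.trans hχ) h3 h4 (mem_range_self 0) (h1 ▸ hq))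
    · obtain ⟨O, hO, hOG⟩ := hfold χ hχ hq.1
      exact mem_of_superset hO hOG
  have hopen' : IsOpen ((range D.θ)ᶜ \ D.Good) := by
    rw [isOpen_iff_mem_nhds]
    intro q hq
    obtain ⟨χ, rfl⟩ := hX q
    rcases χ.ρ_eq with hχ | hχ
    · obtain ⟨χ', h1, h2, h3, h4⟩ := exists_small_chart χ hq.1
      refine mem_of_superset (h1 ▸ χ'.isOpen.mem_nhds (mem_range_self 0)) fun x hx =>
        ⟨?_, fun h => ?_⟩
      · rintro ⟨t, rfl⟩
        exact h3 t hx
      · exact hq.2 (h1 ▸ good_of_mem χ' (h2.trans hχ) h3 h4 hx h (mem_range_self 0))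
    · obtain ⟨O, hO, hOG⟩ := hfold χ hχ hq.1
      exact absurd (hOG (mem_of_mem_nhds hO)) hq.2
  have hempty := eq_empty_of_closure_subset_arc D.contθ D.injθ hD.1 hD.2.1 hD.2.2 hopen'
    (fun t h => h.1 (mem_range_self t)) ?_ ?_
  · exact Subset.antisymm (fun q hq => hq.1) (sdiff_eq_empty.1 hempty)
  · have : (range D.θ)ᶜ \ D.Good ∪ range D.θ = D.Goodᶜ := by
      ext q
      by_cases hq : q ∈ range D.θ
      · simp only [mem_union, hq, or_true, true_iff]
        exact fun h => h.1 hq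
      · simp [hq]
    rw [this]
    exact closure_minimal (fun q hq => hq.2) hopen.isClosed_compl
  · rintro χ hχ ⟨h1, h2⟩
    obtain ⟨O, hO, hOG⟩ := hfold χ hχ h1
    exact h2 (hOG (mem_of_mem_nhds hO))

/-- There is a push missing any given finite set off the arc. -/
lemma exists_push_disjoint [T2Space X] [ConnectedSpace X] (hX : HasCharts X) (hD : D.Proper)
    {P : Set X} (hP : P.Finite) (hPθ : Disjoint P (range D.θ)) :
    ∃ e, D.IsPush e ∧ Disjoint (range e) P := by
  induction hn : P.ncard using Nat.strong_induction_on generalizing P with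
  | _ n ih =>
  rcases P.eq_empty_or_nonempty with rfl | ⟨q, hq⟩
  · exact ⟨id, isPush_id, disjoint_empty _⟩
  have hqg : q ∈ D.Good := by
    rw [good_eq hX hD]
    exact disjoint_left.1 hPθ hq
  obtain ⟨-, e, he, hqe⟩ := hqg
  have hfin : (e ⁻¹' P).Finite := hP.preimage he.1.injOn
  have hlt : (e ⁻¹' P).ncard < n := by
    rw [← hn, ← ncard_image_of_injective _ he.1]
    refine ncard_lt_ncard ⟨image_preimage_subset e P, fun h => hqe ?_⟩ hP
    obtain ⟨x, -, hx⟩ := h hq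
    exact ⟨x, hx⟩
  have hθ : Disjoint (e ⁻¹' P) (range D.θ) := by
    refine disjoint_left.2 ?_
    rintro x hx ⟨t, rfl⟩
    rw [mem_preimage, he.apply_θ] at hx
    exact disjoint_left.1 hPθ hx (mem_range_self t)
  obtain ⟨e', he', hd⟩ := ih _ hlt hfin hθ rfl
  refine ⟨e ∘ e', he.comp he', disjoint_left.2 ?_⟩
  rintro _ ⟨x, rfl⟩ hx
  exact disjoint_left.1 hd (mem_range_self x) hx

end ArcInvolution

end Pushing

/-! ### The equivariant section -/

section EquivariantSection

/-- The fundamental group embeds equivariantly in a free group with a permutation action. -/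
theorem ArcInvolution.exists_section {X : Type} [MetricSpace X] [CompactSpace X] [ConnectedSpace X]
    (D : ArcInvolution X) (hX : HasCharts X) (hD : D.Proper) :
    ∃ s : FundamentalGroup X (D.θ 0) →*
        FreeGroup (FundamentalGroup X (D.θ 0) ⊕ FundamentalGroup X (D.θ 0)),
      (∀ g, twistedEval D.τ (s g) = g) ∧ ∀ g, s (D.τ g) = swapHom _ (s g) := by
  obtain ⟨c, hc, hcτ, hcθ, hcγ⟩ := D.exists_canonical hX
  obtain ⟨f, P, hP, -, hPθ, hfσ, hfP⟩ := exists_equivariant_lift_off_finite (D := D) hX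
    (σ := swapHom _) (τ := D.τ) (p := twistedEval D.τ) swapHom_swapHom
    (twistedEval_surjective D.τ) (twistedEval_swap D.τ_τ) hc hcτ hcθ
  obtain ⟨e, he, heP⟩ := ArcInvolution.exists_push_disjoint hX hD hP hPθ
  have hec := he.continuous
  have hlift : ∀ x, LiftsAt (twistedEval D.τ) c f (e x) := fun x =>
    hfP _ (disjoint_left.1 heP (mem_range_self x))
  have hloc : ∀ x, LocCocycleAt (fun u v => f (e u) (e v)) x := fun x => by
    obtain ⟨V, hV, h, -⟩ := hlift x
    exact LocCocycleAt.comap ⟨V, hV, h⟩ hec.continuousAt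
  refine ⟨holHom _ hloc (D.θ 0), fun g => ?_, fun g => ?_⟩
  · induction g using Path.Homotopic.Quotient.ind with | _ γ =>
    rw [holHom_mk, ← hol_map γ.continuous fun t => hloc _]
    have h1 : hol (fun u v => twistedEval D.τ (f (e u) (e v))) γ =
        hol (fun u v => c (e u) (e v)) γ := by
      refine hol_congr γ.continuous (fun t => ?_) fun t => ?_
      · obtain ⟨V, hV, h⟩ := hloc (γ t)
        refine ⟨V, hV, fun u hu v hv w hw => ?_⟩
        rw [← map_mul, h u hu v hv w hw]
      · obtain ⟨V, hV, -, h⟩ := hlift (γ t)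
        exact ⟨e ⁻¹' V, hec.continuousAt hV, fun u hu v hv => h _ hu _ hv⟩
    have h2 : γ.Homotopic ((γ.map hec).cast (he.apply_θ 0).symm (he.apply_θ 0).symm) := by
      obtain ⟨-, -, H, hH, h0, h1, h2⟩ := he
      have hγ := γ.continuous
      refine ⟨⟨⟨⟨fun z => H (z.1, γ z.2), by fun_prop⟩, fun t => h0 _, fun t => h1 _⟩, ?_⟩⟩
      rintro s t (rfl | rfl)
      · change H (s, γ 0) = γ 0
        rw [γ.source, h2]
      · change H (s, γ 1) = γ 1
        rw [γ.target, h2]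
    rw [h1, ← hcγ, hol_homotopic hc h2]
    rfl
  · induction g using Path.Homotopic.Quotient.ind with | _ γ =>
    rw [D.τ_mk, holHom_mk, holHom_mk, ← hol_map γ.continuous fun t => hloc _]
    have : (fun u v => swapHom _ (f (e u) (e v))) = fun u v => f (e (D.h u)) (e (D.h v)) := by
      funext u v
      rw [he.2.1, he.2.1, hfσ]
    rw [this]
    rfl

end EquivariantSection

/-! ### The quotient by an involution fixing an arc -/

section QuotientByInvolution

open unitInterval Filter

/-- The affine path in the unit interval. -/
def segI (u v : I) (r : I) : I :=
  ⟨(1 - (r : ℝ)) * u + r * v, convex_Icc (0 : ℝ) 1 u.2 v.2 (by linarith [r.2.2]) r.2.1 (by ring)⟩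

lemma continuous_segI (u v : I) : Continuous (segI u v) := by
  unfold segI
  fun_prop

lemma segI_mem_Icc {k l u v : I} (hu : u ∈ Icc k l) (hv : v ∈ Icc k l) (r : I) :
    segI u v r ∈ Icc k l :=
  convex_Icc (k : ℝ) (l : ℝ) (show (u : ℝ) ∈ Icc (k : ℝ) l from hu)
    (show (v : ℝ) ∈ Icc (k : ℝ) l from hv) (by linarith [r.2.2] : 0 ≤ 1 - (r : ℝ)) r.2.1 (by ring)

/-- Primitives on open subsets of the interval. -/
lemma exists_prim_on {A : Type*} [Group A] {J : Set I} (hJ : IsOpen J) {g : I → I → A}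
    (hg : ∀ t ∈ J, LocCocycleAt g t) : ∃ a : I → A, ∀ t ∈ J, ∀ᶠ s in 𝓝 t, a s = g t s * a t := by
  classical
  let pick : Set I → I := fun s => if h : s.Nonempty then h.some else 0
  have hpick : ∀ t ∈ J, pick (connectedComponentIn J t) ∈ connectedComponentIn J t := fun t ht => by
    have h : (connectedComponentIn J t).Nonempty := ⟨t, mem_connectedComponentIn ht⟩
    simp only [pick, dif_pos h]
    exact h.some_mem
  refine ⟨fun t => hol g (segI (pick (connectedComponentIn J t)) t), fun t ht => ?_⟩
  set C := connectedComponentIn J t with hC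
  set b := pick C with hb
  have hbC : b ∈ C := hpick t ht
  have hconv : OrdConnected C := isPreconnected_connectedComponentIn.ordConnected
  have htC : t ∈ C := mem_connectedComponentIn ht
  obtain ⟨k, l, htkl, hkl, hsub⟩ := exists_Icc_mem_subset_of_mem_nhds (hJ.mem_nhds ht)
  have hkl' : k ≤ l := htkl.1.trans htkl.2
  replace hsub : Icc k l ⊆ C := isPreconnected_Icc.subset_connectedComponentIn htkl hsub
  set k' := min b k with hk'
  set l' := max b l with hl'
  have hkC : k' ∈ C := by
    rcases min_choice b k with h | h <;> rw [hk', h]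
    · exact hbC
    · exact hsub (left_mem_Icc.2 hkl')
  have hlC : l' ∈ C := by
    rcases max_choice b l with h | h <;> rw [hl', h]
    · exact hbC
    · exact hsub (right_mem_Icc.2 hkl')
  have hle : k' ≤ l' := (min_le_left _ _).trans (le_max_left _ _)
  let κ : I → I := fun x => max k' (min l' x)
  have hκc : Continuous κ := by fun_prop
  have hκJ : ∀ x, κ x ∈ J := fun x => connectedComponentIn_subset J t <|
    hconv.out hkC hlC ⟨le_max_left _ _, max_le hle (min_le_left _ _)⟩
  have hκ : ∀ x ∈ Icc k' l', κ x = x := fun x hx => by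
    simp only [κ]
    rw [min_eq_right hx.2, max_eq_right hx.1]
  have hbm : b ∈ Icc k' l' := ⟨min_le_left _ _, le_max_left _ _⟩
  have hm : Icc k l ⊆ Icc k' l' := Icc_subset_Icc (min_le_right _ _) (le_max_right _ _)
  obtain ⟨B, hB⟩ := exists_prim hκc fun x => hg _ (hκJ x)
  have ha : ∀ s ∈ Icc k l, hol g (segI b s) = B s * (B b)⁻¹ := fun s hs => by
    have h1 : κ ∘ segI b s = segI b s := funext fun r => hκ _ (segI_mem_Icc hbm (hm hs) r)
    have h2 := hol_comp_prim hB (continuous_segI b s)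
    rw [h1] at h2
    have h3 : segI b s 1 = s := Subtype.ext (by simp [segI])
    have h4 : segI b s 0 = b := Subtype.ext (by simp [segI])
    rw [h2, h3, h4]
  filter_upwards [hkl, hB t] with s hs hBs
  have hcomp : connectedComponentIn J s = C := by
    rw [hC, connectedComponentIn_eq (hsub hs : s ∈ connectedComponentIn J t)]
  rw [hcomp, ha s hs, ha t htkl, hBs, hκ s (hm hs), hκ t (hm htkl), mul_assoc]

namespace ArcInvolution

variable {X Y : Type*} [MetricSpace X] [TopologicalSpace Y]
  (D : ArcInvolution X) {q : X → Y}

lemma isOpenMap_quot [CompactSpace X] [T2Space Y] (hq : Continuous q) (hqs : Surjective q)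
    (hqh : ∀ x y, q x = q y ↔ y = x ∨ y = D.h x) : IsOpenMap q := by
  intro U hU
  rw [← (hq.isClosedMap.isQuotientMap hq hqs).isOpen_preimage]
  have : q ⁻¹' (q '' U) = U ∪ D.h ⁻¹' U := by
    ext x
    constructor
    · rintro ⟨u, hu, h⟩
      rcases (hqh x u).1 h.symm with rfl | rfl
      · exact Or.inl hu
      · exact Or.inr hu
    · rintro (h | h)
      · exact ⟨x, h, rfl⟩
      · exact ⟨D.h x, h, ((hqh x _).2 (Or.inr rfl)).symm⟩
  rw [this]
  exact hU.union (hU.preimage D.cont)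

/-- Paths lift along the quotient by the involution. -/
lemma exists_lift_path [CompactSpace X] [T2Space Y] (hq : Continuous q) (hqs : Surjective q)
    (hqh : ∀ x y, q x = q y ↔ y = x ∨ y = D.h x) {β : I → Y} (hβ : Continuous β) :
    ∃ γ : I → X, Continuous γ ∧ ∀ t, q (γ t) = β t := by
  classical
  have hopen := D.isOpenMap_quot hq hqs hqh
  have hh := D.cont
  have hqh' : ∀ x, q (D.h x) = q x := fun x => ((hqh x _).2 (Or.inr rfl)).symm
  choose ℓ hℓ using fun t => hqs (β t)
  let J : Set I := β ⁻¹' (q '' range D.θ)ᶜ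
  have hJ : IsOpen J := (((isCompact_range D.contθ).image hq).isClosed.isOpen_compl).preimage hβ
  have hJℓ : ∀ t ∈ J, ℓ t ∉ range D.θ := fun t ht h => ht ⟨ℓ t, h, hℓ t⟩
  let g : I → I → ℤˣ := fun t s => if dist (ℓ t) (ℓ s) < dist (ℓ t) (D.h (ℓ s)) then 1 else -1
  have hsheet : ∀ x, x ∉ range D.θ → ∀ O ∈ 𝓝 x, ∃ U ⊆ O, U ∈ 𝓝 x ∧ ∀ u ∈ U, ∀ v ∈ U,
      dist u v < dist u (D.h v) ∧ dist (D.h u) (D.h v) < dist (D.h u) v := by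
    intro x hx O hO
    have hpos : 0 < dist x (D.h x) := dist_pos.2 fun h => hx ((D.fix x).1 h.symm)
    have h1 : ∀ᶠ p : X × X in 𝓝 (x, x), dist p.1 p.2 < dist p.1 (D.h p.2) ∧
        dist (D.h p.1) (D.h p.2) < dist (D.h p.1) p.2 := by
      have hc : IsOpen {p : X × X | dist p.1 p.2 < dist p.1 (D.h p.2)} :=
        isOpen_lt (by fun_prop) (by fun_prop)
      have hc' : IsOpen {p : X × X | dist (D.h p.1) (D.h p.2) < dist (D.h p.1) p.2} :=
        isOpen_lt (by fun_prop) (by fun_prop)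
      refine (hc.inter hc').mem_nhds ⟨?_, ?_⟩
      · simpa using hpos
      · rw [dist_comm] at hpos
        simpa using hpos
    rw [nhds_prod_eq] at h1
    obtain ⟨V, hV, h2⟩ := mem_prod_same_iff.1 h1
    exact ⟨V ∩ O, inter_subset_right, inter_mem hV hO, fun u hu v hv => h2 (mk_mem_prod hu.1 hv.1)⟩
  have hnear : ∀ t, ∀ U ∈ 𝓝 (ℓ t), ∀ᶠ s in 𝓝 t, ℓ s ∈ U ∨ D.h (ℓ s) ∈ U := by
    intro t U hU
    have h1 : q '' U ∈ 𝓝 (β t) := hℓ t ▸ hopen.image_mem_nhds hU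
    filter_upwards [hβ.continuousAt h1] with s hs
    obtain ⟨u, hu, h⟩ := hs
    rcases (hqh (ℓ s) u).1 ((hℓ s).trans h.symm) with rfl | rfl
    · exact Or.inl hu
    · exact Or.inr hu
  have hg : ∀ t ∈ J, LocCocycleAt g t := by
    intro t ht
    obtain ⟨U, -, hU, hUd⟩ := hsheet _ (hJℓ t ht) univ univ_mem
    let k : I → ℤˣ := fun s => if ℓ s ∈ U then 1 else -1
    refine ⟨{s | ℓ s ∈ U ∨ D.h (ℓ s) ∈ U}, hnear t U hU, ?_⟩
    have hgk : ∀ r s, (ℓ r ∈ U ∨ D.h (ℓ r) ∈ U) → (ℓ s ∈ U ∨ D.h (ℓ s) ∈ U) →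
        g r s = k s * k r := by
      intro r s hr hs
      simp only [g, k]
      by_cases hr' : ℓ r ∈ U <;> by_cases hs' : ℓ s ∈ U
      · simp [hr', hs', (hUd _ hr' _ hs').1]
      · have := (hUd _ hr' _ (hs.resolve_left hs')).1
        rw [D.invol] at this
        simp [hr', hs', this.le]
      · have := (hUd _ (hr.resolve_left hr') _ hs').2
        rw [D.invol] at this
        simp [hr', hs', this.le]
      · have := (hUd _ (hr.resolve_left hr') _ (hs.resolve_left hs')).2
        rw [D.invol, D.invol] at this
        simp [hr', hs', this]
    intro r hr s hs w hw
    rw [hgk r s hr hs, hgk s w hs hw, hgk r w hr hw]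
    have : k s * k s = 1 := Int.units_mul_self _
    calc k w * k s * (k s * k r) = k w * (k s * k s) * k r := by simp only [mul_assoc]
      _ = k w * k r := by rw [this, mul_one]
  obtain ⟨a, ha⟩ := exists_prim_on hJ hg
  let act : ℤˣ → X → X := fun e x => if e = 1 then x else D.h x
  have hact1 : ∀ x, act 1 x = x := fun x => if_pos rfl
  have hactneg : ∀ e x, act (-1 * e) x = act e (D.h x) := fun e x => by
    rcases Int.units_eq_one_or e with rfl | rfl
    · simp [act]
    · simp [act, D.invol x]
  have hactc : ∀ e, Continuous (act e) := fun e => by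
    rcases Int.units_eq_one_or e with rfl | rfl
    · have : act 1 = id := funext hact1
      rw [this]; exact continuous_id
    · have : act (-1) = D.h := funext fun x => by simp [act]
      rw [this]; exact D.cont
  have hactq : ∀ e x, q (act e x) = q x := fun e x => by
    simp only [act]
    split_ifs
    · rfl
    · exact hqh' x
  have hlift : ∀ t, q (act (a t) (ℓ t)) = β t := fun t => (hactq _ _).trans (hℓ t)
  refine ⟨fun t => act (a t) (ℓ t), ?_, hlift⟩
  rw [continuous_iff_continuousAt]
  intro t O hO
  refine (?_ : ∀ᶠ s in 𝓝 t, act (a s) (ℓ s) ∈ O)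
  by_cases ht : t ∈ J
  · obtain ⟨U, hUO, hU, hUd⟩ := hsheet _ (hJℓ t ht) _ ((hactc (a t)).continuousAt hO)
    have htU := mem_of_mem_nhds hU
    filter_upwards [ha t ht, hnear t U hU] with s hs hsU
    rcases hsU with hsU | hsU
    · have h1 : g t s = 1 := if_pos (hUd _ htU _ hsU).1
      rw [hs, h1, one_mul]
      exact hUO hsU
    · have h1 : g t s = -1 := by
        have := (hUd _ htU _ hsU).1
        rw [D.invol] at this
        exact if_neg (not_lt.2 this.le)
      rw [hs, h1, hactneg]
      exact hUO hsU
  · have h1 : β t ∈ q '' range D.θ := not_not.1 ht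
    obtain ⟨_, ⟨r, rfl⟩, hr⟩ := h1
    have hfib : ∀ x, q x = β t → x = D.θ r := fun x hx => by
      rcases (hqh (D.θ r) x).1 (hr.trans hx.symm) with h | h
      · exact h
      · rw [h, D.h_θ]
    obtain ⟨O', hO'O, hO', htO'⟩ := _root_.mem_nhds_iff.1 hO
    have hW : (q '' O'ᶜ)ᶜ ∈ 𝓝 (β t) := by
      refine (hq.isClosedMap _ hO'.isClosed_compl).isOpen_compl.mem_nhds ?_
      rintro ⟨x, hx, hxt⟩
      apply hx
      rw [hfib x hxt, ← hfib _ (hlift t)]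
      exact htO'
    filter_upwards [hβ.continuousAt hW] with s hs
    by_contra hn
    exact hs ⟨_, fun h => hn (hO'O h), hlift s⟩

/-- The homomorphism induced by the quotient map on fundamental groups. -/
def quotHom (hq : Continuous q) : FundamentalGroup X (D.θ 0) →* FundamentalGroup Y (q (D.θ 0)) :=
  FundamentalGroup.map ⟨q, hq⟩ (D.θ 0)

lemma quotHom_mk (hq : Continuous q) (γ : Path (D.θ 0) (D.θ 0)) :
    D.quotHom hq (Path.Homotopic.Quotient.mk γ) = Path.Homotopic.Quotient.mk (γ.map hq) := rfl

lemma quotHom_surjective [CompactSpace X] [T2Space Y] (hq : Continuous q) (hqs : Surjective q)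
    (hqh : ∀ x y, q x = q y ↔ y = x ∨ y = D.h x) : Surjective (D.quotHom hq) := by
  intro g
  induction g using Path.Homotopic.Quotient.ind with | _ β =>
  obtain ⟨γ, hγ, hqγ⟩ := D.exists_lift_path hq hqs hqh β.continuous
  have hfib : ∀ x, q x = q (D.θ 0) → x = D.θ 0 := fun x hx => by
    rcases (hqh (D.θ 0) x).1 hx.symm with h | h
    · exact h
    · rw [h, D.h_θ]
  refine ⟨Path.Homotopic.Quotient.mk
    ⟨⟨γ, hγ⟩, hfib _ ((hqγ 0).trans β.source), hfib _ ((hqγ 1).trans β.target)⟩, ?_⟩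
  rw [quotHom_mk]
  congr 1
  ext t
  exact hqγ t

lemma quotHom_τ (hq : Continuous q) (hqh : ∀ x y, q x = q y ↔ y = x ∨ y = D.h x)
    (g : FundamentalGroup X (D.θ 0)) : D.quotHom hq (D.τ g) = D.quotHom hq g := by
  induction g using Path.Homotopic.Quotient.ind with | _ γ =>
  rw [D.τ_mk, quotHom_mk, quotHom_mk]
  congr 1
  ext t
  exact ((hqh (γ t) _).2 (Or.inr rfl)).symm

/-- Invariant cocycles descend to the quotient. -/
lemma exists_descend [CompactSpace X] {A : Type*} [Group A] (hqo : IsOpenMap q)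
    (hqs : Surjective q)
    (hqh : ∀ x y, q x = q y ↔ y = x ∨ y = D.h x) {d : X → X → A} (hd : ∀ x, LocCocycleAt d x)
    (hdh : ∀ x y, d (D.h x) (D.h y) = d x y) : ∃ d' : Y → Y → A, (∀ y, LocCocycleAt d' y) ∧
      ∀ x, ∃ V ∈ 𝓝 x, ∀ u ∈ V, ∀ v ∈ V, d u v = d' (q u) (q v) := by
  classical
  have hh := D.cont
  have hnice : ∀ x, ∃ V : Set X, IsOpen V ∧ x ∈ V ∧ CocycleOn d V ∧
      ((∀ u ∈ V, D.h u ∉ V) ∨ ∀ u ∈ V, ∀ v ∈ V, D.h u ∈ V → d (D.h u) v = d u v) := by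
    intro x
    obtain ⟨V, hV, hdV⟩ := hd x
    obtain ⟨V', hV'V, hV', hxV'⟩ := _root_.mem_nhds_iff.1 hV
    by_cases hx : x ∈ range D.θ
    · have hhx := (D.fix x).2 hx
      refine ⟨V', hV', hxV', hdV.mono hV'V, Or.inr fun u hu v hv hhu => ?_⟩
      have h1 := hdV u (hV'V hu) x (hV'V hxV') v (hV'V hv)
      have h2 := hdV _ (hV'V hhu) x (hV'V hxV') v (hV'V hv)
      rw [← h1, ← h2, ← hdh u x, hhx]
    · have hne : x ≠ D.h x := fun h => hx ((D.fix x).1 h.symm)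
      obtain ⟨U, W, hU, hW, hxU, hxW, hUW⟩ := t2_separation hne
      refine ⟨V' ∩ (U ∩ D.h ⁻¹' W), hV'.inter (hU.inter (hW.preimage hh)), ⟨hxV', hxU, hxW⟩,
        hdV.mono (inter_subset_left.trans hV'V), Or.inl fun u hu hu' => ?_⟩
      exact disjoint_left.1 hUW hu'.2.1 hu.2.2
  choose V hVo hxV hVd hVn using hnice
  obtain ⟨ε, hε, hball⟩ := lebesgue_number_lemma_of_metric (s := univ) (c := V) isCompact_univ hVo
    (fun x _ => mem_iUnion.2 ⟨x, hxV x⟩)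
  let close : X → X → Prop := fun x y => dist x y < ε ∧ dist (D.h x) (D.h y) < ε
  have hwell : ∀ x y x' y', close x y → close x' y' → q x = q x' → q y = q y' →
      d x y = d x' y' := by
    have key : ∀ x y y', close x y → close x y' → q y = q y' → d x y = d x y' := by
      intro x y y' h h' hy
      rcases (hqh y y').1 hy with rfl | rfl
      · rfl
      · obtain ⟨i, hi⟩ := hball x (mem_univ x)
        have hyV : y ∈ V i := hi (by rw [mem_ball, dist_comm]; exact h.1)
        have hyV' : D.h y ∈ V i := hi (by rw [mem_ball, dist_comm]; exact h'.1)
        have hxV' : x ∈ V i := hi (mem_ball_self hε)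
        rcases hVn i with h1 | h1
        · exact absurd hyV' (h1 y hyV)
        · have h2 := h1 y hyV x hxV' hyV'
          have e1 := (hVd i).swap hxV' hyV
          have e2 := (hVd i).swap hxV' hyV'
          rw [h2] at e2
          exact mul_left_cancel (e1.trans e2.symm)
    intro x y x' y' h h' hx hy
    rcases (hqh x x').1 hx with rfl | rfl
    · exact key _ _ _ h h' hy
    · have h1 : close x (D.h y') := by
        refine ⟨?_, ?_⟩
        · have := h'.2
          rwa [D.invol] at this
        · have := h'.1
          rwa [D.invol]
      have h2 := key x y (D.h y') h h1 (hy.trans ((hqh y' _).2 (Or.inr rfl)))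
      rw [h2, ← hdh, D.invol]
  let d' : Y → Y → A := fun a b =>
    if h : ∃ p : X × X, close p.1 p.2 ∧ q p.1 = a ∧ q p.2 = b then d h.choose.1 h.choose.2 else 1
  have hd' : ∀ x y, close x y → d' (q x) (q y) = d x y := fun x y hxy => by
    have h : ∃ p : X × X, close p.1 p.2 ∧ q p.1 = q x ∧ q p.2 = q y := ⟨(x, y), hxy, rfl, rfl⟩
    simp only [d', dif_pos h]
    exact hwell _ _ _ _ h.choose_spec.1 hxy h.choose_spec.2.1 h.choose_spec.2.2
  have hB : ∀ x, ∃ B ∈ 𝓝 x, ∀ u ∈ B, ∀ v ∈ B, close u v := fun x => by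
    have h1 : ∀ᶠ p : X × X in 𝓝 (x, x), close p.1 p.2 := by
      have hc : IsOpen {p : X × X | dist p.1 p.2 < ε} := isOpen_lt (by fun_prop) continuous_const
      have hc' : IsOpen {p : X × X | dist (D.h p.1) (D.h p.2) < ε} :=
        isOpen_lt (by fun_prop) continuous_const
      refine (hc.inter hc').mem_nhds ⟨?_, ?_⟩
      · simpa using hε
      · simpa using hε
    rw [nhds_prod_eq] at h1
    obtain ⟨B, hB, h2⟩ := mem_prod_same_iff.1 h1
    exact ⟨B, hB, fun u hu v hv => h2 (mk_mem_prod hu hv)⟩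
  refine ⟨d', fun y => ?_, fun x => ?_⟩
  · obtain ⟨x, rfl⟩ := hqs y
    obtain ⟨B, hB, hBc⟩ := hB x
    refine ⟨q '' B, hqo.image_mem_nhds hB, ?_⟩
    rintro _ ⟨u, hu, rfl⟩ _ ⟨v, hv, rfl⟩ _ ⟨w, hw, rfl⟩
    rw [hd' _ _ (hBc u hu v hv), hd' _ _ (hBc v hv w hw), hd' _ _ (hBc u hu w hw)]
    obtain ⟨i, hi⟩ := hball u (mem_univ u)
    refine hVd i u (hi (mem_ball_self hε)) v (hi ?_) w (hi ?_)
    · rw [mem_ball, dist_comm]; exact (hBc u hu v hv).1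
    · rw [mem_ball, dist_comm]; exact (hBc u hu w hw).1
  · obtain ⟨B, hB, hBc⟩ := hB x
    exact ⟨B, hB, fun u hu v hv => (hd' u v (hBc u hu v hv)).symm⟩

/-- Invariant homomorphisms factor through the fundamental group of the quotient. -/
lemma exists_factor [CompactSpace X] [ConnectedSpace X] [T2Space Y] (hX : HasCharts X)
    (hq : Continuous q) (hqs : Surjective q) (hqh : ∀ x y, q x = q y ↔ y = x ∨ y = D.h x)
    {A : Type*} [Group A] (Ψ : FundamentalGroup X (D.θ 0) →* A) (hΨ : ∀ g, Ψ (D.τ g) = Ψ g) :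
    ∃ Ψ' : FundamentalGroup Y (q (D.θ 0)) →* A, ∀ g, Ψ' (D.quotHom hq g) = Ψ g := by
  obtain ⟨c, hc, hcτ, -, hcγ⟩ := D.exists_canonical hX
  have hd : ∀ x, LocCocycleAt (fun u v => Ψ (c u v)) x := fun x => by
    obtain ⟨V, hV, h⟩ := hc x
    refine ⟨V, hV, fun u hu v hv w hw => ?_⟩
    rw [← map_mul, h u hu v hv w hw]
  obtain ⟨d', hd', hdd'⟩ := D.exists_descend (D.isOpenMap_quot hq hqs hqh) hqs hqh hd
    fun x y => by rw [hcτ, hΨ]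
  refine ⟨holHom d' hd' _, fun g => ?_⟩
  induction g using Path.Homotopic.Quotient.ind with | _ γ =>
  rw [quotHom_mk, holHom_mk, ← hcγ γ, ← hol_map γ.continuous fun t => hc _,
    hol_congr γ.continuous (fun t => hd _) fun t => hdd' _]
  rfl

end ArcInvolution

end QuotientByInvolution

/-! ### Invariant Seifert surfaces -/

section InvariantSurface

open unitInterval

/-- A relatively open subset of `S` homeomorphic to the plane or the half plane is the range of a
chart. -/
lemma exists_surfChart_of_homeomorph {Y : Type*} [TopologicalSpace Y] {S U : Set Y} (hU : IsOpen U)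
    {T : Set (ℝ × ℝ)} (φ : (U ∩ S : Set Y) ≃ₜ T) {ρ : ℝ × ℝ → ℝ × ℝ} (hρ : ρ = id ∨ ρ = foldMap)
    (hρT : ∀ w, ρ w ∈ T) (hρ' : ∀ w ∈ T, ρ w = w) :
    ∃ χ : SurfChart S, χ.ρ = ρ ∧ ∀ w : T, (χ.ψ w : Y) = φ.symm w := by
  classical
  let ψ : ℝ × ℝ → S := fun w => ⟨φ.symm ⟨ρ w, hρT w⟩, (φ.symm ⟨ρ w, hρT w⟩).2.2⟩
  let j : S → ℝ × ℝ := fun y => if hy : (y : Y) ∈ U then φ ⟨y, hy, y.2⟩ else 0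
  have hρc : Continuous ρ := by
    rcases hρ with rfl | rfl
    · exact continuous_id
    · unfold foldMap; fun_prop
  have hr : range ψ = Subtype.val ⁻¹' U := by
    ext y
    constructor
    · rintro ⟨w, rfl⟩
      exact (φ.symm ⟨ρ w, hρT w⟩).2.1
    · intro hy
      refine ⟨φ ⟨y, hy, y.2⟩, Subtype.ext ?_⟩
      have h1 : (⟨ρ (φ ⟨y, hy, y.2⟩), hρT _⟩ : T) = φ ⟨y, hy, y.2⟩ :=
        Subtype.ext (hρ' _ (φ ⟨y, hy, y.2⟩).2)
      simp only [ψ, h1, φ.symm_apply_apply]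
  have hj : ContinuousOn j (Subtype.val ⁻¹' U) := by
    rw [continuousOn_iff_continuous_domRestrict]
    have h1 : (Subtype.val ⁻¹' U : Set S).domRestrict j =
        fun z => (φ ⟨z.1.1, z.2, z.1.2⟩ : ℝ × ℝ) := funext fun z => dif_pos z.2
    rw [h1]
    fun_prop
  refine ⟨⟨ρ, ψ, j, hρ, by fun_prop, hr ▸ hU.preimage continuous_subtype_val, hr ▸ hj, ?_, ?_⟩,
    rfl, ?_⟩
  · intro w
    have h1 : ((ψ w : S) : Y) ∈ U := (φ.symm ⟨ρ w, hρT w⟩).2.1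
    have h2 : (⟨ψ w, h1, (ψ w).2⟩ : (U ∩ S : Set Y)) = φ.symm ⟨ρ w, hρT w⟩ := rfl
    simp only [j, dif_pos h1, h2, φ.apply_symm_apply]
  · intro w
    simp only [ψ, hρ' _ (hρT w)]
  · intro w
    simp only [ψ, hρ' _ w.2]

lemma IsInteriorPointOf.exists_chart {S : Set S3} {x : S} (hx : IsInteriorPointOf S x) :
    ∃ χ : SurfChart S, χ.ρ = id ∧ χ.ψ 0 = x := by
  obtain ⟨U, hU, hxU, ⟨φ⟩⟩ := hx
  obtain ⟨χ, h1, h2⟩ := exists_surfChart_of_homeomorph hU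
    (φ.trans (Homeomorph.Set.univ (ℝ × ℝ)).symm) (Or.inl rfl) (fun _ => mem_univ _)
    fun _ _ => rfl
  obtain ⟨χ', h3, h4, -⟩ := χ.exists_translate (w := φ ⟨x, hxU, x.2⟩) fun u => by simp [h1]
  refine ⟨χ', h3.trans h1, ?_⟩
  rw [h4, zero_add]
  apply Subtype.ext
  have h5 := h2 ⟨φ ⟨x, hxU, x.2⟩, mem_univ _⟩
  rw [h5]
  simp [Homeomorph.Set.univ]

lemma IsBoundaryPointOf.exists_chart {S : Set S3} {x : S} (hx : IsBoundaryPointOf S x) :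
    ∃ χ : SurfChart S, χ.ρ = foldMap ∧ χ.ψ 0 = x := by
  obtain ⟨U, hU, hxU, φ, hφ⟩ := hx
  obtain ⟨χ, h1, h2⟩ := exists_surfChart_of_homeomorph hU φ (Or.inr rfl) (fun w => abs_nonneg w.1)
    fun w hw => Prod.ext (abs_of_nonneg hw) rfl
  obtain ⟨χ', h3, h4⟩ := χ.exists_translate_fold h1 hφ
  refine ⟨χ', h3, ?_⟩
  rw [h4]
  apply Subtype.ext
  rw [h2, φ.symm_apply_apply]

lemma IsSurfaceWithBoundary.hasCharts {S B : Set S3} (hS : IsSurfaceWithBoundary S B) :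
    HasCharts S := fun x => by
  by_cases hx : (x : S3) ∈ B
  · obtain ⟨χ, -, h⟩ := (hS.2.2.2.2 x hx).exists_chart
    exact ⟨χ, h⟩
  · obtain ⟨χ, -, h⟩ := (hS.2.2.2.1 x ⟨x.2, hx⟩).exists_chart
    exact ⟨χ, h⟩

/-- The end points of an arc are the images of the end points of the interval. -/
lemma mem_arcEndpoints_iff {A : Set S3} (e : A ≃ₜ I) (t : I) :
    (e.symm t : S3) ∈ arcEndpoints A ↔ t = 0 ∨ t = 1 := by
  let f : I → S3 := fun s => e.symm s
  have hf : IsInducing f := IsInducing.subtypeVal.comp e.symm.isInducing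
  have himg : A \ {(e.symm t : S3)} = f '' {t}ᶜ := by
    ext y
    constructor
    · rintro ⟨hy, hyt⟩
      refine ⟨e ⟨y, hy⟩, fun h => hyt ?_, by simp [f]⟩
      rw [mem_singleton_iff] at h ⊢
      rw [← h, e.symm_apply_apply]
    · rintro ⟨s, hs, rfl⟩
      exact ⟨(e.symm s).2, fun h => hs (e.symm.injective (Subtype.ext h))⟩
  have h1 : (e.symm t : S3) ∈ arcEndpoints A ↔ IsPreconnected ({t}ᶜ : Set I) := by
    rw [← hf.isPreconnected_image, ← himg]
    exact ⟨fun h => h.2, fun h => ⟨(e.symm t).2, h⟩⟩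
  rw [h1]
  constructor
  · intro h
    by_contra! hn
    exact h.ordConnected.out (mem_compl_singleton_iff.2 hn.1.symm)
      (mem_compl_singleton_iff.2 hn.2.symm) ⟨unitInterval.nonneg t, unitInterval.le_one t⟩ rfl
  · rintro (rfl | rfl)
    · have : ({0}ᶜ : Set I) = Ioi 0 := by
        ext s; exact (unitInterval.pos_iff_ne_zero).symm
      rw [this]; exact ordConnected_Ioi.isPreconnected
    · have : ({1}ᶜ : Set I) = Iio 1 := by
        ext s; exact (unitInterval.lt_one_iff_ne_one).symm
      rw [this]; exact ordConnected_Iio.isPreconnected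

/-- The restriction of the strong inversion to an invariant Seifert surface. -/
lemma MarkedSIK.exists_arcInvolution (M : MarkedSIK) {S : Set S3}
    (hS : IsInvariantSeifertSurface M.K M.h M.δ S) :
    ∃ D : ArcInvolution S, D.Proper ∧ ∀ x, (D.h x : S3) = M.h x := by
  obtain ⟨⟨hsurf, -⟩, hinv, hfix⟩ := hS
  obtain ⟨hδ, ⟨e⟩, hend⟩ := M.marking
  have hmaps : MapsTo M.h S S := mapsTo_iff_image_subset.2 hinv.subset
  have hδS : M.δ ⊆ S := hfix ▸ inter_subset_right
  have hθ : Continuous fun t : I => inclusion hδS (e.symm t) :=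
    (continuous_inclusion hδS).comp e.symm.continuous
  let D : ArcInvolution S :=
    { h := hmaps.restrict
      cont := M.smooth.continuous.restrict hmaps
      invol := fun x => Subtype.ext (M.involutive x)
      θ := fun t => inclusion hδS (e.symm t)
      contθ := hθ
      injθ := (inclusion_injective hδS).comp e.symm.injective
      fix := fun x => by
        constructor
        · intro hx
          have hxδ : (x : S3) ∈ M.δ := hfix ▸ ⟨congrArg Subtype.val hx, x.2⟩
          exact ⟨e ⟨x, hxδ⟩, Subtype.ext (by simp)⟩
        · rintro ⟨t, rfl⟩
          exact Subtype.ext (hδ (e.symm t).2) }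
  have hbd : ∀ t : I, t = 0 ∨ t = 1 → (D.θ t : S3) ∈ M.K := fun t ht => by
    have h1 : (D.θ t : S3) ∈ arcEndpoints M.δ := (mem_arcEndpoints_iff e t).2 ht
    rw [hend] at h1
    exact h1.2
  refine ⟨D, ⟨(hsurf.2.2.2.2 _ (hbd 0 (Or.inl rfl))).exists_chart,
    (hsurf.2.2.2.2 _ (hbd 1 (Or.inr rfl))).exists_chart, fun t h0 h1 => ?_⟩, fun _ => rfl⟩
  refine (hsurf.2.2.2.1 _ ⟨(D.θ t).2, fun hK => ?_⟩).exists_chart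
  have h2 : (e.symm t : S3) ∈ arcEndpoints M.δ := by
    rw [hend]
    exact ⟨hδ (e.symm t).2, hK⟩
  exact ((mem_arcEndpoints_iff e t).1 h2).elim h0 h1

lemma hasBetti1_iff {S : Set S3} [PathConnectedSpace S] (x : S) (b : ℕ) :
    HasBetti1 S b ↔ Nonempty (FundamentalGroup S x ≃* FreeGroup (Fin b)) := by
  constructor
  · rintro ⟨y, ⟨f⟩⟩
    exact ⟨(FundamentalGroup.fundamentalGroupMulEquivOfPathConnected x y).trans f⟩
  · exact fun h => ⟨x, h⟩

lemma sInf_eq_two_mul_sInf {P Q : Set ℕ} (h1 : ∀ b ∈ Q, 2 * b ∈ P)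
    (h2 : ∀ b ∈ P, ∃ b', b = 2 * b' ∧ b' ∈ Q) : sInf P = 2 * sInf Q := by
  rcases Q.eq_empty_or_nonempty with rfl | hQ
  · have : P = ∅ := eq_empty_iff_forall_notMem.2 fun b hb => by
      obtain ⟨_, -, h⟩ := h2 b hb
      exact h
    simp [this]
  · refine le_antisymm (Nat.sInf_le (h1 _ (Nat.sInf_mem hQ))) ?_
    obtain ⟨b', h3, h4⟩ := h2 _ (Nat.sInf_mem ⟨_, h1 _ (Nat.sInf_mem hQ)⟩)
    rw [h3]
    exact Nat.mul_le_mul_left 2 (Nat.sInf_le h4)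

end InvariantSurface

/-- For an invariant Seifert surface `S` of a marked strongly invertible
knot `(K,h,δ)` and its image `Š = π(S)` under the quotient projection, the first Betti
numbers satisfy `β₁(S) = 2 β₁(Š)`. -/
theorem betti_of_invariant_Seifert_surface_eq_twice_quotient (M : MarkedSIK)
    (π : S3 → S3) (hπ : IsQuotProj M.h π) (S : Set S3)
    (hS : IsInvariantSeifertSurface M.K M.h M.δ S) :
    betti1 S = 2 * betti1 (π '' S) := by
  obtain ⟨D, hD, hDh⟩ := M.exists_arcInvolution hS
  have hsurf : IsSurfaceWithBoundary S M.K := hS.1.1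
  have : CompactSpace S := isCompact_iff_compactSpace.1 hsurf.1
  have : ConnectedSpace S := isConnected_iff_connectedSpace.1 hsurf.2.1
  have hX : HasCharts S := hsurf.hasCharts
  have hS_path : PathConnectedSpace S := hX.pathConnectedSpace
  let q : S → (π '' S : Set S3) := fun x => ⟨π x, mem_image_of_mem π x.2⟩
  have hq : Continuous q := (hπ.1.comp continuous_subtype_val).subtype_mk _
  have hqs : Surjective q := by
    rintro ⟨_, x, hx, rfl⟩
    exact ⟨⟨x, hx⟩, rfl⟩
  have hqh : ∀ x y, q x = q y ↔ y = x ∨ y = D.h x := fun x y => by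
    rw [Subtype.ext_iff, Subtype.ext_iff (a1 := y), Subtype.ext_iff (a1 := y), hDh]
    exact hπ.2.2 x y
  have hY_path : PathConnectedSpace (π '' S : Set S3) := hqs.pathConnectedSpace hq
  obtain ⟨s, hs, hsτ⟩ := D.exists_section hX hD
  have key := free_rank_double D.τ_τ (D.quotHom_surjective hq hqs hqh) (D.quotHom_τ hq hqh)
    (fun A _ Ψ hΨ => D.exists_factor hX hq hqs hqh Ψ hΨ) hs hsτ
  refine sInf_eq_two_mul_sInf (fun b hb => ?_) fun b hb => ?_
  · exact (hasBetti1_iff (D.θ 0) _).2 ((key b).1 ((hasBetti1_iff (q (D.θ 0)) b).1 hb))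
  · obtain ⟨b', h1, h2⟩ := (key b).2 ((hasBetti1_iff (D.θ 0) b).1 hb)
    exact ⟨b', h1, (hasBetti1_iff (q (D.θ 0)) b').2 h2⟩

end
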